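/- arXiv:2210.07112 — 3 statements merged into one kernel-verified Lean document; each statement's English description precedes it below -/
import Mathlib

section
/- For every bounded continuous function h : ℝ² → ℝ, the limit as m → ∞ of m^{-(n-1)} · ∑_{a ∈ L_m} h(dinv_m(a)/m, area_m(a)/m) exists and equals ∫_{ℝ²} h dμ_n. (Equivalently, the normalized discrete measures m^{-(n-1)} ∑_{a ∈ L_m} δ_{(dinv_m(a)/m, area_m(a)/m)} converge weakly to the q,t-Catalan measure μ_n.) -/
open MeasureTheory Finset Filter

noncomputable section

/-- `sc x = max (1 - |x|) 0`. -/
def sc (x : ℝ) : ℝ := max (1 - |x|) 0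

/-- Extend `a : Fin k → ℝ` (thought of as coordinates `a_1, …, a_k`) to an ℕ-indexed
vector with the convention `a_0 = 0` (and value `0` beyond index `k`). -/
def cext {k : ℕ} (a : Fin k → ℝ) (i : ℕ) : ℝ :=
  if h : 1 ≤ i ∧ i ≤ k then a ⟨i - 1, by omega⟩ else 0

/-- The area polytope `A_n ⊆ ℝ^{n-1}`. -/
def areaPoly (n : ℕ) : Set (Fin (n - 1) → ℝ) :=
  {a | ∀ i < n - 1, 0 ≤ cext a (i + 1) ∧ cext a (i + 1) ≤ cext a i + 1}

/-- The bounce polytope `B_n ⊆ ℝ^{n-1}`. -/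
def bouncePoly (n : ℕ) : Set (Fin (n - 1) → ℝ) :=
  {b | ∀ i < n - 1, cext b i ≤ cext b (i + 1) ∧ cext b (i + 1) ≤ cext b i + 1}

/-- `area(a) = ∑_{i=0}^{n-1} a_i`. -/
def area (n : ℕ) (a : Fin (n - 1) → ℝ) : ℝ := ∑ i ∈ Finset.range n, cext a i

/-- `dinv(a) = ∑_{0 ≤ i < j ≤ n-1} sc(a_i - a_j)`. -/
def dinv (n : ℕ) (a : Fin (n - 1) → ℝ) : ℝ :=
  ∑ j ∈ Finset.range n, ∑ i ∈ Finset.range j, sc (cext a i - cext a j)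

/-- The `q,t`-Catalan measure `μ_n`: pushforward of Lebesgue measure restricted to `A_n`
under `a ↦ (dinv a, area a)`. -/
def qtMeasure (n : ℕ) : Measure (ℝ × ℝ) :=
  Measure.map (fun a => (dinv n a, area n a)) (volume.restrict (areaPoly n))

/-- `sc_m : ℤ → ℤ`. -/
def scm (m : ℕ) (p : ℤ) : ℤ :=
  if 1 ≤ p ∧ p ≤ (m : ℤ) then (m : ℤ) + 1 - p
  else if -(m : ℤ) ≤ p ∧ p ≤ 0 then (m : ℤ) + p
  else 0

/-- `dinv_m(a) = ∑_{0 ≤ i < j ≤ n-1} sc_m(a_i - a_j)` for `a ∈ ℤ^n`. -/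
def dinvm (n m : ℕ) (a : Fin n → ℤ) : ℤ :=
  ∑ j : Fin n, ∑ i ∈ Finset.univ.filter (· < j), scm m (a i - a j)

/-- `area_m(a) = ∑_{i=0}^{n-1} a_i` for `a ∈ ℤ^n`. -/
def aream (n : ℕ) (a : Fin n → ℤ) : ℤ := ∑ i, a i


theorem my_cext_cont {k : ℕ} (i : ℕ) : Continuous (fun a : Fin k → ℝ => cext a i) := by
  unfold cext
  split_ifs
  · exact continuous_apply _
  · exact continuous_const

theorem my_area_cont (n : ℕ) : Continuous (area n) := by
  unfold area
  exact continuous_finsetSum _ fun i _ => my_cext_cont i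

theorem my_dinv_cont (n : ℕ) : Continuous (dinv n) := by
  unfold dinv sc
  refine continuous_finsetSum _ fun j _ => continuous_finsetSum _ fun i _ => ?_
  have h1 := my_cext_cont (k := n - 1) i
  have h2 := my_cext_cont (k := n - 1) j
  fun_prop

theorem my_cext_add {k : ℕ} (a b : Fin k → ℝ) (s t : ℝ) (i : ℕ) :
    cext (s • a + t • b) i = s * cext a i + t * cext b i := by
  unfold cext
  split_ifs <;> simp

theorem my_poly_closed (n : ℕ) : IsClosed (areaPoly n) := by
  unfold areaPoly
  simp only [Set.ofPred_forall, Set.ofPred_and]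
  refine isClosed_iInter fun i => isClosed_iInter fun _ => IsClosed.inter ?_ ?_
  · exact isClosed_le continuous_const (my_cext_cont _)
  · exact isClosed_le (my_cext_cont _) ((my_cext_cont _).add continuous_const)

theorem my_poly_convex (n : ℕ) : Convex ℝ (areaPoly n) := by
  intro a ha b hb s t hs ht hst i hi
  obtain ⟨h1, h2⟩ := ha i hi
  obtain ⟨h3, h4⟩ := hb i hi
  rw [my_cext_add, my_cext_add]
  constructor
  · positivity
  · nlinarith [mul_le_mul_of_nonneg_left h2 hs, mul_le_mul_of_nonneg_left h4 ht]

theorem my_poly_bdd (n : ℕ) : Bornology.IsBounded (areaPoly n) := by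
  have key : ∀ a ∈ areaPoly n, ∀ i : ℕ, i ≤ n - 1 → 0 ≤ cext a i ∧ cext a i ≤ i := by
    intro a ha i
    induction i with
    | zero => intro _; simp [cext]
    | succ i ih =>
      intro hi
      have h1 := ih (by omega)
      have h2 := ha i (by omega)
      push_cast
      exact ⟨h2.1, by linarith [h2.2, h1.2]⟩
  refine (Metric.isBounded_Icc (0 : Fin (n-1) → ℝ) (fun _ => (n : ℝ))).subset ?_
  intro a ha
  have e : ∀ k : Fin (n-1), a k = cext a (k + 1) := by
    intro k
    have := k.2
    unfold cext
    rw [dif_pos (by omega)]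
    rfl
  constructor
  · intro k
    have := k.2
    rw [e k]; exact (key a ha (k+1) (by omega)).1
  · intro k
    have := k.2
    rw [e k]
    refine (key a ha (k+1) (by omega)).2.trans ?_
    have : (k : ℕ) + 1 ≤ n := by omega
    show (((k : ℕ) + 1 : ℕ) : ℝ) ≤ (n : ℝ)
    exact_mod_cast this

theorem my_scm (m : ℕ) (hm : 0 < m) (p : ℤ) :
    |(scm m p : ℝ) / m - sc ((p : ℝ) / m)| ≤ 1 / m := by
  have hm' : (0 : ℝ) < m := by exact_mod_cast hm
  have e : sc ((p : ℝ) / m) = (max ((m : ℤ) - |p|) 0 : ℤ) / m := by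
    unfold sc
    push_cast
    rw [← max_div_div_right hm'.le, sub_div, div_self hm'.ne', abs_div, abs_of_pos hm', zero_div]
  rw [e, ← sub_div, abs_div, abs_of_pos hm']
  gcongr
  have : |scm m p - max ((m : ℤ) - |p|) 0| ≤ 1 := by
    unfold scm
    grind
  exact_mod_cast this

/-- scaled vector -/
def myphi (n m : ℕ) (a : Fin n → ℤ) : Fin (n - 1) → ℝ :=
  fun k => (a ⟨k + 1, by omega⟩ : ℝ) / m

theorem my_cext_phi (n m : ℕ) (hn : 0 < n) (a : Fin n → ℤ) (h0 : a ⟨0, hn⟩ = 0) (i : Fin n) :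
    cext (myphi n m a) i = (a i : ℝ) / m := by
  obtain ⟨i, hi⟩ := i
  unfold cext myphi
  rcases i with _ | i
  · simp [h0]
  · rw [dif_pos (by simp; omega)]
    simp

theorem my_area_phi (n m : ℕ) (hn : 0 < n) (a : Fin n → ℤ) (h0 : a ⟨0, hn⟩ = 0) :
    area n (myphi n m a) = (aream n a : ℝ) / m := by
  unfold area aream
  rw [Finset.sum_range]
  push_cast
  rw [Finset.sum_div]
  exact Finset.sum_congr rfl fun i _ => my_cext_phi n m hn a h0 i

theorem my_dinv_phi (n m : ℕ) (hn : 0 < n) (hm : 0 < m) (a : Fin n → ℤ) (h0 : a ⟨0, hn⟩ = 0) :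
    |(dinvm n m a : ℝ) / m - dinv n (myphi n m a)| ≤ (n : ℝ) * n / m := by
  have e : dinv n (myphi n m a) =
      ∑ j : Fin n, ∑ i ∈ Finset.univ.filter (· < j), sc (((a i - a j : ℤ) : ℝ) / m) := by
    unfold dinv
    rw [Finset.sum_range]
    refine Finset.sum_congr rfl fun j _ => ?_
    symm
    refine Finset.sum_bij (fun i _ => (i : ℕ)) ?_ ?_ ?_ ?_
    · intro i hi; simpa using hi
    · intro i _ j _ h; exact Fin.ext h
    · intro b hb
      have hb' := Finset.mem_range.1 hb
      exact ⟨⟨b, hb'.trans j.2⟩, Finset.mem_filter.2 ⟨Finset.mem_univ _, Fin.lt_def.2 hb'⟩, rfl⟩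
    · intro i _
      rw [my_cext_phi n m hn a h0, my_cext_phi n m hn a h0]
      push_cast
      rw [sub_div]
  rw [e]
  unfold dinvm
  push_cast
  simp only [Finset.sum_div, ← Finset.sum_sub_distrib]
  calc _ ≤ ∑ j : Fin n, (n : ℝ) * (1 / m) := by
        refine (Finset.abs_sum_le_sum_abs _ _).trans (Finset.sum_le_sum fun j _ => ?_)
        refine (Finset.abs_sum_le_sum_abs _ _).trans ?_
        calc _ ≤ ∑ i ∈ Finset.univ.filter (· < j), (1 : ℝ) / m := by
              refine Finset.sum_le_sum fun i _ => ?_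
              have := my_scm m hm (a i - a j)
              push_cast at this
              exact this
          _ ≤ _ := by
              rw [Finset.sum_const, nsmul_eq_mul]
              gcongr
              exact (Finset.card_le_univ _).trans (Fintype.card_fin n).le
    _ = _ := by
        rw [Finset.sum_const, Finset.card_univ, Fintype.card_fin, nsmul_eq_mul]; ring

open scoped Pointwise in
theorem my_set_eq (n m : ℕ) (hn0 : 0 < n) (hm : 0 < m) (L : Finset (Fin n → ℤ))
    (hL : ∀ a : Fin n → ℤ, a ∈ L ↔
      (a ⟨0, hn0⟩ = 0 ∧ ∀ i : ℕ, ∀ hi : i + 1 < n, ∀ hi' : i < n,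
        0 ≤ a ⟨i + 1, hi⟩ ∧ a ⟨i + 1, hi⟩ ≤ a ⟨i, hi'⟩ + (m : ℤ))) :
    areaPoly n ∩ ((m : ℝ)⁻¹ • (Submodule.span ℤ (Set.range (Pi.basisFun ℝ (Fin (n-1)))) :
      Set (Fin (n-1) → ℝ))) = (L.image (myphi n m) : Finset _) := by
  have hm' : (0 : ℝ) < m := by exact_mod_cast hm
  have hpoly : ∀ a : Fin n → ℤ, a ⟨0, hn0⟩ = 0 → (myphi n m a ∈ areaPoly n ↔ a ∈ L) := by
    intro a h0
    rw [hL]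
    simp only [h0, true_and, areaPoly, Set.mem_ofPred_eq]
    refine ⟨fun h i hi _ => ?_, fun h i hi => ?_⟩
    · have := h i (by omega)
      rw [my_cext_phi n m (by omega) a h0 ⟨i+1, hi⟩, my_cext_phi n m (by omega) a h0 ⟨i, by omega⟩,
        div_add_one hm'.ne', div_le_div_iff_of_pos_right hm', le_div_iff₀ hm', zero_mul] at this
      exact_mod_cast this
    · have := h i (by omega) (by omega)
      rw [my_cext_phi n m (by omega) a h0 ⟨i+1, by omega⟩,
        my_cext_phi n m (by omega) a h0 ⟨i, by omega⟩,
        div_add_one hm'.ne', div_le_div_iff_of_pos_right hm', le_div_iff₀ hm', zero_mul]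
      exact_mod_cast this
  ext x
  simp only [Set.mem_inter_iff, Finset.coe_image, Set.mem_image, Finset.mem_coe]
  rw [Set.mem_inv_smul_set_iff₀ hm'.ne', SetLike.mem_coe, Module.Basis.mem_span_iff_repr_mem]
  simp only [Pi.basisFun_repr, Pi.smul_apply, smul_eq_mul]
  constructor
  · rintro ⟨hx, hz⟩
    choose z hz using hz
    let a : Fin n → ℤ := fun i => if h : i.1 = 0 then 0 else z ⟨i - 1, by omega⟩
    have hphi : myphi n m a = x := by
      ext k
      have := hz k
      simp only [myphi, a]
      simp at this ⊢
      rw [this]; field_simp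
    exact ⟨a, (hpoly a (by simp [a])).1 (by rwa [hphi]), hphi⟩
  · rintro ⟨a, ha, rfl⟩
    refine ⟨(hpoly a ((hL a).1 ha).1).2 ha, fun k => ⟨a ⟨k + 1, by omega⟩, ?_⟩⟩
    simp [myphi]
    field_simp

open scoped Pointwise in
theorem my_sum_eq (n m : ℕ) (hn0 : 0 < n) (hm : 0 < m) (L : Finset (Fin n → ℤ))
    (hL : ∀ a : Fin n → ℤ, a ∈ L ↔
      (a ⟨0, hn0⟩ = 0 ∧ ∀ i : ℕ, ∀ hi : i + 1 < n, ∀ hi' : i < n,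
        0 ≤ a ⟨i + 1, hi⟩ ∧ a ⟨i + 1, hi⟩ ≤ a ⟨i, hi'⟩ + (m : ℤ)))
    (F : (Fin (n-1) → ℝ) → ℝ) :
    ∑' x : ↑(areaPoly n ∩ ((m : ℝ)⁻¹ • (Submodule.span ℤ (Set.range (Pi.basisFun ℝ (Fin (n-1)))) :
      Set (Fin (n-1) → ℝ)))), F x = ∑ a ∈ L, F (myphi n m a) := by
  have hm' : (0 : ℝ) < m := by exact_mod_cast hm
  rw [my_set_eq n m hn0 hm L hL, Finset.tsum_subtype', Finset.sum_image]
  intro a ha b hb hab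
  have ha := ((hL a).1 ha).1
  have hb := ((hL b).1 hb).1
  ext i
  have h1 := my_cext_phi n m (by omega) a ha i
  rw [hab, my_cext_phi n m (by omega) b hb i, div_left_inj' hm'.ne'] at h1
  exact_mod_cast h1.symm

theorem my_lim (n : ℕ) (hn0 : 0 < n)
    (L : ℕ → Finset (Fin n → ℤ))
    (hL : ∀ m : ℕ, ∀ a : Fin n → ℤ, a ∈ L m ↔
      (a ⟨0, hn0⟩ = 0 ∧ ∀ i : ℕ, ∀ hi : i + 1 < n, ∀ hi' : i < n,
        0 ≤ a ⟨i + 1, hi⟩ ∧ a ⟨i + 1, hi⟩ ≤ a ⟨i, hi'⟩ + (m : ℤ)))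
    (F : (Fin (n-1) → ℝ) → ℝ) (hF : Continuous F) :
    Filter.Tendsto (fun m : ℕ => ((m : ℝ) ^ (n - 1))⁻¹ * ∑ a ∈ L m, F (myphi n m a))
      atTop (nhds (∫ x in areaPoly n, F x)) := by
  have := tendsto_tsum_div_pow_atTop_integral (areaPoly n) F hF (my_poly_bdd n)
    (my_poly_closed n).measurableSet ((my_poly_convex n).addHaar_frontier volume)
  refine this.congr' ?_
  filter_upwards [eventually_gt_atTop 0] with m hm
  rw [my_sum_eq n m hn0 hm (L m) (hL m), Fintype.card_fin, div_eq_inv_mul]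

/-- Theorem (weak convergence of normalized higher q,t-Catalan discrete measures to μ_n):
for every bounded continuous `h : ℝ² → ℝ`, the limit as `m → ∞` of
`m^{-(n-1)} ∑_{a ∈ L_m} h(dinv_m(a)/m, area_m(a)/m)` equals `∫ h dμ_n`. -/
theorem qtMeasure_weak_limit (n : ℕ) (hn : 2 ≤ n)
    (L : ℕ → Finset (Fin n → ℤ))
    (hL : ∀ m : ℕ, ∀ a : Fin n → ℤ, a ∈ L m ↔
      (a ⟨0, by omega⟩ = 0 ∧ ∀ i : ℕ, ∀ hi : i + 1 < n,
        0 ≤ a ⟨i + 1, hi⟩ ∧ a ⟨i + 1, hi⟩ ≤ a ⟨i, by omega⟩ + (m : ℤ)))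
    (h : ℝ × ℝ → ℝ) (hcont : Continuous h) (hbdd : ∃ C : ℝ, ∀ p, |h p| ≤ C) :
    Filter.Tendsto
      (fun m : ℕ => ((m : ℝ) ^ (n - 1))⁻¹ *
        ∑ a ∈ L m, h ((dinvm n m a : ℝ) / m, (aream n a : ℝ) / m))
      Filter.atTop (nhds (∫ p, h p ∂(qtMeasure n))) := by
  have hn0 : 0 < n := by omega
  replace hL : ∀ m : ℕ, ∀ a : Fin n → ℤ, a ∈ L m ↔
      (a ⟨0, hn0⟩ = 0 ∧ ∀ i : ℕ, ∀ hi : i + 1 < n, ∀ hi' : i < n,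
        0 ≤ a ⟨i + 1, hi⟩ ∧ a ⟨i + 1, hi⟩ ≤ a ⟨i, hi'⟩ + (m : ℤ)) := by
    intro m a
    rw [hL m a]
    exact ⟨fun h => ⟨h.1, fun i hi _ => h.2 i hi⟩, fun h => ⟨h.1, fun i hi => h.2 i hi _⟩⟩
  have hFc : Continuous (fun a => h (dinv n a, area n a)) :=
    hcont.comp ((my_dinv_cont n).prodMk (my_area_cont n))
  have hint : ∫ p, h p ∂(qtMeasure n) = ∫ a in areaPoly n, h (dinv n a, area n a) := by
    unfold qtMeasure
    exact integral_map ((my_dinv_cont n).prodMk (my_area_cont n)).aemeasurable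
      hcont.aestronglyMeasurable
  rw [hint]
  have hmain := my_lim n hn0 L hL _ hFc
  have hone := my_lim n hn0 L hL (fun _ => 1) continuous_const
  set V := ∫ x in areaPoly n, (1 : ℝ) with hV
  have hV0 : 0 ≤ V := integral_nonneg fun _ => zero_le_one
  have hK : IsCompact ((fun a => (dinv n a, area n a)) '' areaPoly n) :=
    (Metric.isCompact_of_isClosed_isBounded (my_poly_closed n) (my_poly_bdd n)).image
      ((my_dinv_cont n).prodMk (my_area_cont n))
  have hdiff : Tendsto (fun m : ℕ => ((m : ℝ) ^ (n - 1))⁻¹ *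
        ∑ a ∈ L m, h ((dinvm n m a : ℝ) / m, (aream n a : ℝ) / m) -
        ((m : ℝ) ^ (n - 1))⁻¹ * ∑ a ∈ L m, h (dinv n (myphi n m a), area n (myphi n m a)))
      atTop (nhds 0) := by
    rw [Metric.tendsto_nhds]
    intro ε hε
    have hδ : 0 < ε / (V + 1) := by positivity
    have hu := hK.uniformContinuousAt_of_continuousAt h (fun a _ => hcont.continuousAt)
      (Metric.dist_mem_uniformity hδ)
    obtain ⟨δ, hδ0, hu⟩ := Metric.mem_uniformity_dist.1 hu
    have hlim : Tendsto (fun m : ℕ => (n : ℝ) * n / m) atTop (nhds 0) :=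
      tendsto_const_div_atTop_nhds_zero_nat _
    filter_upwards [eventually_gt_atTop 0, hlim.eventually_lt_const hδ0,
      hone.eventually_lt_const (lt_add_one V)] with m hm hmδ hcard
    have hm' : (0 : ℝ) < m := by exact_mod_cast hm
    rw [Real.dist_0_eq_abs, ← mul_sub, ← Finset.sum_sub_distrib, abs_mul,
      abs_of_pos (by positivity)]
    calc _ ≤ ((m : ℝ) ^ (n - 1))⁻¹ * ∑ a ∈ L m, (ε / (V + 1)) * 1 := by
          gcongr
          refine (Finset.abs_sum_le_sum_abs _ _).trans (Finset.sum_le_sum fun a ha => ?_)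
          have h0 := ((hL m a).1 ha).1
          have hmem : myphi n m a ∈ areaPoly n := by
            have : myphi n m a ∈ ((L m).image (myphi n m) : Set (Fin (n-1) → ℝ)) := by
              simpa using ⟨a, ha, rfl⟩
            rw [← my_set_eq n m hn0 hm (L m) (hL m)] at this
            exact this.1
          have hd : dist (dinv n (myphi n m a), area n (myphi n m a))
              ((dinvm n m a : ℝ) / m, (aream n a : ℝ) / m) < δ := by
            rw [Prod.dist_eq, my_area_phi n m (by omega) a h0, dist_self, dist_comm, Real.dist_eq]
            exact max_lt ((my_dinv_phi n m (by omega) hm a h0).trans_lt hmδ) hδ0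
          have := hu hd ⟨_, hmem, rfl⟩
          simp only [Set.mem_ofPred_eq] at this
          rw [dist_comm, Real.dist_eq] at this
          rw [mul_one]
          exact this.le
      _ = (ε / (V + 1)) * (((m : ℝ) ^ (n - 1))⁻¹ * ∑ a ∈ L m, 1) := by
          rw [← Finset.mul_sum]; ring
      _ < (ε / (V + 1)) * (V + 1) := by gcongr
      _ = ε := by field_simp
  simpa using hdiff.add hmain
end
end

section
/- The q,t-Catalan measure μ_n is symmetric about the line y = x: the pushforward of μ_n under the swap map (x, y) ↦ (y, x) on ℝ² equals μ_n. -/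
open MeasureTheory Finset Filter

noncomputable section

set_option linter.unusedSectionVars false
set_option linter.unusedVariables false
set_option linter.unusedSimpArgs false
namespace QT
open Equiv Equiv.Perm

variable {ι : Type*} [Fintype ι] [DecidableEq ι]

lemma pow_mod_apply {π : Perm ι} {i : ι} {k : ℕ} (h : (π ^ k) i = i) (m : ℕ) :
    (π ^ m) i = (π ^ (m % k)) i := by
  conv_lhs => rw [← Nat.mod_add_div m k, pow_add, pow_mul, Perm.mul_apply]
  congr 1
  have : ∀ q : ℕ, ((π ^ k) ^ q) i = i := by
    intro q
    induction q with
    | zero => simp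
    | succ q ih => rw [pow_succ, Perm.mul_apply, h, ih]
  exact this _

lemma sameCycle_nat {π : Perm ι} {i j : ι} : SameCycle π i j ↔ ∃ m : ℕ, (π ^ m) i = j := by
  constructor
  · intro h
    obtain ⟨m, _, hm⟩ := h.exists_pow_eq'
    exact ⟨m, hm⟩
  · rintro ⟨m, hm⟩
    exact ⟨m, by simpa using hm⟩

lemma same_swap {π : Perm ι} {i j : ι} (hij : i ≠ j) :
    SameCycle (π * swap i j) i j ↔ ¬ SameCycle π i j := by
  classical
  have hex : ∃ k : ℕ, 0 < k ∧ ((π ^ k) i = i ∨ (π ^ k) i = j) :=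
    ⟨orderOf π, orderOf_pos π, Or.inl (by simp [pow_orderOf_eq_one])⟩
  obtain ⟨k, ⟨hk0, hk⟩, hmin⟩ : ∃ k : ℕ, (0 < k ∧ ((π ^ k) i = i ∨ (π ^ k) i = j)) ∧
      ∀ m, 0 < m → m < k → (π ^ m) i ≠ i ∧ (π ^ m) i ≠ j := by
    refine ⟨Nat.find hex, Nat.find_spec hex, fun m hm hmk => ?_⟩
    have := Nat.find_min hex hmk
    tauto
  set σ := π * swap i j with hσ
  have hs : ∀ m, 0 < m → m ≤ k → (σ ^ m) j = (π ^ m) i := by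
    intro m hm
    induction m, hm using Nat.le_induction with
    | base => intro _; simp [hσ]
    | succ m hm ih =>
      intro hmk
      have h1 := hmin m hm (by omega)
      rw [pow_succ', Perm.mul_apply, ih (by omega), hσ, Perm.mul_apply,
        swap_apply_of_ne_of_ne h1.1 h1.2, pow_succ' π, Perm.mul_apply]
  rcases hk with hk | hk
  · have h1 : SameCycle σ i j := by
      refine SameCycle.symm (sameCycle_nat.2 ⟨k, ?_⟩)
      rw [hs k hk0 le_rfl, hk]
    have h2 : ¬ SameCycle π i j := by
      rw [sameCycle_nat]
      rintro ⟨m, hm⟩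
      rw [pow_mod_apply hk] at hm
      rcases Nat.eq_zero_or_pos (m % k) with h0 | h0
      · rw [h0] at hm; simp at hm; exact hij hm
      · exact (hmin _ h0 (Nat.mod_lt _ hk0)).2 hm
    tauto
  · have h1 : SameCycle π i j := sameCycle_nat.2 ⟨k, hk⟩
    have h2 : ¬ SameCycle σ i j := by
      rw [sameCycle_comm, sameCycle_nat]
      rintro ⟨m, hm⟩
      rw [pow_mod_apply (k := k) (by rw [hs k hk0 le_rfl, hk])] at hm
      rcases Nat.eq_zero_or_pos (m % k) with h0 | h0
      · rw [h0] at hm; simp at hm; exact hij hm.symm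
      · have hlt := Nat.mod_lt m hk0
        rw [hs _ h0 hlt.le] at hm
        exact (hmin _ h0 hlt).1 hm
    tauto

/-- invariant two-colourings -/
def fixB (π : Perm ι) : Finset (ι → Bool) := Finset.univ.filter (fun κ => ∀ x, κ (π x) = κ x)

def ell (π : Perm ι) : ℕ := Nat.log 2 (fixB π).card

lemma inv_same {C : Type*} {π : Perm ι} {κ : ι → C} (h : ∀ x, κ (π x) = κ x) {a b : ι}
    (hab : SameCycle π a b) : κ a = κ b := by
  obtain ⟨m, rfl⟩ := sameCycle_nat.1 hab
  induction m with
  | zero => simp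
  | succ m ih =>
    rw [pow_succ', Perm.mul_apply, h]
    exact ih (sameCycle_nat.2 ⟨m, rfl⟩)

lemma fixB_card {π : Perm ι} {i j : ι} (hij : i ≠ j) (h : ¬ SameCycle π i j) :
    (fixB π).card = 2 * (fixB (π * swap i j)).card := by
  classical
  have hσ := (same_swap (π := π) hij).2 h
  have e1 : fixB (π * swap i j) = (fixB π).filter (fun κ => κ i = κ j) := by
    ext κ
    simp only [fixB, Finset.mem_filter, Finset.mem_univ, true_and]
    constructor
    · intro hκ
      have hh := inv_same hκ hσ
      refine ⟨fun x => ?_, hh⟩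
      have h1 := hκ (swap i j x)
      simp only [Perm.mul_apply, swap_apply_self] at h1
      rw [h1]
      by_cases hi : x = i
      · subst hi; simp [hh]
      · by_cases hj : x = j
        · subst hj; simp [hh]
        · rw [swap_apply_of_ne_of_ne hi hj]
    · rintro ⟨h1, h2⟩ x
      rw [Perm.mul_apply, h1]
      by_cases hi : x = i
      · subst hi; simp [h2]
      · by_cases hj : x = j
        · subst hj; simp [h2]
        · rw [swap_apply_of_ne_of_ne hi hj]
  have e2 : ((fixB π).filter (fun κ => κ i = κ j)).card =
      ((fixB π).filter (fun κ => ¬ κ i = κ j)).card := by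
    let φ : (ι → Bool) → (ι → Bool) := fun κ x => if SameCycle π i x then !(κ x) else κ x
    have hφφ : ∀ κ, φ (φ κ) = κ := by
      intro κ; funext x; simp only [φ]; split_ifs <;> simp
    have hφ : ∀ κ, κ ∈ fixB π → φ κ ∈ fixB π := by
      intro κ hκ
      simp only [fixB, Finset.mem_filter, Finset.mem_univ, true_and] at hκ ⊢
      intro x
      simp only [φ, sameCycle_apply_right, hκ]
    have hi : ∀ κ, φ κ i = !(κ i) := by intro κ; simp [φ, SameCycle.refl]
    have hj : ∀ κ, φ κ j = κ j := by intro κ; simp [φ, h]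
    refine Finset.card_bij' (fun κ _ => φ κ) (fun κ _ => φ κ) ?_ ?_ ?_ ?_
    · intro κ hκ
      rw [Finset.mem_filter] at hκ ⊢
      refine ⟨hφ _ hκ.1, ?_⟩
      rw [hi, hj, hκ.2]; simp
    · intro κ hκ
      rw [Finset.mem_filter] at hκ ⊢
      refine ⟨hφ _ hκ.1, ?_⟩
      rw [hi, hj]
      have := hκ.2
      revert this
      cases κ i <;> cases κ j <;> simp
    · intro κ _; exact hφφ κ
    · intro κ _; exact hφφ κ
  rw [e1, ← Finset.card_filter_add_card_filter_not (s := fixB π) (p := fun κ => κ i = κ j), ← e2]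
  ring

lemma fixB_ne (π : Perm ι) : (fixB π).card ≠ 0 := by
  rw [← Nat.pos_iff_ne_zero, Finset.card_pos]
  exact ⟨fun _ => true, by simp [fixB]⟩

lemma ell_diff {π : Perm ι} {i j : ι} (hij : i ≠ j) (h : ¬ SameCycle π i j) :
    ell π = ell (π * swap i j) + 1 := by
  unfold ell
  rw [fixB_card hij h, mul_comm, Nat.log_mul_base (by norm_num) (fixB_ne _)]

lemma ell_same {π : Perm ι} {i j : ι} (hij : i ≠ j) (h : SameCycle π i j) :
    ell (π * swap i j) = ell π + 1 := by
  have h1 : ¬ SameCycle (π * swap i j) i j := by rw [same_swap hij]; tauto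
  have := ell_diff hij h1
  rwa [mul_assoc, swap_mul_self, mul_one] at this

lemma ell_one : ell (1 : Perm ι) = Fintype.card ι := by
  unfold ell fixB
  simp [Finset.card_univ]

lemma ell_cycle {π : Perm ι} [Nonempty ι] (h : ∀ a b, SameCycle π a b) : ell π = 1 := by
  have : fixB π = {fun _ => true, fun _ => false} := by
    ext κ
    simp only [fixB, Finset.mem_filter, Finset.mem_univ, true_and, Finset.mem_insert,
      Finset.mem_singleton]
    constructor
    · intro hκ
      obtain ⟨a⟩ := ‹Nonempty ι›
      have : ∀ b, κ b = κ a := fun b => inv_same hκ (h b a)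
      cases hh : κ a
      · right; funext b; rw [this, hh]
      · left; funext b; rw [this, hh]
    · rintro (rfl | rfl) <;> simp
  unfold ell
  rw [this, Finset.card_pair]
  · norm_num
  · obtain ⟨a⟩ := ‹Nonempty ι›
    intro h; simpa using congrFun h a

end QT

namespace QT
open Equiv Equiv.Perm

variable {ι : Type*} [Fintype ι] [DecidableEq ι] {C : Type*} [DecidableEq C]

lemma pow_eq_iff_of_orbits {σ π : Perm ι} {r : ι}
    (h : ∀ b, SameCycle σ r b ↔ SameCycle π r b) (a b : ℕ) :
    (σ ^ a) r = (σ ^ b) r ↔ (π ^ a) r = (π ^ b) r := by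
  classical
  have key : ∀ τ : Perm ι, (τ ^ a) r = (τ ^ b) r ↔
      ((Function.minimalPeriod (τ • ·) r : ℕ) : ℤ) ∣ (a : ℤ) - b := by
    intro τ
    rw [← MulAction.zpow_smul_eq_iff_minimalPeriod_dvd]
    have : (τ ^ ((a : ℤ) - b)) = (τ ^ b)⁻¹ * τ ^ a := by
      rw [zpow_sub, zpow_natCast, zpow_natCast, ← zpow_natCast, ← zpow_natCast, ← zpow_neg, ← zpow_add, ← zpow_add, add_comm]
    rw [this, Perm.smul_def, Perm.mul_apply, Perm.inv_eq_iff_eq]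
  rw [key, key]
  have hc : ∀ τ : Perm ι, Function.minimalPeriod (τ • ·) r =
      (Finset.univ.filter (fun b => SameCycle τ r b)).card := by
    intro τ
    rw [MulAction.minimalPeriod_eq_card, ← Fintype.card_coe]
    apply Fintype.card_congr
    refine Equiv.subtypeEquivRight ?_
    intro x
    rw [MulAction.mem_orbit_iff]
    simp only [Finset.mem_filter, Finset.mem_univ, true_and]
    constructor
    · rintro ⟨⟨g, k, rfl⟩, hg⟩
      exact ⟨k, hg⟩
    · rintro ⟨k, hk⟩
      exact ⟨⟨τ ^ k, k, rfl⟩, hk⟩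
  rw [hc, hc]
  simp only [h]

lemma conj_of_orbits {σ π : Perm ι}
    (h : ∀ a b, SameCycle σ a b ↔ SameCycle π a b) : ∃ g : Perm ι, g * σ * g⁻¹ = π := by
  classical
  let rep : ι → ι := fun x => (Quotient.mk (SameCycle.setoid σ) x).out
  have hrep : ∀ x, SameCycle σ (rep x) x := by
    intro x
    exact Quotient.exact (s := SameCycle.setoid σ) (Quotient.out_eq _)
  have hrr : ∀ x y, SameCycle σ x y → rep x = rep y := by
    intro x y hxy
    simp only [rep]
    rw [Quotient.sound (s := SameCycle.setoid σ) hxy]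
  choose m hm using fun x => sameCycle_nat.1 (hrep x)
  let g : ι → ι := fun x => (π ^ (m x)) (rep x)
  have hg1 : ∀ x, SameCycle σ x (g x) := by
    intro x
    have h1 : SameCycle π (rep x) (g x) := sameCycle_nat.2 ⟨m x, rfl⟩
    exact (hrep x).symm.trans ((h _ _).2 h1)
  have hinj : Function.Injective g := by
    intro x y hxy
    have hxy' : SameCycle σ x y := (hg1 x).trans (by rw [hxy]; exact (hg1 y).symm)
    have hr := hrr x y hxy'
    have h2 : (π ^ (m x)) (rep x) = (π ^ (m y)) (rep x) := by
      conv_rhs => rw [hr]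
      exact hxy
    rw [← pow_eq_iff_of_orbits (h (rep x))] at h2
    rw [← hm x, ← hm y, h2, hr]
  have hgs : ∀ x, g (σ x) = π (g x) := by
    intro x
    have hr : rep (σ x) = rep x := hrr _ _ (by simpa using SameCycle.refl σ x)
    simp only [g]
    rw [hr, ← Perm.mul_apply, ← pow_succ', ← pow_eq_iff_of_orbits (h (rep x)), pow_succ', Perm.mul_apply, hm x]
    rw [← hr, hm]
  refine ⟨Equiv.ofBijective g (Finite.injective_iff_bijective.1 hinj), ?_⟩
  rw [mul_inv_eq_iff_eq_mul]
  ext x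
  simp [hgs]

/-- Young subgroup of a colouring -/
def yng (κ : ι → C) : Finset (Perm ι) := Finset.univ.filter (fun π => ∀ x, κ (π x) = κ x)

lemma mem_yng {κ : ι → C} {π : Perm ι} : π ∈ yng κ ↔ ∀ x, κ (π x) = κ x := by
  simp [yng]

def sg (π : Perm ι) : ℝ := ((Perm.sign π : ℤ) : ℝ)

lemma sg_mul (π σ : Perm ι) : sg (π * σ) = sg π * sg σ := by simp [sg]
lemma sg_swap {i j : ι} (h : i ≠ j) : sg (swap i j) = -1 := by simp [sg, h]
lemma sg_ne (π : Perm ι) : sg π ≠ 0 := by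
  simp [sg]
lemma sg_one : sg (1 : Perm ι) = 1 := by simp [sg]

def HT (G : Perm ι → ℝ) (κ : ι → C) : ℝ := ∑ π ∈ yng κ, sg π * G π

def IsCl (G : Perm ι → ℝ) : Prop := ∀ g π : Perm ι, G (g * π * g⁻¹) = G π

lemma IsCl.comm {G : Perm ι → ℝ} (h : IsCl G) (a b : Perm ι) : G (a * b) = G (b * a) := by
  have := h a (b * a)
  rw [← this]; congr 1; group

lemma HT_inj {R : Perm ι → ℝ} (hR : IsCl R) (h : ∀ κ : ι → ι, HT R κ = 0) : ∀ σ, R σ = 0 := by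
  classical
  suffices H : ∀ N : ℕ, ∀ σ : Perm ι, Fintype.card (ι → Bool) - (fixB σ).card = N → R σ = 0 from
    fun σ => H _ σ rfl
  intro N
  induction N using Nat.strong_induction_on with
  | _ N ih =>
  intro σ hσ
  let rep : ι → ι := fun x => (Quotient.mk (SameCycle.setoid σ) x).out
  have hrep : ∀ x y, rep x = rep y ↔ SameCycle σ x y := by
    intro x y
    simp only [rep]
    rw [Quotient.out_inj, Quotient.eq (r := SameCycle.setoid σ)]
    rfl
  have key : ∀ π ∈ yng rep, sg π * R π =
      if ∀ a b, SameCycle σ a b ↔ SameCycle π a b then sg σ * R σ else 0 := by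
    intro π hπ
    rw [mem_yng] at hπ
    split_ifs with hh
    · obtain ⟨g, hg⟩ := conj_of_orbits hh
      rw [← hg, hR, sg_mul, sg_mul]
      have : sg g * sg g⁻¹ = 1 := by rw [← sg_mul]; simp [sg_one]
      rw [show sg g * sg σ * sg g⁻¹ = (sg g * sg g⁻¹) * sg σ by ring, this, one_mul]
    · have hle : ∀ a b, SameCycle π a b → SameCycle σ a b := by
        intro a b hab
        exact (hrep a b).1 (inv_same hπ hab)
      have : ∃ a b, SameCycle σ a b ∧ ¬ SameCycle π a b := by
        by_contra hcon
        push Not at hcon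
        exact hh fun a b => ⟨hcon a b, hle a b⟩
      obtain ⟨a, b, h1, h2⟩ := this
      have hlt : (fixB σ).card < (fixB π).card := by
        apply Finset.card_lt_card
        rw [Finset.ssubset_iff_of_subset]
        · refine ⟨fun x => decide (SameCycle π a x), ?_, ?_⟩
          · simp [fixB]
          · intro hmem
            simp only [fixB, Finset.mem_filter, Finset.mem_univ, true_and] at hmem
            have := inv_same (κ := fun x => decide (SameCycle π a x)) hmem h1
            simp [SameCycle.refl, h2] at this
        · intro κ hκ
          simp only [fixB, Finset.mem_filter, Finset.mem_univ, true_and] at hκ ⊢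
          intro x
          exact (inv_same hκ (hle x (π x) (by simpa using SameCycle.refl π x))).symm
      have hle2 : (fixB π).card ≤ Fintype.card (ι → Bool) := Finset.card_le_univ _
      rw [ih _ (by omega) π rfl, mul_zero]
  have h0 := h rep
  unfold HT at h0
  rw [Finset.sum_congr rfl key, ← Finset.sum_filter, Finset.sum_const, nsmul_eq_mul] at h0
  have hc : ((yng rep).filter (fun π => ∀ a b, SameCycle σ a b ↔ SameCycle π a b)).card ≠ 0 := by
    rw [← Nat.pos_iff_ne_zero, Finset.card_pos]
    refine ⟨σ, ?_⟩
    rw [Finset.mem_filter, mem_yng]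
    refine ⟨fun x => (hrep _ _).2 (by simpa using SameCycle.refl σ x), fun a b => Iff.rfl⟩
  have hc' : ((((yng rep).filter (fun π => ∀ a b, SameCycle σ a b ↔ SameCycle π a b)).card : ℕ) : ℝ) ≠ 0 := by
    exact_mod_cast hc
  have h3 := (mul_eq_zero.1 h0).resolve_left hc'
  exact (mul_eq_zero.1 h3).resolve_left (sg_ne σ)

open Classical in
/-- pair contribution of the evolution -/
def rr (s t : ℝ) (G : Perm ι → ℝ) (i j : ι) (π : Perm ι) : ℝ :=
  t * (if SameCycle π i j then G (π * swap i j) - G π else 0)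
    - s * (if SameCycle π i j then G π else G (π * swap i j))

def QQ (G : Perm ι → ℝ) (κ : ι → C) (i j : ι) : ℝ := ∑ π ∈ yng κ, sg π * G (π * swap i j)

lemma swap_mem_yng {κ : ι → C} {i j : ι} (h : κ i = κ j) : swap i j ∈ yng κ := by
  rw [mem_yng]; intro x
  by_cases hi : x = i
  · subst hi; simp [h]
  · by_cases hj : x = j
    · subst hj; simp [h]
    · rw [swap_apply_of_ne_of_ne hi hj]

lemma mul_mem_yng {κ : ι → C} {a b : Perm ι} (ha : a ∈ yng κ) (hb : b ∈ yng κ) : a * b ∈ yng κ := by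
  rw [mem_yng] at *; intro x; rw [Perm.mul_apply, ha, hb]

lemma sum_yng_mul_swap {κ : ι → C} {i j : ι} (h : κ i = κ j) (f : Perm ι → ℝ) :
    ∑ π ∈ yng κ, f (π * swap i j) = ∑ π ∈ yng κ, f π := by
  refine Finset.sum_bij' (fun π _ => π * swap i j) (fun π _ => π * swap i j) ?_ ?_ ?_ ?_ ?_
  · intro π hπ; exact mul_mem_yng hπ (swap_mem_yng h)
  · intro π hπ; exact mul_mem_yng hπ (swap_mem_yng h)
  · intro π _; simp [mul_assoc]
  · intro π _; simp [mul_assoc]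
  · intro π _; rfl

lemma rr_same (s t : ℝ) (G : Perm ι → ℝ) {κ : ι → C} {i j : ι} (hij : i ≠ j) (h : κ i = κ j) :
    ∑ π ∈ yng κ, sg π * rr s t G i j π = - t * HT G κ := by
  classical
  have e1 : ∑ π ∈ yng κ, sg π * (if SameCycle π i j then G (π * swap i j) else 0) =
      - ∑ π ∈ yng κ, sg π * (if SameCycle π i j then 0 else G π) := by
    rw [← sum_yng_mul_swap h, ← Finset.sum_neg_distrib]
    refine Finset.sum_congr rfl fun π _ => ?_
    rw [sg_mul, sg_swap hij, mul_assoc π, swap_mul_self, mul_one]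
    have := same_swap (π := π) hij
    by_cases h1 : SameCycle π i j
    · rw [if_pos h1, if_neg (by tauto)]; ring
    · rw [if_neg h1, if_pos (by tauto)]; ring
  have e2 : ∑ π ∈ yng κ, sg π * (if SameCycle π i j then 0 else G (π * swap i j)) =
      - ∑ π ∈ yng κ, sg π * (if SameCycle π i j then G π else 0) := by
    rw [← sum_yng_mul_swap h, ← Finset.sum_neg_distrib]
    refine Finset.sum_congr rfl fun π _ => ?_
    rw [sg_mul, sg_swap hij, mul_assoc π, swap_mul_self, mul_one]
    have := same_swap (π := π) hij
    by_cases h1 : SameCycle π i j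
    · rw [if_pos h1, if_neg (by tauto)]; ring
    · rw [if_neg h1, if_pos (by tauto)]; ring
  have e3 : ∑ π ∈ yng κ, sg π * rr s t G i j π =
      t * ∑ π ∈ yng κ, sg π * (if SameCycle π i j then G (π * swap i j) else 0)
      - t * ∑ π ∈ yng κ, sg π * (if SameCycle π i j then G π else 0)
      - s * (∑ π ∈ yng κ, sg π * (if SameCycle π i j then G π else 0)
        + ∑ π ∈ yng κ, sg π * (if SameCycle π i j then 0 else G (π * swap i j))) := by
    rw [← Finset.sum_add_distrib, Finset.mul_sum, Finset.mul_sum, Finset.mul_sum,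
      ← Finset.sum_sub_distrib, ← Finset.sum_sub_distrib]
    refine Finset.sum_congr rfl fun π _ => ?_
    unfold rr
    split_ifs <;> ring
  have e4 : HT G κ = ∑ π ∈ yng κ, sg π * (if SameCycle π i j then G π else 0)
      + ∑ π ∈ yng κ, sg π * (if SameCycle π i j then 0 else G π) := by
    rw [← Finset.sum_add_distrib]
    refine Finset.sum_congr rfl fun π _ => ?_
    split_ifs <;> ring
  rw [e3, e2, e1, e4]; ring

lemma rr_diff (s t : ℝ) (G : Perm ι → ℝ) {κ : ι → C} {i j : ι} (h : κ i ≠ κ j) :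
    ∑ π ∈ yng κ, sg π * rr s t G i j π = - s * QQ G κ i j := by
  unfold QQ
  rw [Finset.mul_sum]
  refine Finset.sum_congr rfl fun π hπ => ?_
  have : ¬ SameCycle π i j := fun hh => h (inv_same (mem_yng.1 hπ) hh)
  unfold rr
  rw [if_neg this, if_neg this]; ring

lemma yng_coset_right (κ : ι → C) (y : ι) (f : Perm ι → ℝ) :
    ∑ π ∈ yng κ, f π = ∑ j ∈ Finset.univ.filter (fun j => κ j = κ y),
      ∑ π ∈ (yng κ).filter (fun π => π y = y), f (π * swap y j) := by
  have : ∀ π ∈ yng κ, π⁻¹ y ∈ Finset.univ.filter (fun j => κ j = κ y) := by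
    intro π hπ
    rw [mem_yng] at hπ
    have := hπ (π⁻¹ y)
    rw [show π (π⁻¹ y) = y from π.apply_symm_apply y] at this
    simp [this]
  rw [← Finset.sum_fiberwise_of_maps_to this]
  refine Finset.sum_congr rfl fun j hj => ?_
  have hj' : κ y = κ j := by simpa using ((Finset.mem_filter.1 hj).2).symm
  symm
  refine Finset.sum_bij' (fun π _ => π * swap y j) (fun π _ => π * swap y j) ?_ ?_ ?_ ?_ ?_
  · intro π hπ
    rw [Finset.mem_filter] at hπ ⊢
    refine ⟨mul_mem_yng hπ.1 (swap_mem_yng hj'), ?_⟩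
    rw [Perm.inv_eq_iff_eq]; simp [hπ.2]
  · intro π hπ
    rw [Finset.mem_filter] at hπ ⊢
    refine ⟨mul_mem_yng hπ.1 (swap_mem_yng hj'), ?_⟩
    have := hπ.2
    rw [Perm.inv_eq_iff_eq] at this
    simp [← this]
  · intro π _; simp [mul_assoc]
  · intro π _; simp [mul_assoc]
  · intro π _; rfl

lemma yng_coset_left (κ : ι → C) (y : ι) (f : Perm ι → ℝ) :
    ∑ π ∈ yng κ, f π = ∑ j ∈ Finset.univ.filter (fun j => κ j = κ y),
      ∑ π ∈ (yng κ).filter (fun π => π y = y), f (swap y j * π) := by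
  have : ∀ π ∈ yng κ, π y ∈ Finset.univ.filter (fun j => κ j = κ y) := by
    intro π hπ
    rw [mem_yng] at hπ
    simp [hπ]
  rw [← Finset.sum_fiberwise_of_maps_to this]
  refine Finset.sum_congr rfl fun j hj => ?_
  have hj' : κ y = κ j := by simpa using ((Finset.mem_filter.1 hj).2).symm
  symm
  refine Finset.sum_bij' (fun π _ => swap y j * π) (fun π _ => swap y j * π) ?_ ?_ ?_ ?_ ?_
  · intro π hπ
    rw [Finset.mem_filter] at hπ ⊢
    refine ⟨mul_mem_yng (swap_mem_yng hj') hπ.1, ?_⟩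
    simp [hπ.2]
  · intro π hπ
    rw [Finset.mem_filter] at hπ ⊢
    refine ⟨mul_mem_yng (swap_mem_yng hj') hπ.1, ?_⟩
    simp [hπ.2]
  · intro π _; simp [← mul_assoc]
  · intro π _; simp [← mul_assoc]
  · intro π _; rfl

lemma HQ_move {G : Perm ι → ℝ} (hG : IsCl G) {κ κ' : ι → C} {y : ι} {c d : C} (hcd : c ≠ d)
    (hy : κ y = d) (hy' : κ' y = c) (hoff : ∀ x, x ≠ y → κ' x = κ x) :
    HT G κ - ∑ i ∈ Finset.univ.filter (fun i => κ i = c), QQ G κ i y =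
    HT G κ' - ∑ j ∈ Finset.univ.filter (fun j => κ' j = d), QQ G κ' y j := by
  classical
  have hst : (yng κ).filter (fun π => π y = y) = (yng κ').filter (fun π => π y = y) := by
    ext π
    simp only [Finset.mem_filter, mem_yng]
    refine and_congr_left fun hπ => ?_
    have hne : ∀ x, x ≠ y → π x ≠ y := by
      intro x hx h; exact hx (π.injective (by rw [h, hπ]))
    refine forall_congr' fun x => ?_
    by_cases hx : x = y
    · subst hx; simp [hπ]
    · rw [hoff x hx, hoff _ (hne x hx)]
  set S0 := (yng κ).filter (fun π => π y = y) with hS0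
  -- left side
  have eps : ∀ x : ι, sg (swap y x) = if x = y then 1 else -1 := by
    intro x
    split_ifs with h
    · subst h; rw [swap_self]; exact sg_one
    · exact sg_swap (Ne.symm h)
  have hX : Finset.univ.filter (fun i => κ' i = κ' y) =
      insert y (Finset.univ.filter (fun i => κ i = c)) := by
    ext x
    by_cases hx : x = y
    · subst hx; simp
    · simp [hx, hoff x hx, hy']
  have hyX : y ∉ Finset.univ.filter (fun i => κ i = c) := by simp [hy, hcd.symm]
  have hY : Finset.univ.filter (fun i => κ i = κ y) =
      insert y (Finset.univ.filter (fun i => κ' i = d)) := by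
    ext x
    by_cases hx : x = y
    · subst hx; simp
    · simp [hx, hoff x hx, hy]
  have hyY : y ∉ Finset.univ.filter (fun i => κ' i = d) := by simp [hy', hcd]
  have L : HT G κ - ∑ i ∈ Finset.univ.filter (fun i => κ i = c), QQ G κ i y =
      ∑ i ∈ Finset.univ.filter (fun i => κ' i = κ' y), ∑ π ∈ yng κ,
        sg (swap y i) * sg π * G (swap y i * π) := by
    rw [hX, Finset.sum_insert hyX, sub_eq_add_neg, ← Finset.sum_neg_distrib]
    congr 1
    · unfold HT
      refine Finset.sum_congr rfl fun π _ => ?_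
      rw [eps, if_pos rfl, swap_self, ← Perm.one_def]; simp
    · refine Finset.sum_congr rfl fun i hi => ?_
      have : i ≠ y := by rintro rfl; exact hyX hi
      unfold QQ
      rw [← Finset.sum_neg_distrib]
      refine Finset.sum_congr rfl fun π _ => ?_
      rw [eps, if_neg this, hG.comm (swap y i) π, swap_comm]; ring
  have Rr : HT G κ' - ∑ j ∈ Finset.univ.filter (fun j => κ' j = d), QQ G κ' y j =
      ∑ j ∈ Finset.univ.filter (fun i => κ i = κ y), ∑ π ∈ yng κ',
        sg (swap y j) * sg π * G (π * swap y j) := by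
    rw [hY, Finset.sum_insert hyY, sub_eq_add_neg, ← Finset.sum_neg_distrib]
    congr 1
    · unfold HT
      refine Finset.sum_congr rfl fun π _ => ?_
      rw [eps, if_pos rfl, swap_self, ← Perm.one_def]; simp
    · refine Finset.sum_congr rfl fun i hi => ?_
      have : i ≠ y := by rintro rfl; exact hyY hi
      unfold QQ
      rw [← Finset.sum_neg_distrib]
      refine Finset.sum_congr rfl fun π _ => ?_
      rw [eps, if_neg this]; ring
  rw [L, Rr]
  have L2 : ∀ i, ∑ π ∈ yng κ, sg (swap y i) * sg π * G (swap y i * π) =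
      ∑ j ∈ Finset.univ.filter (fun j => κ j = κ y), ∑ π ∈ S0,
        sg (swap y i) * (sg π * sg (swap y j)) * G (swap y i * π * swap y j) := by
    intro i
    rw [yng_coset_right κ y]
    simp only [sg_mul, mul_assoc, ← hS0]
  have R2 : ∀ j, ∑ π ∈ yng κ', sg (swap y j) * sg π * G (π * swap y j) =
      ∑ i ∈ Finset.univ.filter (fun i => κ' i = κ' y), ∑ π ∈ S0,
        sg (swap y i) * (sg π * sg (swap y j)) * G (swap y i * π * swap y j) := by
    intro j
    rw [yng_coset_left κ' y, ← hst]
    refine Finset.sum_congr rfl fun i _ => Finset.sum_congr rfl fun π _ => ?_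
    rw [sg_mul]; ring
  rw [Finset.sum_congr rfl fun i _ => L2 i, Finset.sum_congr rfl fun j _ => R2 j, Finset.sum_comm]

end QT

namespace QT
open Equiv Equiv.Perm

variable {ι : Type*} [Fintype ι] [DecidableEq ι] {C : Type*} [DecidableEq C]

open Classical in
def II (L : ℝ) (α : ι → ℝ) (π : Perm ι) : ℝ := if ∀ i, α (π i) ≤ α i + L then 1 else 0

def proper (L : ℝ) (α : ι → ℝ) (κ : ι → C) : Prop :=
  ∀ i j, i ≠ j → κ i = κ j → L < |α i - α j|

open Classical in
lemma det_lemma {L : ℝ} (hL : 0 ≤ L) (α : ι → ℝ) (κ : ι → C) :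
    HT (II L α) κ = if proper L α κ then 1 else 0 := by
  split_ifs with hp
  · unfold HT
    rw [Finset.sum_eq_single (1 : Perm ι)]
    · simp [sg_one, II, hL]
    · intro π hπ hne
      rw [mem_yng] at hπ
      unfold II
      rw [if_neg, mul_zero]
      intro hall
      have hle : ∀ i, α (π i) ≤ α i := by
        intro i
        by_cases h : π i = i
        · rw [h]
        · have := hp _ _ h (hπ i)
          have h2 := hall i
          rcases abs_cases (α (π i) - α i) with ⟨h3, _⟩ | ⟨h3, _⟩ <;> linarith
      have hsum : ∑ i, α (π i) = ∑ i, α i := Equiv.sum_comp π α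
      have heq := (Finset.sum_eq_sum_iff_of_le (fun i _ => hle i)).1 hsum
      apply hne
      ext i
      by_contra h
      have h1 := hp _ _ h (hπ i)
      have h2 := heq i (Finset.mem_univ _)
      rw [h2] at h1; simp at h1; linarith
    · intro h; exact absurd (mem_yng.2 (by simp)) h
  · unfold proper at hp
    push Not at hp
    -- set of upper elements of near pairs
    let B : Finset ι := Finset.univ.filter
      (fun b => ∃ a, a ≠ b ∧ κ a = κ b ∧ α a ≤ α b ∧ α b - α a ≤ L)
    have hB : B.Nonempty := by
      obtain ⟨i, j, hij, hk, hn⟩ := hp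
      rcases le_total (α i) (α j) with h | h
      · refine ⟨j, ?_⟩
        simp only [B, Finset.mem_filter, Finset.mem_univ, true_and]
        refine ⟨i, hij, hk, h, ?_⟩
        rw [abs_sub_comm] at hn
        exact (le_abs_self _).trans hn
      · refine ⟨i, ?_⟩
        simp only [B, Finset.mem_filter, Finset.mem_univ, true_and]
        refine ⟨j, hij.symm, hk.symm, h, ?_⟩
        exact (le_abs_self _).trans hn
    obtain ⟨b, hb, hmax⟩ := Finset.exists_max_image B α hB
    have hb' := hb
    simp only [B, Finset.mem_filter, Finset.mem_univ, true_and] at hb'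
    obtain ⟨a, hab, hk, hle, hn⟩ := hb'
    have hrow : ∀ v, κ v = κ b → (α v ≤ α a + L ↔ α v ≤ α b + L) := by
      intro v hv
      constructor
      · intro h; linarith
      · intro h
        by_contra hcon
        push Not at hcon
        have hvb : α b < α v := by linarith
        have : v ∈ B := by
          simp only [B, Finset.mem_filter, Finset.mem_univ, true_and]
          refine ⟨b, ?_, hv.symm, hvb.le, by linarith⟩
          rintro rfl; exact lt_irrefl _ hvb
        exact absurd (hmax v this) (not_le.2 hvb)
    have hII : ∀ π ∈ yng κ, II L α (π * swap a b) = II L α π := by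
      intro π hπ
      rw [mem_yng] at hπ
      unfold II
      congr 1
      rw [eq_iff_iff]
      have hpa : κ (π a) = κ b := by rw [hπ, hk]
      have hpb : κ (π b) = κ b := by rw [hπ]
      constructor
      · intro h i
        by_cases hi : i = a
        · subst hi
          have := h b
          rw [Perm.mul_apply, swap_apply_right] at this
          exact (hrow _ hpa).2 this
        · by_cases hj : i = b
          · subst hj
            have := h a
            rw [Perm.mul_apply, swap_apply_left] at this
            exact (hrow _ hpb).1 this
          · have := h i
            rwa [Perm.mul_apply, swap_apply_of_ne_of_ne hi hj] at this
      · intro h i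
        rw [Perm.mul_apply]
        by_cases hi : i = a
        · subst hi
          rw [swap_apply_left]
          exact (hrow _ hpb).2 (h b)
        · by_cases hj : i = b
          · subst hj
            rw [swap_apply_right]
            exact (hrow _ hpa).1 (h a)
          · rw [swap_apply_of_ne_of_ne hi hj]; exact h i
    have : HT (II L α) κ = - HT (II L α) κ := by
      conv_lhs => unfold HT; rw [← sum_yng_mul_swap hk]
      unfold HT
      rw [← Finset.sum_neg_distrib]
      refine Finset.sum_congr rfl fun π hπ => ?_
      rw [hII π hπ, sg_mul, sg_swap hab]; ring
    linarith

/-! two-colour identity -/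

section two
variable (L : ℝ) (α : ι → ℝ)

def pr (S X : Finset ι) : Prop :=
  ∀ i ∈ S, ∀ j ∈ S, i ≠ j → (i ∈ X ↔ j ∈ X) → L < |α i - α j|

open Classical in
def rk (S X : Finset ι) (i : ι) : ℝ :=
  ((S.filter (fun v => (v ∈ X ↔ i ∈ X) ∧ α v < α i)).card : ℝ)

open Classical in
def ww (S X : Finset ι) : ℝ :=
  ∑ b ∈ S, ∑ a ∈ S, if α a < α b ∧ α b - α a < L then 1 - rk α S X b + rk α S X a else 0

open Classical in
def EE (S : Finset ι) (p : Finset ι → Prop) (g : Finset ι → ℝ) : ℝ :=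
  ∑ X ∈ S.powerset, if pr L α S X ∧ p X then g X else 0

def Sh : (ℕ → ℝ) →ₗ[ℝ] (ℕ → ℝ) where
  toFun f := fun k => f (k + 1)
  map_add' f g := rfl
  map_smul' c f := rfl

/-- the balance relation -/
def Rel (T V : (ℕ → ℝ) →ₗ[ℝ] ℝ) (m : ℝ) : Prop :=
  ∀ f : ℕ → ℝ, T (fun k => k * f k) - V f = T (fun k => (m - k) * f (k + 1)) - V (fun k => f (k+1))

def OddSt (S : Finset ι) (a : ι) : Prop := ∃ T V : (ℕ → ℝ) →ₗ[ℝ] ℝ, Rel T V (S.card - 1) ∧ ∀ f : ℕ → ℝ,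
  EE L α S (fun X => a ∈ X) (fun X => f X.card) = T (fun k => f (k+1)) ∧
  EE L α S (fun X => a ∉ X) (fun X => f X.card) = T f ∧
  EE L α S (fun X => a ∈ X) (fun X => ww L α S X * f X.card) = V (fun k => f (k+1)) ∧
  EE L α S (fun X => a ∉ X) (fun X => ww L α S X * f X.card) = V f

def EvenSt (S : Finset ι) (a : ι) : Prop := ∃ T V : (ℕ → ℝ) →ₗ[ℝ] ℝ, Rel T V S.card ∧ ∀ f : ℕ → ℝ,
  EE L α S (fun X => a ∈ X) (fun X => f X.card) = T f ∧
  EE L α S (fun X => a ∉ X) (fun X => f X.card) = T f ∧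
  EE L α S (fun X => a ∈ X) (fun X => ww L α S X * f X.card) = V f - T (fun k => (2 * k - S.card) * f k) ∧
  EE L α S (fun X => a ∉ X) (fun X => ww L α S X * f X.card) = V f + T (fun k => (2 * k - S.card) * f k)

def TotSt (S : Finset ι) : Prop := ∃ T V : (ℕ → ℝ) →ₗ[ℝ] ℝ, Rel T V S.card ∧ ∀ f : ℕ → ℝ,
  EE L α S (fun X => True) (fun X => f X.card) = T f ∧
  EE L α S (fun X => True) (fun X => ww L α S X * f X.card) = V f

variable {L α}

lemma EE_split (S : Finset ι) (a : ι) (g : Finset ι → ℝ) :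
    EE L α S (fun _ => True) g = EE L α S (fun X => a ∈ X) g + EE L α S (fun X => a ∉ X) g := by
  classical
  unfold EE
  rw [← Finset.sum_add_distrib]
  refine Finset.sum_congr rfl fun X _ => ?_
  by_cases h1 : pr L α S X <;> by_cases h2 : a ∈ X <;> simp [h1, h2]

lemma lin_fun (T : (ℕ → ℝ) →ₗ[ℝ] ℝ) (f g h : ℕ → ℝ) (c d : ℝ) (H : ∀ k, h k = c * f k + d * g k) :
    T h = c * T f + d * T g := by
  have : h = c • f + d • g := by funext k; simp [H]
  rw [this, map_add, map_smul, map_smul]; rfl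

lemma Tot_of_Odd {S : Finset ι} {a : ι} (h : OddSt L α S a) : TotSt L α S := by
  obtain ⟨T, V, hR, hE⟩ := h
  refine ⟨T.comp Sh + T, V.comp Sh + V, ?_, ?_⟩
  · intro f
    have h1 := hR f
    have h2 := hR (fun k => f (k+1))
    simp only [LinearMap.add_apply, LinearMap.comp_apply, Sh, LinearMap.coe_mk, AddHom.coe_mk]
    rw [lin_fun T (fun k => (k:ℝ) * f (k+1)) (fun k => f (k+1)) (fun k => ((k+1 : ℕ) : ℝ) * f (k+1)) 1 1
      (by intro k; push_cast; ring)]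
    rw [lin_fun T (fun k => ((S.card:ℝ) - 1 - k) * f (k+1)) (fun k => f (k+1)) (fun k => ((S.card : ℝ) - k) * f (k+1)) 1 1
      (by intro k; ring)]
    have e : (fun k : ℕ => ((S.card : ℝ) - ((k+1 : ℕ):ℝ)) * f (k+1+1)) =
      fun k : ℕ => ((S.card : ℝ) - 1 - k) * f (k+1+1) := by funext k; push_cast; ring
    rw [e]
    linarith
  · intro f
    obtain ⟨h1, h2, h3, h4⟩ := hE f
    rw [EE_split S a, EE_split S a, h1, h2, h3, h4]
    exact ⟨rfl, rfl⟩

lemma Tot_of_Even {S : Finset ι} {a : ι} (h : EvenSt L α S a) : TotSt L α S := by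
  obtain ⟨T, V, hR, hE⟩ := h
  refine ⟨T + T, V + V, ?_, ?_⟩
  · intro f
    have h1 := hR f
    simp only [LinearMap.add_apply]
    linarith
  · intro f
    obtain ⟨h1, h2, h3, h4⟩ := hE f
    rw [EE_split S a, EE_split S a, h1, h2, h3, h4]
    refine ⟨rfl, ?_⟩
    simp only [LinearMap.add_apply]; ring

lemma Tot_empty : TotSt L α ∅ := by
  refine ⟨LinearMap.proj 0, 0, ?_, ?_⟩
  · intro f; simp
  · intro f; simp [EE, pr, ww]

lemma EE_congr {S : Finset ι} {p q : Finset ι → Prop} {g h : Finset ι → ℝ}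
    (H : ∀ X ⊆ S, pr L α S X → ((p X ↔ q X) ∧ (q X → g X = h X))) :
    EE L α S p g = EE L α S q h := by
  classical
  unfold EE
  refine Finset.sum_congr rfl fun X hX => ?_
  rw [Finset.mem_powerset] at hX
  by_cases h1 : pr L α S X
  · obtain ⟨h2, h3⟩ := H X hX h1
    by_cases h4 : q X
    · rw [if_pos ⟨h1, h2.2 h4⟩, if_pos ⟨h1, h4⟩, h3 h4]
    · rw [if_neg (by tauto), if_neg (by tauto)]
  · rw [if_neg (by tauto), if_neg (by tauto)]

/-- adding a new top element, coloured `X`. -/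
lemma EE_insert_mem {S : Finset ι} {b : ι} (hb : b ∉ S) (g : Finset ι → ℝ) (q : Finset ι → Prop)
    (h : ι → ℝ) (hq : ∀ X ⊆ S, (pr L α (insert b S) (insert b X) ↔ pr L α S X ∧ q X)) :
    EE L α (insert b S) (fun X => b ∈ X) g = EE L α S q (fun X => g (insert b X)) := by
  classical
  unfold EE
  rw [Finset.sum_powerset_insert hb, ← Finset.sum_add_distrib]
  refine Finset.sum_congr rfl fun X hX => ?_
  rw [Finset.mem_powerset] at hX
  have hbX : b ∉ X := fun h => hb (hX h)
  rw [if_neg (by tauto), zero_add]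
  simp only [Finset.mem_insert_self, and_true, hq X hX]

lemma EE_insert_notMem {S : Finset ι} {b : ι} (hb : b ∉ S) (g : Finset ι → ℝ) (q : Finset ι → Prop)
    (h : ι → ℝ) (hq : ∀ X ⊆ S, (pr L α (insert b S) X ↔ pr L α S X ∧ q X)) :
    EE L α (insert b S) (fun X => b ∉ X) g = EE L α S q g := by
  classical
  unfold EE
  rw [Finset.sum_powerset_insert hb, ← Finset.sum_add_distrib]
  refine Finset.sum_congr rfl fun X hX => ?_
  rw [Finset.mem_powerset] at hX
  have hbX : b ∉ X := fun h => hb (hX h)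
  simp [hq X hX, hbX]

end two
end QT

namespace QT
open Equiv Equiv.Perm

variable {ι : Type*} [Fintype ι] [DecidableEq ι] {C : Type*} [DecidableEq C]

section two
variable {L : ℝ} {α : ι → ℝ}

lemma EE_add {S : Finset ι} (p : Finset ι → Prop) (g h : Finset ι → ℝ) :
    EE L α S p (fun X => g X + h X) = EE L α S p g + EE L α S p h := by
  classical
  unfold EE
  rw [← Finset.sum_add_distrib]
  refine Finset.sum_congr rfl fun X _ => ?_
  split_ifs <;> simp

lemma pr_insert_mem {S X : Finset ι} {b : ι} (hb : b ∉ S) (ht : ∀ i ∈ S, α i < α b) (hX : X ⊆ S) :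
    pr L α (insert b S) (insert b X) ↔ pr L α S X ∧ ∀ i ∈ X, L < α b - α i := by
  have hne : ∀ i ∈ S, i ≠ b := fun i hi h => hb (h ▸ hi)
  have hbX : b ∉ X := fun h => hb (hX h)
  constructor
  · intro h
    refine ⟨?_, ?_⟩
    · intro i hi j hj hij hiff
      refine h i (by simp [hi]) j (by simp [hj]) hij ?_
      simp [hne i hi, hne j hj, hiff]
    · intro i hi
      have := h b (by simp) i (by simp [hX hi]) (hne i (hX hi)).symm (by simp [hi])
      rwa [abs_of_pos (by linarith [ht i (hX hi)])] at this
  · rintro ⟨h1, h2⟩ i hi j hj hij hiff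
    rw [Finset.mem_insert] at hi hj
    rcases hi with rfl | hi <;> rcases hj with rfl | hj
    · exact absurd rfl hij
    · have hjX : j ∈ X := by
        have := hiff.1 (by simp)
        simpa [hne j hj] using this
      exact (h2 j hjX).trans_le (le_abs_self _)
    · have hjX : i ∈ X := by
        have := hiff.2 (by simp)
        simpa [hne i hi] using this
      rw [abs_sub_comm]
      exact (h2 i hjX).trans_le (le_abs_self _)
    · refine h1 i hi j hj hij ?_
      simpa [hne i hi, hne j hj] using hiff

lemma pr_insert_notMem {S X : Finset ι} {b : ι} (hb : b ∉ S) (ht : ∀ i ∈ S, α i < α b) (hX : X ⊆ S) :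
    pr L α (insert b S) X ↔ pr L α S X ∧ ∀ i ∈ S, i ∉ X → L < α b - α i := by
  have hne : ∀ i ∈ S, i ≠ b := fun i hi h => hb (h ▸ hi)
  have hbX : b ∉ X := fun h => hb (hX h)
  constructor
  · intro h
    refine ⟨?_, ?_⟩
    · intro i hi j hj hij hiff
      exact h i (by simp [hi]) j (by simp [hj]) hij hiff
    · intro i hi hiX
      have := h b (by simp) i (by simp [hi]) (hne i hi).symm (by simp [hiX, hbX])
      rwa [abs_of_pos (by linarith [ht i hi])] at this
  · rintro ⟨h1, h2⟩ i hi j hj hij hiff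
    rw [Finset.mem_insert] at hi hj
    rcases hi with rfl | hi <;> rcases hj with rfl | hj
    · exact absurd rfl hij
    · exact (h2 j hj (by tauto)).trans_le (le_abs_self _)
    · rw [abs_sub_comm]
      exact (h2 i hi (by tauto)).trans_le (le_abs_self _)
    · exact h1 i hi j hj hij hiff

lemma rk_insert {S X Y : Finset ι} {b : ι} (hb : b ∉ S) (ht : ∀ i ∈ S, α i < α b)
    (hXY : ∀ i ∈ S, (i ∈ Y ↔ i ∈ X)) {i : ι} (hi : i ∈ S) :
    rk α (insert b S) Y i = rk α S X i := by
  classical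
  unfold rk
  congr 2
  ext v
  simp only [Finset.mem_filter, Finset.mem_insert]
  constructor
  · rintro ⟨rfl | hv, h1, h2⟩
    · exact absurd (ht i hi) (not_lt.2 h2.le)
    · exact ⟨hv, by rw [← hXY v hv, ← hXY i hi, h1], h2⟩
  · rintro ⟨hv, h1, h2⟩
    exact ⟨Or.inr hv, by rw [hXY v hv, hXY i hi, h1], h2⟩

lemma rk_new_mem {S X : Finset ι} {b : ι} (hb : b ∉ S) (ht : ∀ i ∈ S, α i < α b) (hX : X ⊆ S) :
    rk α (insert b S) (insert b X) b = X.card := by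
  classical
  unfold rk
  congr 2
  ext v
  simp only [Finset.mem_filter, Finset.mem_insert, true_or, iff_true]
  constructor
  · rintro ⟨h1, rfl | h2, h3⟩
    · exact absurd h3 (lt_irrefl _)
    · exact h2
  · intro h; exact ⟨Or.inr (hX h), Or.inr h, ht v (hX h)⟩

lemma rk_new_notMem {S X : Finset ι} {b : ι} (hb : b ∉ S) (ht : ∀ i ∈ S, α i < α b) (hX : X ⊆ S) :
    rk α (insert b S) X b = S.card - X.card := by
  classical
  have hbX : b ∉ X := fun h => hb (hX h)
  rw [← Nat.cast_sub (Finset.card_le_card hX), ← Finset.card_sdiff_of_subset hX]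
  unfold rk
  congr 2
  ext v
  simp only [Finset.mem_filter, Finset.mem_insert, hbX, iff_false, Finset.mem_sdiff]
  constructor
  · rintro ⟨rfl | h2, h1, h3⟩
    · exact absurd h3 (lt_irrefl _)
    · exact ⟨h2, h1⟩
  · rintro ⟨h1, h2⟩; exact ⟨Or.inr h1, h2, ht v h1⟩

lemma rk_top_mem {S X : Finset ι} {a : ι} (ha : a ∈ S) (ht : ∀ i ∈ S, i ≠ a → α i < α a) (hX : X ⊆ S)
    (haX : a ∈ X) : rk α S X a = X.card - 1 := by
  classical
  have h := rk_new_mem (α := α) (S := S.erase a) (X := X.erase a) (b := a) (by simp)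
    (fun i hi => ht i (Finset.mem_of_mem_erase hi) (Finset.ne_of_mem_erase hi)) (Finset.erase_subset_erase _ hX)
  rw [Finset.insert_erase ha, Finset.insert_erase haX] at h
  rw [h, Finset.card_erase_of_mem haX, Nat.cast_sub (Finset.card_pos.2 ⟨a, haX⟩)]; simp

lemma rk_top_notMem {S X : Finset ι} {a : ι} (ha : a ∈ S) (ht : ∀ i ∈ S, i ≠ a → α i < α a) (hX : X ⊆ S)
    (haX : a ∉ X) : rk α S X a = S.card - 1 - X.card := by
  classical
  have h := rk_new_notMem (α := α) (S := S.erase a) (X := X) (b := a) (by simp)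
    (fun i hi => ht i (Finset.mem_of_mem_erase hi) (Finset.ne_of_mem_erase hi))
    (fun i hi => Finset.mem_erase.2 ⟨fun h => haX (h ▸ hi), hX hi⟩)
  rw [Finset.insert_erase ha] at h
  rw [h, Finset.card_erase_of_mem ha, Nat.cast_sub (Finset.card_pos.2 ⟨a, ha⟩)]; simp

open Classical in
lemma ww_insert {S X Y : Finset ι} {b : ι} (hb : b ∉ S) (ht : ∀ i ∈ S, α i < α b)
    (hXY : ∀ i ∈ S, (i ∈ Y ↔ i ∈ X)) :
    ww L α (insert b S) Y = ww L α S X +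
      ∑ a ∈ S, if α b - α a < L then 1 - rk α (insert b S) Y b + rk α S X a else 0 := by
  unfold ww
  rw [Finset.sum_insert hb, Finset.sum_insert hb]
  simp only [lt_irrefl, false_and, if_false, zero_add]
  rw [add_comm]
  congr 1
  · refine Finset.sum_congr rfl fun i hi => ?_
    rw [Finset.sum_insert hb, if_neg (by simp [(ht i hi).le, not_lt]), zero_add]
    refine Finset.sum_congr rfl fun j hj => ?_
    rw [rk_insert hb ht hXY hi, rk_insert hb ht hXY hj]
  · refine Finset.sum_congr rfl fun i hi => ?_
    rw [rk_insert hb ht hXY hi]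
    simp [ht i hi]

lemma mem_agree {S X : Finset ι} {b : ι} (hb : b ∉ S) : ∀ i ∈ S, (i ∈ insert b X ↔ i ∈ X) := by
  intro i hi
  have : i ≠ b := fun h => hb (h ▸ hi)
  simp [this]

/-- all of `S` far below -/
lemma step_open {S : Finset ι} {b : ι} (hb : b ∉ S) (ht : ∀ i ∈ S, α i < α b)
    (hfar : ∀ i ∈ S, L < α b - α i) (hS : TotSt L α S) : OddSt L α (insert b S) b := by
  classical
  obtain ⟨T, V, hR, hE⟩ := hS
  refine ⟨T, V, ?_, ?_⟩
  · rw [Finset.card_insert_of_notMem hb]; push_cast; simpa using hR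
  · intro f
    have hq1 : ∀ X ⊆ S, (pr L α (insert b S) (insert b X) ↔ pr L α S X ∧ True) := by
      intro X hX
      rw [pr_insert_mem hb ht hX]
      have : ∀ i ∈ X, L < α b - α i := fun i hi => hfar i (hX hi)
      tauto
    have hq2 : ∀ X ⊆ S, (pr L α (insert b S) X ↔ pr L α S X ∧ True) := by
      intro X hX
      rw [pr_insert_notMem hb ht hX]
      have : ∀ i ∈ S, i ∉ X → L < α b - α i := fun i hi _ => hfar i hi
      tauto
    have hw : ∀ X Y : Finset ι, (∀ i ∈ S, (i ∈ Y ↔ i ∈ X)) → ww L α (insert b S) Y = ww L α S X := by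
      intro X Y h
      rw [ww_insert hb ht h, Finset.sum_eq_zero, add_zero]
      intro i hi
      rw [if_neg]; have := hfar i hi; linarith
    rw [EE_insert_mem hb _ (fun _ => True) α hq1, EE_insert_mem hb _ (fun _ => True) α hq1,
      EE_insert_notMem hb _ (fun _ => True) α hq2, EE_insert_notMem hb _ (fun _ => True) α hq2]
    rw [← (hE f).1, ← (hE f).2, ← (hE (fun k => f (k+1))).1, ← (hE (fun k => f (k+1))).2]
    refine ⟨EE_congr ?_, rfl, EE_congr ?_, EE_congr ?_⟩
    · intro X hX _
      refine ⟨Iff.rfl, fun _ => ?_⟩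
      rw [Finset.card_insert_of_notMem (fun h => hb (hX h))]
    · intro X hX _
      refine ⟨Iff.rfl, fun _ => ?_⟩
      rw [Finset.card_insert_of_notMem (fun h => hb (hX h)), hw X _ (mem_agree hb)]
    · intro X hX _
      refine ⟨Iff.rfl, fun _ => ?_⟩
      rw [hw X X (fun _ _ => Iff.rfl)]

/-- two near elements below: nothing is proper -/
lemma step_dead {S : Finset ι} {b a c : ι} (hb : b ∉ S) (ht : ∀ i ∈ S, α i < α b)
    (ha : a ∈ S) (hc : c ∈ S) (hac : a ≠ c) (hna : α b - α a < L) (hnc : α b - α c < L) :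
    OddSt L α (insert b S) b := by
  classical
  have key : ∀ X, ¬ pr L α (insert b S) X := by
    intro X h
    have hab : a ≠ b := fun h => hb (h ▸ ha)
    have hcb : c ≠ b := fun h => hb (h ▸ hc)
    have h1 : (a ∈ X ↔ b ∈ X) → False := by
      intro h'
      have := h a (by simp [ha]) b (by simp) hab h'
      rw [abs_of_neg (by linarith [ht a ha])] at this
      linarith
    have h2 : (c ∈ X ↔ b ∈ X) → False := by
      intro h'
      have := h c (by simp [hc]) b (by simp) hcb h'
      rw [abs_of_neg (by linarith [ht c hc])] at this
      linarith
    have h3 : (a ∈ X ↔ c ∈ X) → False := by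
      intro h'
      have := h a (by simp [ha]) c (by simp [hc]) hac h'
      have h4 := ht a ha
      have h5 := ht c hc
      rcases abs_cases (α a - α c) with ⟨h3, _⟩ | ⟨h3, _⟩ <;> linarith
    tauto
  refine ⟨0, 0, ?_, ?_⟩
  · intro f; simp
  · intro f
    simp [EE, key]

section closed
variable {S : Finset ι} {a b : ι} (hb : b ∉ S) (ht : ∀ i ∈ S, α i < α b)
    (ha : a ∈ S) (hta : ∀ i ∈ S, i ≠ a → α i < α a) (hna : α b - α a < L)
    (hfar : ∀ i ∈ S, i ≠ a → L < α b - α i)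

lemma closed_mem (hb : b ∉ S) (ht : ∀ i ∈ S, α i < α b)
    (ha : a ∈ S) (hta : ∀ i ∈ S, i ≠ a → α i < α a) (hna : α b - α a < L)
    (hfar : ∀ i ∈ S, i ≠ a → L < α b - α i) (f : ℕ → ℝ) :
    EE L α (insert b S) (fun X => b ∈ X) (fun X => f X.card) =
      EE L α S (fun X => a ∉ X) (fun X => f (X.card + 1)) ∧
    EE L α (insert b S) (fun X => b ∈ X) (fun X => ww L α (insert b S) X * f X.card) =
      EE L α S (fun X => a ∉ X) (fun X => ww L α S X * f (X.card + 1)) +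
      EE L α S (fun X => a ∉ X) (fun X => ((S.card : ℝ) - 2 * X.card) * f (X.card + 1)) := by
  classical
  have hq1 : ∀ X ⊆ S, (pr L α (insert b S) (insert b X) ↔ pr L α S X ∧ a ∉ X) := by
    intro X hX
    rw [pr_insert_mem hb ht hX]
    refine and_congr_right fun _ => ⟨fun h hX => ?_, fun h i hi => hfar i (hX hi) (fun h' => h (h' ▸ hi))⟩
    have := h a hX; linarith
  rw [EE_insert_mem hb _ _ α hq1, EE_insert_mem hb _ _ α hq1, ← EE_add]
  refine ⟨EE_congr ?_, EE_congr ?_⟩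
  · intro X hX _
    refine ⟨Iff.rfl, fun _ => ?_⟩
    rw [Finset.card_insert_of_notMem (fun h => hb (hX h))]
  · intro X hX _
    refine ⟨Iff.rfl, fun haX => ?_⟩
    rw [Finset.card_insert_of_notMem (fun h => hb (hX h)), ww_insert hb ht (mem_agree hb),
      Finset.sum_eq_single a, if_pos hna, rk_new_mem hb ht hX, rk_top_notMem ha hta hX haX]
    · ring
    · intro i hi hia
      rw [if_neg]; linarith [hfar i hi hia]
    · intro h; exact absurd ha h

lemma closed_notMem (hb : b ∉ S) (ht : ∀ i ∈ S, α i < α b)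
    (ha : a ∈ S) (hta : ∀ i ∈ S, i ≠ a → α i < α a) (hna : α b - α a < L)
    (hfar : ∀ i ∈ S, i ≠ a → L < α b - α i) (f : ℕ → ℝ) :
    EE L α (insert b S) (fun X => b ∉ X) (fun X => f X.card) =
      EE L α S (fun X => a ∈ X) (fun X => f X.card) ∧
    EE L α (insert b S) (fun X => b ∉ X) (fun X => ww L α (insert b S) X * f X.card) =
      EE L α S (fun X => a ∈ X) (fun X => ww L α S X * f X.card) +
      EE L α S (fun X => a ∈ X) (fun X => (2 * (X.card : ℝ) - S.card) * f X.card) := by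
  classical
  have hq1 : ∀ X ⊆ S, (pr L α (insert b S) X ↔ pr L α S X ∧ a ∈ X) := by
    intro X hX
    rw [pr_insert_notMem hb ht hX]
    refine and_congr_right fun _ => ⟨fun h => ?_, fun h i hi hiX => hfar i hi (fun h' => hiX (h' ▸ h))⟩
    by_contra hcon
    have := h a ha hcon; linarith
  rw [EE_insert_notMem hb _ _ α hq1, EE_insert_notMem hb _ _ α hq1, ← EE_add]
  refine ⟨EE_congr ?_, EE_congr ?_⟩
  · intro X hX _
    exact ⟨Iff.rfl, fun _ => rfl⟩
  · intro X hX _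
    refine ⟨Iff.rfl, fun haX => ?_⟩
    rw [ww_insert hb ht (X := X) (fun _ _ => Iff.rfl),
      Finset.sum_eq_single a, if_pos hna, rk_new_notMem hb ht hX, rk_top_mem ha hta hX haX]
    · ring
    · intro i hi hia
      rw [if_neg]; linarith [hfar i hi hia]
    · intro h; exact absurd ha h

lemma step_closed_odd (hb : b ∉ S) (ht : ∀ i ∈ S, α i < α b)
    (ha : a ∈ S) (hta : ∀ i ∈ S, i ≠ a → α i < α a) (hna : α b - α a < L)
    (hfar : ∀ i ∈ S, i ≠ a → L < α b - α i) (hS : OddSt L α S a) : EvenSt L α (insert b S) b := by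
  obtain ⟨T, V, hR, hE⟩ := hS
  refine ⟨T.comp Sh, V.comp Sh + T.comp Sh, ?_, ?_⟩
  · intro f
    have h1 := hR (fun k => f (k+1))
    rw [Finset.card_insert_of_notMem hb]
    simp only [LinearMap.add_apply, LinearMap.comp_apply, Sh, LinearMap.coe_mk, AddHom.coe_mk]
    rw [lin_fun T (fun k => (k:ℝ) * f (k+1)) (fun k => f (k+1)) (fun k => ((k+1 : ℕ) : ℝ) * f (k+1)) 1 1
      (by intro k; push_cast; ring)]
    rw [lin_fun T (fun k => ((S.card:ℝ) - 1 - k) * f (k+1+1)) (fun k => f (k+1+1))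
      (fun k => (((S.card + 1 : ℕ) : ℝ) - ((k+1 : ℕ):ℝ)) * f (k+1+1)) 1 1
      (by intro k; push_cast; ring)]
    linarith
  · intro f
    obtain ⟨c1, c2⟩ := closed_mem hb ht ha hta hna hfar f
    obtain ⟨d1, d2⟩ := closed_notMem hb ht ha hta hna hfar f
    rw [c1, c2, d1, d2, (hE (fun k => f (k+1))).2.1, (hE f).1, (hE (fun k => f (k+1))).2.2.2, (hE f).2.2.1,
      (hE (fun k => ((S.card : ℝ) - 2 * k) * f (k+1))).2.1, (hE (fun k => (2 * (k:ℝ) - S.card) * f k)).1,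
      Finset.card_insert_of_notMem hb]
    simp only [LinearMap.add_apply, LinearMap.comp_apply, Sh, LinearMap.coe_mk, AddHom.coe_mk]
    refine ⟨trivial, trivial, ?_, ?_⟩
    · rw [lin_fun T (fun k => f (k+1)) (fun k => (2 * (((k+1 : ℕ)):ℝ) - ((S.card + 1 : ℕ):ℝ)) * f (k+1))
        (fun k => ((S.card : ℝ) - 2 * k) * f (k+1)) 1 (-1) (by intro k; push_cast; ring)]
      ring
    · rw [lin_fun T (fun k => f (k+1)) (fun k => (2 * (((k+1 : ℕ)):ℝ) - ((S.card + 1 : ℕ):ℝ)) * f (k+1))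
        (fun k => (2 * (((k+1 : ℕ)):ℝ) - S.card) * f (k+1)) 1 1 (by intro k; push_cast; ring)]
      ring

lemma step_closed_even (hb : b ∉ S) (ht : ∀ i ∈ S, α i < α b)
    (ha : a ∈ S) (hta : ∀ i ∈ S, i ≠ a → α i < α a) (hna : α b - α a < L)
    (hfar : ∀ i ∈ S, i ≠ a → L < α b - α i) (hS : EvenSt L α S a) : OddSt L α (insert b S) b := by
  obtain ⟨T, V, hR, hE⟩ := hS
  refine ⟨T, V, ?_, ?_⟩
  · rw [Finset.card_insert_of_notMem hb]; push_cast; simpa using hR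
  · intro f
    obtain ⟨c1, c2⟩ := closed_mem hb ht ha hta hna hfar f
    obtain ⟨d1, d2⟩ := closed_notMem hb ht ha hta hna hfar f
    rw [c1, c2, d1, d2, (hE (fun k => f (k+1))).2.1, (hE f).1, (hE (fun k => f (k+1))).2.2.2, (hE f).2.2.1,
      (hE (fun k => ((S.card : ℝ) - 2 * k) * f (k+1))).2.1, (hE (fun k => (2 * (k:ℝ) - S.card) * f k)).1]
    refine ⟨rfl, rfl, ?_, ?_⟩
    · rw [lin_fun T (fun k => (2 * (k:ℝ) - S.card) * f (k+1)) 0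
        (fun k => ((S.card : ℝ) - 2 * k) * f (k+1)) (-1) 0 (by intro k; ring)]
      ring
    · ring

end closed

lemma Tot_all (hinj : Function.Injective α) (hgen : ∀ i j, i ≠ j → |α i - α j| ≠ L) (S : Finset ι) :
    TotSt L α S ∧ (S.Nonempty → ∃ a ∈ S, (∀ i ∈ S, i ≠ a → α i < α a) ∧ (OddSt L α S a ∨ EvenSt L α S a)) := by
  classical
  induction S using Finset.induction_on_max_value α with
  | empty => exact ⟨Tot_empty, fun h => absurd h (by simp)⟩
  | insert b S hb hmax ih =>
    have hne : ∀ i ∈ S, i ≠ b := fun i hi h => hb (h ▸ hi)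
    have ht : ∀ i ∈ S, α i < α b := fun i hi => lt_of_le_of_ne (hmax i hi) (fun h => hne i hi (hinj h))
    have hdich : ∀ i ∈ S, L < α b - α i ∨ α b - α i < L := by
      intro i hi
      have := hgen b i (hne i hi).symm
      rw [abs_of_pos (by linarith [ht i hi])] at this
      exact (lt_or_gt_of_ne this).symm
    suffices h : OddSt L α (insert b S) b ∨ EvenSt L α (insert b S) b by
      refine ⟨h.elim Tot_of_Odd Tot_of_Even, fun _ => ⟨b, by simp, ?_, h⟩⟩
      intro i hi hib
      rcases Finset.mem_insert.1 hi with h | h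
      · exact absurd h hib
      · exact ht i h
    by_cases hS : S.Nonempty
    · obtain ⟨a, ha, hta, hst⟩ := ih.2 hS
      by_cases hfar : ∀ i ∈ S, L < α b - α i
      · exact Or.inl (step_open hb ht hfar ih.1)
      · push Not at hfar
        obtain ⟨c, hc, hcn⟩ := hfar
        have hcn' := (hdich c hc).resolve_left (not_lt.2 hcn)
        by_cases hfar2 : ∀ i ∈ S, i ≠ a → L < α b - α i
        · have hca : c = a := by
            by_contra h
            exact absurd (hfar2 c hc h) (not_lt.2 hcn)
          subst hca
          rcases hst with h | h
          · exact Or.inr (step_closed_odd hb ht ha hta hcn' hfar2 h)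
          · exact Or.inl (step_closed_even hb ht ha hta hcn' hfar2 h)
        · push Not at hfar2
          obtain ⟨d, hd, hda, hdn⟩ := hfar2
          have hdn' := (hdich d hd).resolve_left (not_lt.2 hdn)
          refine Or.inl (step_dead hb ht ha hd hda.symm ?_ hdn')
          linarith [hta d hd hda]
    · rw [Finset.not_nonempty_iff_eq_empty] at hS
      subst hS
      exact Or.inl (step_open hb ht (by simp) Tot_empty)

open Classical in
/-- The two-colour identity. -/
lemma two_colour (hinj : Function.Injective α) (hgen : ∀ i j, i ≠ j → |α i - α j| ≠ L) (S : Finset ι)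
    (f : ℕ → ℝ) :
    ∑ X ∈ S.powerset, (if pr L α S X then ((X.card : ℝ) - ww L α S X) * f X.card else 0) =
    ∑ X ∈ S.powerset, (if pr L α S X then ((S.card : ℝ) - X.card - ww L α S X) * f (X.card + 1) else 0) := by
  obtain ⟨T, V, hR, hE⟩ := (Tot_all hinj hgen S).1
  have h := hR f
  have e1 := (hE (fun k => k * f k)).1
  have e2 := (hE f).2
  have e3 := (hE (fun k => ((S.card : ℝ) - k) * f (k+1))).1
  have e4 := (hE (fun k => f (k+1))).2
  rw [← e1, ← e2, ← e3, ← e4] at h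
  unfold EE at h
  rw [← Finset.sum_sub_distrib, ← Finset.sum_sub_distrib] at h
  refine Eq.trans (Finset.sum_congr rfl fun X _ => ?_) (h.trans (Finset.sum_congr rfl fun X _ => ?_))
  · by_cases h1 : pr L α S X <;> simp [h1]; ring
  · by_cases h1 : pr L α S X <;> simp [h1]; ring

end two
end QT

namespace QT
open Equiv Equiv.Perm

variable {ι : Type*} [Fintype ι] [DecidableEq ι] {C : Type*} [DecidableEq C]

def SS (κ : ι → C) (c d : C) : Finset ι := Finset.univ.filter (fun i => κ i = c ∨ κ i = d)

def col (κ : ι → C) (c d : C) (X : Finset ι) (i : ι) : C :=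
  if i ∈ SS κ c d then (if i ∈ X then c else d) else κ i

def KK (G : Perm ι → ℝ) (κ : ι → C) (c d : C) : ℝ :=
  ∑ i ∈ Finset.univ.filter (fun i => κ i = c), ∑ j ∈ Finset.univ.filter (fun j => κ j = d), QQ G κ i j

lemma sum_move (S : Finset ι) (φ : Finset ι → ι → ℝ) :
    ∑ X ∈ S.powerset, ∑ y ∈ S \ X, φ (insert y X) y = ∑ X ∈ S.powerset, ∑ y ∈ X, φ X y := by
  rw [Finset.sum_sigma', Finset.sum_sigma']
  refine Finset.sum_bij' (fun p _ => ⟨insert p.2 p.1, p.2⟩) (fun p _ => ⟨p.1.erase p.2, p.2⟩) ?_ ?_ ?_ ?_ ?_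
  · rintro ⟨X, y⟩ h
    simp only [Finset.mem_sigma, Finset.mem_powerset, Finset.mem_sdiff] at h ⊢
    exact ⟨Finset.insert_subset h.2.1 h.1, by simp⟩
  · rintro ⟨X, y⟩ h
    simp only [Finset.mem_sigma, Finset.mem_powerset, Finset.mem_sdiff] at h ⊢
    exact ⟨(Finset.erase_subset _ _).trans h.1, h.1 h.2, by simp⟩
  · rintro ⟨X, y⟩ h
    simp only [Finset.mem_sigma, Finset.mem_powerset, Finset.mem_sdiff] at h ⊢
    simp [Finset.erase_insert h.2.2]
  · rintro ⟨X, y⟩ h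
    simp only [Finset.mem_sigma, Finset.mem_powerset, Finset.mem_sdiff] at h ⊢
    simp [Finset.insert_erase h.2]
  · rintro ⟨X, y⟩ h; rfl

section
variable {κ : ι → C} {c d : C} (hcd : c ≠ d)

lemma mem_SS {i : ι} : i ∈ SS κ c d ↔ κ i = c ∨ κ i = d := by simp [SS]

lemma col_eq_c {X : Finset ι} (hcd : c ≠ d) (hX : X ⊆ SS κ c d) (i : ι) : col κ c d X i = c ↔ i ∈ X := by
  unfold col
  split_ifs with h1 h2
  · simp [h2]
  · simp [h2, hcd.symm]
  · rw [mem_SS] at h1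
    have : i ∉ X := fun h => h1 (mem_SS.1 (hX h))
    tauto

lemma col_eq_d {X : Finset ι} (hcd : c ≠ d) (hX : X ⊆ SS κ c d) (i : ι) :
    col κ c d X i = d ↔ i ∈ SS κ c d \ X := by
  unfold col
  rw [Finset.mem_sdiff]
  split_ifs with h1 h2
  · simp [h2, hcd]
  · simp [h1, h2]
  · rw [mem_SS] at *
    tauto

lemma col_eq_e {X : Finset ι} {e : C} (hec : e ≠ c) (hed : e ≠ d) (i : ι) :
    col κ c d X i = e ↔ κ i = e := by
  unfold col
  split_ifs with h1 h2
  · rw [mem_SS] at h1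
    rcases h1 with h | h <;> simp [h, hec.symm, hed.symm]
  · rw [mem_SS] at h1
    rcases h1 with h | h <;> simp [h, hec.symm, hed.symm]
  · rfl

lemma filter_col_c {X : Finset ι} (hcd : c ≠ d) (hX : X ⊆ SS κ c d) :
    Finset.univ.filter (fun i => col κ c d X i = c) = X := by
  ext i; simp [col_eq_c hcd hX]

lemma filter_col_d {X : Finset ι} (hcd : c ≠ d) (hX : X ⊆ SS κ c d) :
    Finset.univ.filter (fun i => col κ c d X i = d) = SS κ c d \ X := by
  ext i; simp only [Finset.mem_filter, Finset.mem_univ, true_and, col_eq_d hcd hX]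

lemma col_self (hcd : c ≠ d) : col κ c d (Finset.univ.filter (fun i => κ i = c)) = κ := by
  funext i
  unfold col
  split_ifs with h1 h2
  · simp at h2; exact h2.symm
  · simp at h2
    rw [mem_SS] at h1
    tauto
  · rfl

lemma K_rel (hcd : c ≠ d) {G : Perm ι → ℝ} (hG : IsCl G) (f : ℕ → ℝ) :
    ∑ X ∈ (SS κ c d).powerset, ((X.card : ℝ) * HT G (col κ c d X) - KK G (col κ c d X) c d) * f X.card =
    ∑ X ∈ (SS κ c d).powerset, (((SS κ c d).card - X.card : ℝ) * HT G (col κ c d X) - KK G (col κ c d X) c d)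
      * f (X.card + 1) := by
  symm
  have h := sum_move (SS κ c d) (fun X y => (HT G (col κ c d X) -
    ∑ j ∈ SS κ c d \ X, QQ G (col κ c d X) y j) * f X.card)
  refine Eq.trans ?_ (h.trans ?_)
  · refine Finset.sum_congr rfl fun X hX => ?_
    rw [Finset.mem_powerset] at hX
    have h1 : ∀ y ∈ SS κ c d \ X, (HT G (col κ c d (insert y X)) -
        ∑ j ∈ SS κ c d \ (insert y X), QQ G (col κ c d (insert y X)) y j) * f (insert y X).card =
        (HT G (col κ c d X) - ∑ i ∈ X, QQ G (col κ c d X) i y) * f (X.card + 1) := by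
      intro y hy
      have hy' := Finset.mem_sdiff.1 hy
      have hXy : insert y X ⊆ SS κ c d := Finset.insert_subset hy'.1 hX
      have := HQ_move hG hcd (κ := col κ c d X) (κ' := col κ c d (insert y X)) (y := y)
        ((col_eq_d hcd hX y).2 hy) ((col_eq_c hcd hXy y).2 (by simp))
        (by intro x hx; unfold col; simp [hx])
      rw [filter_col_c hcd hX, filter_col_d hcd hXy] at this
      rw [← this, Finset.card_insert_of_notMem hy'.2]
    rw [Finset.sum_congr rfl h1, ← Finset.sum_mul]
    congr 1
    unfold KK
    rw [Finset.sum_sub_distrib, filter_col_c hcd hX, filter_col_d hcd hX, Finset.sum_const,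
      Finset.card_sdiff_of_subset hX, nsmul_eq_mul, Nat.cast_sub (Finset.card_le_card hX), Finset.sum_comm]
  · refine Finset.sum_congr rfl fun X hX => ?_
    rw [Finset.mem_powerset] at hX
    rw [← Finset.sum_mul]
    unfold KK
    rw [Finset.sum_sub_distrib, filter_col_c hcd hX, filter_col_d hcd hX, Finset.sum_const, nsmul_eq_mul]

lemma exists_relabel (hcd : c ≠ d) {X Y : Finset ι} (hX : X ⊆ SS κ c d) (hY : Y ⊆ SS κ c d)
    (h : X.card = Y.card) : ∃ g : Perm ι, col κ c d X ∘ g = col κ c d Y := by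
  have hcard : ∀ e : C, Fintype.card {i // col κ c d Y i = e} = Fintype.card {i // col κ c d X i = e} := by
    intro e
    rw [Fintype.card_subtype, Fintype.card_subtype]
    by_cases hec : e = c
    · subst hec; rw [filter_col_c hcd hX, filter_col_c hcd hY, h]
    by_cases hed : e = d
    · subst hed; rw [filter_col_d hcd hX, filter_col_d hcd hY, Finset.card_sdiff_of_subset hX,
        Finset.card_sdiff_of_subset hY, h]
    · simp only [col_eq_e hec hed]
  refine ⟨Equiv.ofFiberEquiv (fun e => Fintype.equivOfCardEq (hcard e)), ?_⟩
  funext i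
  exact Equiv.ofFiberEquiv_map _ i

lemma yng_relabel (κ : ι → C) (g : Perm ι) (F : Perm ι → ℝ) :
    ∑ π ∈ yng (κ ∘ g), F π = ∑ π ∈ yng κ, F (g⁻¹ * π * g) := by
  refine Finset.sum_bij' (fun π _ => g * π * g⁻¹) (fun π _ => g⁻¹ * π * g) ?_ ?_ ?_ ?_ ?_
  · intro π h
    rw [mem_yng] at h ⊢
    intro x
    have := h (g⁻¹ x)
    simpa using this
  · intro π h
    rw [mem_yng] at h ⊢
    intro x
    have := h (g x)
    simpa using this
  · intro π h; group
  · intro π h; group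
  · intro π h; congr 1; group

lemma sg_conj (g π : Perm ι) : sg (g⁻¹ * π * g) = sg π := by
  have h : Perm.sign (g⁻¹ * π * g) = Perm.sign π := by
    rw [Perm.sign_mul, Perm.sign_mul, Perm.sign_inv, mul_right_comm, Int.units_mul_self, one_mul]
  unfold sg
  rw [h]

lemma QQ_relabel {G : Perm ι → ℝ} (hG : IsCl G) (κ : ι → C) (g : Perm ι) (i j : ι) :
    QQ G (κ ∘ g) i j = QQ G κ (g i) (g j) := by
  unfold QQ
  rw [yng_relabel]
  refine Finset.sum_congr rfl fun π _ => ?_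
  rw [sg_conj]
  congr 1
  rw [← hG g]
  congr 1
  have : swap (g i) (g j) = g * swap i j * g⁻¹ := by
    rw [Equiv.swap_apply_apply]
  rw [this]; group

lemma HT_relabel {G : Perm ι → ℝ} (hG : IsCl G) (κ : ι → C) (g : Perm ι) :
    HT G (κ ∘ g) = HT G κ := by
  unfold HT
  rw [yng_relabel]
  refine Finset.sum_congr rfl fun π _ => ?_
  rw [sg_conj]
  congr 1
  rw [← hG g]
  congr 1; group

lemma sum_relabel (κ : ι → C) (g : Perm ι) (c : C) (F : ι → ℝ) :
    ∑ i ∈ Finset.univ.filter (fun i => (κ ∘ g) i = c), F (g i) = ∑ i ∈ Finset.univ.filter (fun i => κ i = c), F i := by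
  rw [Finset.sum_filter, Finset.sum_filter]
  exact Equiv.sum_comp g (fun i => if κ i = c then F i else 0)

lemma KK_relabel {G : Perm ι → ℝ} (hG : IsCl G) (κ : ι → C) (g : Perm ι) (c d : C) :
    KK G (κ ∘ g) c d = KK G κ c d := by
  unfold KK
  simp only [QQ_relabel hG]
  rw [sum_relabel κ g c (fun i => ∑ j ∈ Finset.univ.filter (fun j => (κ ∘ g) j = d), QQ G κ i (g j))]
  refine Finset.sum_congr rfl fun i _ => ?_
  exact sum_relabel κ g d (fun j => QQ G κ i j)

lemma K_eq_W (hcd : c ≠ d) {G : Perm ι → ℝ} (hG : IsCl G) (W : (ι → C) → ℝ)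
    (hWs : ∀ (κ : ι → C) (g : Perm ι), W (κ ∘ g) = W κ)
    (hW : ∀ f : ℕ → ℝ, 
      ∑ X ∈ (SS κ c d).powerset, ((X.card : ℝ) * HT G (col κ c d X) - W (col κ c d X)) * f X.card =
      ∑ X ∈ (SS κ c d).powerset, (((SS κ c d).card - X.card : ℝ) * HT G (col κ c d X) - W (col κ c d X))
        * f (X.card + 1)) : KK G κ c d = W κ := by
  set X0 := Finset.univ.filter (fun i => κ i = c) with hX0
  have hX0s : X0 ⊆ SS κ c d := by
    intro i hi; rw [mem_SS]; simp [hX0] at hi; exact Or.inl hi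
  set N : Finset ι → ℝ := fun X => KK G (col κ c d X) c d - W (col κ c d X) with hN
  have hsymm : ∀ X ⊆ SS κ c d, X.card = X0.card → N X = N X0 := by
    intro X hX h
    obtain ⟨g, hg⟩ := exists_relabel hcd hX hX0s h
    simp only [hN]
    rw [← hg, KK_relabel hG, hWs]
  let f : ℕ → ℝ := fun k => if k ≤ X0.card then 1 else 0
  have h1 := hW f
  have h2 := K_rel (κ := κ) hcd hG f
  have h3 : ∑ X ∈ (SS κ c d).powerset, N X * (f X.card - f (X.card + 1)) = 0 := by
    have e : ∀ X, N X * (f X.card - f (X.card + 1)) =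
      (((X.card : ℝ) * HT G (col κ c d X) - W (col κ c d X)) * f X.card -
      (((SS κ c d).card - X.card : ℝ) * HT G (col κ c d X) - W (col κ c d X)) * f (X.card + 1)) -
      (((X.card : ℝ) * HT G (col κ c d X) - KK G (col κ c d X) c d) * f X.card -
      (((SS κ c d).card - X.card : ℝ) * HT G (col κ c d X) - KK G (col κ c d X) c d) * f (X.card + 1)) := by
      intro X; simp only [hN]; ring
    rw [Finset.sum_congr rfl (fun X _ => e X), Finset.sum_sub_distrib, Finset.sum_sub_distrib,
      Finset.sum_sub_distrib, h1, h2]; ring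
  have h4 : ∑ X ∈ (SS κ c d).powerset, (if X.card = X0.card then N X0 else 0) = 0 := by
    refine Eq.trans (Finset.sum_congr rfl fun X hX => ?_) h3
    rw [Finset.mem_powerset] at hX
    have : f X.card - f (X.card + 1) = if X.card = X0.card then 1 else 0 := by
      simp only [f]
      split_ifs <;> first | omega | norm_num
    rw [this]
    split_ifs with h
    · rw [hsymm X hX h, mul_one]
    · simp
  rw [← Finset.sum_filter, Finset.sum_const, nsmul_eq_mul, mul_eq_zero] at h4
  rcases h4 with h | h
  · exfalso
    rw [Nat.cast_eq_zero, Finset.card_eq_zero] at h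
    have : X0 ∈ (SS κ c d).powerset.filter (fun X => X.card = X0.card) := by simp [hX0s]
    rw [h] at this; simp at this
  · simp only [hN, hX0, col_self hcd] at h
    linarith
end

end QT

namespace QT
open Equiv Equiv.Perm

variable {ι : Type*} [Fintype ι] [DecidableEq ι] {C : Type*} [DecidableEq C]

def posO (ι : Type*) : Set (ι → ℝ) := {α | ∀ i, 0 ≤ α i}

lemma meas_posO : MeasurableSet (posO ι) := by
  have : posO ι = ⋂ i, {α : ι → ℝ | 0 ≤ α i} := by ext; simp [posO]
  rw [this]
  exact MeasurableSet.iInter fun i => measurableSet_le measurable_const (measurable_pi_apply i)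

lemma null_hyper {i j : ι} (hij : i ≠ j) (x : ℝ) : volume {α : ι → ℝ | α i - α j = x} = 0 := by
  let ℓ : (ι → ℝ) →ₗ[ℝ] ℝ := (LinearMap.proj i : (ι → ℝ) →ₗ[ℝ] ℝ) - (LinearMap.proj j : (ι → ℝ) →ₗ[ℝ] ℝ)
  let p : ι → ℝ := Pi.single i x
  have hp : ℓ p = x := by simp [ℓ, p, hij.symm]
  have : {α : ι → ℝ | α i - α j = x} = (AffineSubspace.mk' p (LinearMap.ker ℓ) : Set (ι → ℝ)) := by
    ext α
    simp only [Set.mem_ofPred_eq, SetLike.mem_coe, AffineSubspace.mem_mk', vsub_eq_sub, LinearMap.mem_ker,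
      map_sub, hp]
    simp [ℓ, sub_eq_zero]
  rw [this]
  apply Measure.addHaar_affineSubspace
  intro h
  have h2 := congrArg AffineSubspace.direction h
  rw [AffineSubspace.direction_mk', AffineSubspace.direction_top] at h2
  have h3 : (Pi.single i 1 : ι → ℝ) ∈ LinearMap.ker ℓ := by rw [h2]; trivial
  simp [ℓ, hij.symm] at h3

/-- generic positions -/
def gen (L : ℝ) (α : ι → ℝ) : Prop := ∀ i j, i ≠ j → ∀ m : ℤ, α i - α j ≠ L * m

lemma gen_ae (L : ℝ) : ∀ᵐ α : ι → ℝ, gen L α := by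
  unfold gen
  simp only [ae_all_iff]
  intro i j hij m
  rw [ae_iff]
  simp only [ne_eq, not_not]
  exact null_hyper hij _

lemma gen.inj {L : ℝ} {α : ι → ℝ} (h : gen L α) : Function.Injective α := by
  intro i j hij
  by_contra hne
  have := h i j hne 0
  simp [hij] at this

lemma gen.abs {L : ℝ} {α : ι → ℝ} (h : gen L α) (i j : ι) (hij : i ≠ j) : |α i - α j| ≠ L := by
  intro h'
  rcases abs_choice (α i - α j) with h1 | h1
  · exact h i j hij 1 (by rw [h1] at h'; simp [h'])
  · exact h i j hij (-1) (by rw [h1] at h'; simp; linarith)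

open Classical in
def rkk (κ : ι → C) (α : ι → ℝ) (k : ι) : ℝ :=
  ((Finset.univ.filter (fun v => κ v = κ k ∧ α v < α k)).card : ℝ)

def psi (L : ℝ) (κ : ι → C) (β : ι → ℝ) : ι → ℝ := fun k => β k + L * rkk κ β k

lemma rkk_lt {κ : ι → C} {β : ι → ℝ} {v k : ι} (hc : κ v = κ k) (h : β v < β k) :
    rkk κ β v + 1 ≤ rkk κ β k := by
  classical
  unfold rkk
  have : insert v (Finset.univ.filter (fun u => κ u = κ v ∧ β u < β v)) ⊆
      Finset.univ.filter (fun u => κ u = κ k ∧ β u < β k) := by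
    intro u hu
    simp only [Finset.mem_insert, Finset.mem_filter, Finset.mem_univ, true_and] at hu ⊢
    rcases hu with rfl | ⟨h1, h2⟩
    · exact ⟨hc, h⟩
    · exact ⟨h1.trans hc, h2.trans h⟩
  have h2 := Finset.card_le_card this
  rw [Finset.card_insert_of_notMem (by simp)] at h2
  exact_mod_cast h2

lemma rkk_eq {κ : ι → C} {β : ι → ℝ} {v k : ι} (hc : κ v = κ k) (h : β v = β k) :
    rkk κ β v = rkk κ β k := by
  unfold rkk; simp only [hc, h]

lemma rkk_nonneg (κ : ι → C) (β : ι → ℝ) (k : ι) : 0 ≤ rkk κ β k := by unfold rkk; positivity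

lemma rkk_le (κ : ι → C) (β : ι → ℝ) (k : ι) : rkk κ β k ≤ Fintype.card ι := by
  unfold rkk
  exact_mod_cast Finset.card_le_univ _

lemma rkk_congr {κ : ι → C} {β γ : ι → ℝ}
    (h : ∀ v k, κ v = κ k → (γ v < γ k ↔ β v < β k)) : rkk κ γ = rkk κ β := by
  classical
  funext k
  unfold rkk
  congr 2
  ext v
  simp only [Finset.mem_filter, Finset.mem_univ, true_and]
  exact and_congr_right fun hc => h v k hc

lemma psi_lt {L : ℝ} (hL : 0 ≤ L) {κ : ι → C} {β : ι → ℝ} {v k : ι} (hc : κ v = κ k) :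
    psi L κ β v < psi L κ β k ↔ β v < β k := by
  have key : ∀ v k, κ v = κ k → β v < β k → psi L κ β v < psi L κ β k := by
    intro v k hc h
    have := rkk_lt hc h
    unfold psi
    nlinarith
  constructor
  · intro h
    by_contra hcon
    push Not at hcon
    rcases hcon.lt_or_eq with h1 | h1
    · exact absurd (key k v hc.symm h1) (not_lt.2 h.le)
    · unfold psi at h
      rw [rkk_eq hc h1.symm, h1] at h
      exact lt_irrefl _ h
  · exact key v k hc

lemma rkk_psi {L : ℝ} (hL : 0 ≤ L) (κ : ι → C) (β : ι → ℝ) : rkk κ (psi L κ β) = rkk κ β :=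
  rkk_congr fun _ _ hc => psi_lt hL hc

def noties (κ : ι → C) (β : ι → ℝ) : Prop := ∀ i j, i ≠ j → κ i = κ j → β i ≠ β j

lemma psi_inj {L : ℝ} (hL : 0 ≤ L) (κ : ι → C) : Function.Injective (psi L κ) := by
  intro β γ h
  have h1 := rkk_psi hL κ β
  rw [h, rkk_psi hL κ γ] at h1
  funext k
  have := congrFun h k
  unfold psi at this
  rw [h1] at this
  linarith

lemma psi_proper {L : ℝ} (hL : 0 ≤ L) {κ : ι → C} {β : ι → ℝ} (h : noties κ β) : proper L (psi L κ β) κ := by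
  have key : ∀ i j, κ i = κ j → β i < β j → L < psi L κ β j - psi L κ β i := by
    intro i j hc h
    have := rkk_lt hc h
    unfold psi
    nlinarith
  intro i j hij hc
  rcases lt_or_gt_of_ne (h i j hij hc) with h1 | h1
  · rw [abs_sub_comm]; exact (key i j hc h1).trans_le (le_abs_self _)
  · exact (key j i hc.symm h1).trans_le (le_abs_self _)

/-- predecessor within a colour class -/
lemma exists_pred {L : ℝ} (hL : 0 ≤ L) {κ : ι → C} {α : ι → ℝ} (h : proper L α κ) {v k : ι} (hc : κ v = κ k)
    (hv : α v < α k) : ∃ u, κ u = κ k ∧ α v ≤ α u ∧ L < α k - α u ∧ rkk κ α k = rkk κ α u + 1 ∧ (α v = α u → v = u) := by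
  classical
  let B := Finset.univ.filter (fun u => κ u = κ k ∧ α u < α k)
  have hB : B.Nonempty := ⟨v, by simp [B, hc, hv]⟩
  obtain ⟨u, hu, hmax⟩ := Finset.exists_max_image B α hB
  have hu' := hu
  simp only [B, Finset.mem_filter, Finset.mem_univ, true_and] at hu'
  have hties : ∀ w, κ w = κ k → α w = α u → w = u := by
    intro w hw he
    by_contra hne
    have := h w u hne (hw.trans hu'.1.symm)
    rw [he] at this; simp at this; linarith
  refine ⟨u, hu'.1, hmax v (by simp [B, hc, hv]), ?_, ?_, hties v hc⟩
  · have := h k u (by rintro rfl; exact lt_irrefl _ hu'.2) hu'.1.symm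
    rwa [abs_of_pos (by linarith)] at this
  · unfold rkk
    have : Finset.univ.filter (fun w => κ w = κ k ∧ α w < α k) =
        insert u (Finset.univ.filter (fun w => κ w = κ u ∧ α w < α u)) := by
      ext w
      simp only [Finset.mem_filter, Finset.mem_univ, true_and, Finset.mem_insert]
      constructor
      · rintro ⟨h1, h2⟩
        rcases (hmax w (by simp [B, h1, h2])).lt_or_eq with h3 | h3
        · exact Or.inr ⟨h1.trans hu'.1.symm, h3⟩
        · exact Or.inl (hties w h1 h3)
      · rintro (rfl | ⟨h1, h2⟩)
        · exact hu'
        · exact ⟨h1.trans hu'.1, h2.trans hu'.2⟩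
    rw [this, Finset.card_insert_of_notMem (by simp)]
    push_cast; ring

lemma proper_gap {L : ℝ} (hL : 0 ≤ L) {κ : ι → C} {α : ι → ℝ} (h : proper L α κ) :
    ∀ (n : ℕ) (v k : ι), κ v = κ k → α v < α k → rkk κ α k ≤ n → L * (rkk κ α k - rkk κ α v) < α k - α v := by
  intro n
  induction n with
  | zero =>
    intro v k hc hv hn
    have := rkk_lt hc hv
    have := rkk_nonneg κ α v
    simp at hn; linarith
  | succ n ih =>
    intro v k hc hv hn
    obtain ⟨u, h1, h2, h3, h4, h5⟩ := exists_pred hL h hc hv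
    rcases h2.lt_or_eq with h6 | h6
    · have := ih v u (hc.trans h1.symm) h6 (by push_cast at hn; linarith)
      rw [h4]; linarith
    · have := h5 h6
      subst this
      rw [h4]; linarith

lemma proper_low {L : ℝ} (hL : 0 ≤ L) {κ : ι → C} {α : ι → ℝ} (h : proper L α κ) (h0 : ∀ i, 0 ≤ α i) :
    ∀ (n : ℕ) (k : ι), rkk κ α k ≤ n → L * rkk κ α k ≤ α k := by
  classical
  intro n
  induction n with
  | zero =>
    intro k hn
    have := rkk_nonneg κ α k
    have h1 : rkk κ α k = 0 := by simp at hn; linarith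
    rw [h1]; simpa using h0 k
  | succ n ih =>
    intro k hn
    by_cases hk : ∃ v, κ v = κ k ∧ α v < α k
    · obtain ⟨v, hc, hv⟩ := hk
      obtain ⟨u, h1, h2, h3, h4, h5⟩ := exists_pred hL h hc hv
      have := ih u (by push_cast at hn; linarith)
      rw [h4]; linarith
    · have h1 : rkk κ α k = 0 := by
        unfold rkk
        rw [Nat.cast_eq_zero, Finset.card_eq_zero, Finset.filter_eq_empty_iff]
        intro v _ hv
        exact hk ⟨v, hv⟩
      rw [h1]; simpa using h0 k

lemma psi_image {L : ℝ} (hL : 0 ≤ L) (κ : ι → C) :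
    psi L κ '' (posO ι ∩ {β | noties κ β}) = posO ι ∩ {α | proper L α κ} := by
  ext α
  constructor
  · rintro ⟨β, ⟨h1, h2⟩, rfl⟩
    refine ⟨?_, psi_proper hL h2⟩
    intro i
    have := rkk_nonneg κ β i
    have := h1 i
    unfold psi; positivity
  · rintro ⟨h1, h2⟩
    have hlt : ∀ v k, κ v = κ k → α v < α k → α v - L * rkk κ α v < α k - L * rkk κ α k := by
      intro v k hc h
      have := proper_gap hL h2 (Fintype.card ι) v k hc h (rkk_le _ _ _)
      linarith
    have hr : rkk κ (fun k => α k - L * rkk κ α k) = rkk κ α := by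
      apply rkk_congr
      intro v k hc
      refine ⟨fun h => ?_, hlt v k hc⟩
      by_contra hcon
      push Not at hcon
      rcases hcon.lt_or_eq with h3 | h3
      · have := hlt k v hc.symm h3; linarith
      · simp only [h3, rkk_eq hc h3.symm] at h; exact lt_irrefl _ h
    refine ⟨fun k => α k - L * rkk κ α k, ⟨?_, ?_⟩, ?_⟩
    · intro k
      have := proper_low hL h2 h1 (Fintype.card ι) k (rkk_le _ _ _)
      simp only; linarith
    · intro i j hij hc
      have h3 : α i ≠ α j := by
        intro h
        have := h2 i j hij hc
        rw [h] at this; simp at this; linarith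
      rcases lt_or_gt_of_ne h3 with h4 | h4
      · exact (hlt i j hc h4).ne
      · exact (hlt j i hc.symm h4).ne'
    · funext k
      unfold psi
      rw [hr]; ring

lemma rkk_eventually {κ : ι → C} {β : ι → ℝ} (h : noties κ β) : ∀ᶠ γ in nhds β, rkk κ γ = rkk κ β := by
  have : ∀ v k, ∀ᶠ γ in nhds β, κ v = κ k → (γ v < γ k ↔ β v < β k) := by
    intro v k
    by_cases hvk : v = k
    · subst hvk; simp
    by_cases hc : κ v = κ k
    · rcases lt_or_gt_of_ne (h v k hvk hc) with h1 | h1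
      · have := ContinuousAt.eventually_lt (f := fun γ : ι → ℝ => γ v) (g := fun γ : ι → ℝ => γ k) (x₀ := β) (continuous_apply _).continuousAt (continuous_apply _).continuousAt h1
        filter_upwards [this] with γ hγ _
        simp [hγ, h1]
      · have := ContinuousAt.eventually_lt (f := fun γ : ι → ℝ => γ k) (g := fun γ : ι → ℝ => γ v) (x₀ := β) (continuous_apply _).continuousAt (continuous_apply _).continuousAt h1
        filter_upwards [this] with γ hγ _
        exact ⟨fun h => absurd h (not_lt.2 (le_of_lt hγ)), fun h => absurd h (not_lt.2 (le_of_lt h1))⟩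
    · simp [hc]
  have h2 : ∀ᶠ γ in nhds β, ∀ v k, κ v = κ k → (γ v < γ k ↔ β v < β k) := by
    rw [eventually_all]; intro v; rw [eventually_all]; intro k; exact this v k
  filter_upwards [h2] with γ hγ
  exact rkk_congr hγ

lemma meas_noties (κ : ι → C) : MeasurableSet {β : ι → ℝ | noties κ β} := by
  classical
  have : {β : ι → ℝ | noties κ β} = ⋂ i, ⋂ j, {β : ι → ℝ | i ≠ j → κ i = κ j → β i ≠ β j} := by
    ext; simp [noties]
  rw [this]
  refine MeasurableSet.iInter fun i => MeasurableSet.iInter fun j => ?_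
  by_cases h : i ≠ j ∧ κ i = κ j
  swap
  · convert MeasurableSet.univ
    ext β
    constructor
    · intro _; trivial
    · intro _ h1 h2; exact absurd ⟨h1, h2⟩ h
  have e : {β : ι → ℝ | i ≠ j → κ i = κ j → β i ≠ β j} = {β : ι → ℝ | β i = β j}ᶜ := by
    ext β; simp [h.1, h.2]
  rw [e]
  exact (measurableSet_eq_fun (f := fun β : ι → ℝ => β i) (g := fun β : ι → ℝ => β j) (by fun_prop) (by fun_prop)).compl

lemma noties_ae (κ : ι → C) : ∀ᵐ β : ι → ℝ, noties κ β := by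
  filter_upwards [gen_ae (ι := ι) 0] with β h i j hij _ he
  exact hij (h.inj he)

lemma subst {L : ℝ} (hL : 0 ≤ L) (κ : ι → C) (F : (ι → ℝ) → ℝ) :
    ∫ α in posO ι ∩ {α | proper L α κ}, F α = ∫ β in posO ι, F (psi L κ β) := by
  rw [← psi_image hL κ]
  rw [integral_image_eq_integral_abs_det_fderiv_smul volume (meas_posO.inter (meas_noties κ))
    (f' := fun _ => ContinuousLinearMap.id ℝ (ι → ℝ)) ?_ (psi_inj hL κ).injOn]
  · simp only [ContinuousLinearMap.det, ContinuousLinearMap.coe_id, LinearMap.det_id, abs_one, one_smul]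
    apply setIntegral_congr_set
    have h : ∀ᵐ β : ι → ℝ, β ∈ {β : ι → ℝ | noties κ β} := noties_ae κ
    filter_upwards [h] with β hβ
    apply propext
    exact ⟨fun h => h.1, fun h => ⟨h, hβ⟩⟩
  · rintro β ⟨h1, h2⟩
    have h3 := rkk_eventually h2
    apply HasFDerivAt.hasFDerivWithinAt
    have h4 : HasFDerivAt (fun γ : ι → ℝ => γ + (fun k => L * rkk κ β k)) (ContinuousLinearMap.id ℝ (ι → ℝ)) β :=
      (hasFDerivAt_id β).add_const _
    refine h4.congr_of_eventuallyEq ?_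
    filter_upwards [h3] with γ hγ
    funext k
    simp [psi, hγ]

end QT

namespace QT
open Equiv Equiv.Perm

variable {ι : Type*} [Fintype ι] [DecidableEq ι] {C : Type*} [DecidableEq C]

def DD (L : ℝ) (α : ι → ℝ) : ℝ := (1/2) * ∑ i, ∑ j, if i = j then 0 else max (L - |α i - α j|) 0

def PP (s t L : ℝ) (α : ι → ℝ) : ℝ := Real.exp (-(t * ∑ i, α i) - s * DD L α)

def EX (t : ℝ) (α : ι → ℝ) : ℝ := Real.exp (-(t * ∑ i, α i))

lemma EX_prod (t : ℝ) (α : ι → ℝ) : EX t α = ∏ i, Real.exp (-t * α i) := by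
  unfold EX
  rw [← Real.exp_sum, Finset.mul_sum, ← Finset.sum_neg_distrib]
  simp

lemma posO_restrict : (volume : Measure (ι → ℝ)).restrict (posO ι) =
    Measure.pi (fun _ : ι => (volume : Measure ℝ).restrict (Set.Ici 0)) := by
  have : posO ι = Set.univ.pi (fun _ : ι => Set.Ici (0:ℝ)) := by
    ext x; simp only [posO, Set.mem_pi, Set.mem_univ, true_imp_iff, Set.mem_Ici]; rfl
  rw [this, volume_pi, Measure.restrict_pi_pi]

lemma EX_int {t : ℝ} (ht : 0 < t) : IntegrableOn (EX (ι := ι) t) (posO ι) := by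
  unfold IntegrableOn
  rw [posO_restrict, funext (EX_prod (ι := ι) t)]
  apply Integrable.fintype_prod (f := fun _ x => Real.exp (-t * x))
  intro i
  exact (integrableOn_Ici_iff_integrableOn_Ioi).2 (integrableOn_exp_mul_Ioi (by linarith) 0)

lemma EX_integral {t : ℝ} (ht : 0 < t) : ∫ α in posO ι, EX t α = (t⁻¹) ^ (Fintype.card ι) := by
  rw [posO_restrict, funext (EX_prod (ι := ι) t),
    integral_fintype_prod_eq_pow (fun x => Real.exp (-t * x)), integral_Ici_eq_integral_Ioi,
    integral_exp_mul_Ioi (by linarith)]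
  congr 1
  simp

lemma DD_nonneg (L : ℝ) (α : ι → ℝ) : 0 ≤ DD L α := by
  unfold DD
  have : ∀ i j, 0 ≤ (if i = j then 0 else max (L - |α i - α j|) 0) := by
    intro i j; split_ifs
    · exact le_rfl
    · exact le_max_right _ _
  have := Finset.sum_nonneg (s := Finset.univ) fun i _ => Finset.sum_nonneg (s := Finset.univ) fun j _ => this i j
  linarith

lemma PP_le {s t L : ℝ} (hs : 0 ≤ s) (α : ι → ℝ) : PP s t L α ≤ EX t α := by
  unfold PP EX
  apply Real.exp_le_exp.2
  have := mul_nonneg hs (DD_nonneg L α)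
  linarith

lemma PP_pos {s t L : ℝ} (α : ι → ℝ) : 0 < PP s t L α := Real.exp_pos _

lemma DD_cont (L : ℝ) : Continuous (DD (ι := ι) L) := by
  unfold DD
  refine continuous_const.mul (continuous_finsetSum _ fun i _ => continuous_finsetSum _ fun j _ => ?_)
  split_ifs <;> fun_prop

lemma PP_cont (s t L : ℝ) : Continuous (PP (ι := ι) s t L) := by
  unfold PP
  have := DD_cont (ι := ι) L
  fun_prop

lemma PP_int {s t L : ℝ} (hs : 0 ≤ s) (ht : 0 < t) : IntegrableOn (PP (ι := ι) s t L) (posO ι) := by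
  refine Integrable.mono' (EX_int ht) (PP_cont s t L).aestronglyMeasurable (ae_of_all _ fun α => ?_)
  rw [Real.norm_of_nonneg (PP_pos α).le]
  exact PP_le hs α

/-- bounded measurable times PP is integrable -/
lemma PP_mul_int {s t L : ℝ} (hs : 0 ≤ s) (ht : 0 < t) {F : (ι → ℝ) → ℝ} (hF : Measurable F) {M : ℝ}
    (hM : ∀ α, |F α| ≤ M) : IntegrableOn (fun α => PP (ι := ι) s t L α * F α) (posO ι) := by
  have := (PP_int (ι := ι) (L := L) hs ht).mul_bdd (c := M) hF.aestronglyMeasurable (ae_of_all _ fun α => by simpa using hM α)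
  exact this

lemma rkk_meas (κ : ι → C) (k : ι) : Measurable (fun β : ι → ℝ => rkk κ β k) := by
  classical
  have : (fun β : ι → ℝ => rkk κ β k) = fun β => ∑ v, if κ v = κ k ∧ β v < β k then (1:ℝ) else 0 := by
    funext β
    unfold rkk
    rw [Finset.sum_boole]
  rw [this]
  refine Finset.measurable_sum _ fun v _ => ?_
  by_cases h : κ v = κ k
  · simp only [h, true_and]
    exact Measurable.ite (measurableSet_lt (measurable_pi_apply v) (measurable_pi_apply k)) measurable_const measurable_const
  · simp [h]

lemma psi_meas (L : ℝ) (κ : ι → C) : Measurable (psi (ι := ι) L κ) := by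
  refine measurable_pi_iff.2 fun k => ?_
  unfold psi
  exact (measurable_pi_apply k).add ((rkk_meas κ k).const_mul L)

open Classical in
def NN (L : ℝ) (κ : ι → C) (α : ι → ℝ) : ℝ :=
  (1/2) * ∑ i, ∑ j, if i = j then 0 else if |α i - α j| < L then
    1 - (if 0 < α i - α j then rkk κ α i - rkk κ α j else -(rkk κ α i - rkk κ α j)) else 0

def Phi (s t L : ℝ) (κ : ι → C) (α : ι → ℝ) : ℝ := -(t * ∑ k, rkk κ α k) - s * NN L κ α

lemma NN_meas (L : ℝ) (κ : ι → C) : Measurable (NN (ι := ι) L κ) := by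
  classical
  unfold NN
  refine (Finset.measurable_sum _ fun i _ => Finset.measurable_sum _ fun j _ => ?_).const_mul _
  have h1 := rkk_meas κ i
  have h2 := rkk_meas κ j
  by_cases hij : i = j
  · simp [hij]
  simp only [hij, if_false]
  refine Measurable.ite (measurableSet_lt (by fun_prop) measurable_const) ?_ measurable_const
  refine measurable_const.sub (Measurable.ite (measurableSet_lt measurable_const (by fun_prop)) ?_ ?_)
  · exact h1.sub h2
  · exact (h1.sub h2).neg

lemma Phi_meas (s t L : ℝ) (κ : ι → C) : Measurable (Phi (ι := ι) s t L κ) := by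
  unfold Phi
  have h1 := NN_meas (ι := ι) L κ
  have h2 := fun k => rkk_meas κ k
  have h3 : Measurable (fun α : ι → ℝ => ∑ k, rkk κ α k) := Finset.measurable_sum _ fun k _ => h2 k
  exact (h3.const_mul t).neg.sub (h1.const_mul s)

lemma max_deriv {δ ρ L : ℝ} (h0 : δ + L * ρ ≠ 0) (h1 : |δ + L * ρ| ≠ L) :
    HasDerivAt (fun l => max (l - |δ + l * ρ|) 0)
      (if |δ + L * ρ| < L then 1 - (if 0 < δ + L * ρ then ρ else -ρ) else 0) L := by
  have hlin : HasDerivAt (fun l => δ + l * ρ) ρ L := by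
    simpa using ((hasDerivAt_id L).mul_const ρ).const_add δ
  have habs : HasDerivAt (fun l => |δ + l * ρ|) (if 0 < δ + L * ρ then ρ else -ρ) L := by
    split_ifs with h
    · have := (hasDerivAt_abs_pos h).comp L hlin
      rw [one_mul] at this
      exact this
    · have h' : δ + L * ρ < 0 := lt_of_le_of_ne (not_lt.1 h) h0
      have := (hasDerivAt_abs_neg h').comp L hlin
      rw [neg_one_mul] at this
      exact this
  have hd : HasDerivAt (fun l => l - |δ + l * ρ|) (1 - (if 0 < δ + L * ρ then ρ else -ρ)) L :=
    (hasDerivAt_id L).sub habs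
  have hcont := hd.continuousAt
  rcases lt_or_gt_of_ne h1 with h | h
  · rw [if_pos h]
    refine hd.congr_of_eventuallyEq ?_
    have := hcont.eventually (lt_mem_nhds (show (0:ℝ) < L - |δ + L * ρ| by linarith))
    filter_upwards [this] with l hl
    exact max_eq_left (le_of_lt hl)
  · rw [if_neg (not_lt.2 h.le)]
    refine (hasDerivAt_const L (0:ℝ)).congr_of_eventuallyEq ?_
    have := hcont.eventually (gt_mem_nhds (show L - |δ + L * ρ| < 0 by linarith))
    filter_upwards [this] with l hl
    exact max_eq_right (le_of_lt hl)

lemma psi_sub (L : ℝ) (κ : ι → C) (β : ι → ℝ) (i j : ι) :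
    psi L κ β i - psi L κ β j = (β i - β j) + L * (rkk κ β i - rkk κ β j) := by
  unfold psi; ring

lemma rkk_int (κ : ι → C) (β : ι → ℝ) (i j : ι) : ∃ m : ℤ, rkk κ β i - rkk κ β j = m := by
  unfold rkk
  exact ⟨(_ : ℕ) - (_ : ℕ), by push_cast; rfl⟩

lemma PP_psi_deriv {s t L : ℝ} (hL : 0 < L) {κ : ι → C} {β : ι → ℝ} (hβ : gen L β) :
    HasDerivAt (fun l => PP s t l (psi l κ β)) (PP s t L (psi L κ β) * Phi s t L κ (psi L κ β)) L := by
  classical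
  have hS : HasDerivAt (fun l => ∑ i, psi l κ β i) (∑ k, rkk κ β k) L := by
    apply HasDerivAt.fun_sum
    intro k _
    unfold psi
    simpa using ((hasDerivAt_id L).mul_const (rkk κ β k)).const_add (β k)
  have hD : HasDerivAt (fun l => DD l (psi l κ β)) (NN L κ (psi L κ β)) L := by
    unfold DD NN
    apply HasDerivAt.const_mul
    apply HasDerivAt.fun_sum
    intro i _
    apply HasDerivAt.fun_sum
    intro j _
    by_cases hij : i = j
    · simp only [hij, if_true]; exact hasDerivAt_const _ _
    · simp only [hij, if_false, psi_sub, rkk_psi hL.le]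
      obtain ⟨m, hm⟩ := rkk_int κ β i j
      apply max_deriv
      · intro h
        refine hβ i j hij (-m) ?_
        rw [hm] at h
        push_cast; linarith
      · intro h
        rcases abs_choice ((β i - β j) + L * (rkk κ β i - rkk κ β j)) with h1 | h1
        · refine hβ i j hij (1 - m) ?_
          rw [h1, hm] at h
          push_cast; linarith
        · refine hβ i j hij (-1 - m) ?_
          rw [h1, hm] at h
          push_cast; linarith
  unfold PP Phi
  rw [rkk_psi hL.le]
  exact ((hS.const_mul t).neg.sub (hD.const_mul s)).exp

lemma exp_lip {u v : ℝ} (hu : 0 ≤ u) (hv : 0 ≤ v) : |Real.exp (-u) - Real.exp (-v)| ≤ |u - v| := by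
  have key : ∀ u v : ℝ, 0 ≤ u → u ≤ v → |Real.exp (-u) - Real.exp (-v)| ≤ |u - v| := by
    intro u v hu huv
    have h1 : Real.exp (-v) ≤ Real.exp (-u) := Real.exp_le_exp.2 (by linarith)
    rw [abs_of_nonneg (by linarith), abs_of_nonpos (by linarith)]
    have h2 : Real.exp (-u) ≤ 1 := by rw [← Real.exp_zero]; exact Real.exp_le_exp.2 (by linarith)
    have h3 : Real.exp (-v) = Real.exp (-u) * Real.exp (u - v) := by rw [← Real.exp_add]; congr 1; ring
    have h4 := Real.add_one_le_exp (u - v)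
    have h5 := Real.exp_pos (-u)
    rw [h3]
    nlinarith
  rcases le_total u v with h | h
  · exact key u v hu h
  · rw [abs_sub_comm, abs_sub_comm u]; exact key v u hv h

lemma DD_lip (κ : ι → C) (β : ι → ℝ) (l l' : ℝ) :
    |DD l (psi l κ β) - DD l' (psi l' κ β)| ≤ ((Fintype.card ι : ℝ)^2 * (1 + Fintype.card ι)) * |l - l'| := by
  classical
  unfold DD
  rw [← mul_sub, ← Finset.sum_sub_distrib]
  simp only [← Finset.sum_sub_distrib]
  have hterm : ∀ i j : ι, |((if i = j then 0 else max (l - |psi l κ β i - psi l κ β j|) 0) -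
      (if i = j then 0 else max (l' - |psi l' κ β i - psi l' κ β j|) 0))| ≤ (1 + Fintype.card ι) * |l - l'| := by
    intro i j
    by_cases hij : i = j
    · simp only [hij, if_true, sub_self, abs_zero]; positivity
    simp only [hij, if_false, psi_sub]
    have hρ : |rkk κ β i - rkk κ β j| ≤ Fintype.card ι := by
      have h1 := rkk_le κ β i
      have h2 := rkk_le κ β j
      have h3 := rkk_nonneg κ β i
      have h4 := rkk_nonneg κ β j
      rw [abs_le]; constructor <;> linarith
    set ρ := rkk κ β i - rkk κ β j
    set δ := β i - β j
    have e1 := abs_max_sub_max_le_abs (l - |δ + l * ρ|) (l' - |δ + l' * ρ|) 0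
    have e2 : |l - |δ + l * ρ| - (l' - |δ + l' * ρ|)| ≤ |l - l'| + |l - l'| * |ρ| := by
      have e3 : l - |δ + l * ρ| - (l' - |δ + l' * ρ|) = (l - l') - (|δ + l * ρ| - |δ + l' * ρ|) := by ring
      rw [e3]
      have e4 := abs_abs_sub_abs_le_abs_sub (δ + l * ρ) (δ + l' * ρ)
      have e5 : δ + l * ρ - (δ + l' * ρ) = (l - l') * ρ := by ring
      rw [e5, abs_mul] at e4
      exact (abs_sub _ _).trans (by linarith)
    have := mul_le_mul_of_nonneg_left hρ (abs_nonneg (l - l'))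
    linarith
  rw [abs_mul]
  have h1 : |∑ i : ι, ∑ j : ι, ((if i = j then 0 else max (l - |psi l κ β i - psi l κ β j|) 0) -
      (if i = j then 0 else max (l' - |psi l' κ β i - psi l' κ β j|) 0))| ≤
      ∑ i : ι, ∑ j : ι, (1 + Fintype.card ι) * |l - l'| := by
    refine (Finset.abs_sum_le_sum_abs _ _).trans (Finset.sum_le_sum fun i _ => ?_)
    exact (Finset.abs_sum_le_sum_abs _ _).trans (Finset.sum_le_sum fun j _ => hterm i j)
  simp only [Finset.sum_const, Finset.card_univ, nsmul_eq_mul] at h1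
  have h2 : |(1/2 : ℝ)| = 1/2 := by norm_num
  rw [h2]
  have : 0 ≤ (Fintype.card ι : ℝ)^2 * (1 + Fintype.card ι) * |l - l'| := by positivity
  nlinarith

def lipc (ι : Type*) [Fintype ι] (s t : ℝ) : ℝ :=
  t * (Fintype.card ι : ℝ)^2 + s * ((Fintype.card ι : ℝ)^2 * (1 + Fintype.card ι))

lemma PP_psi_lip {s t : ℝ} (hs : 0 ≤ s) (ht : 0 ≤ t) (κ : ι → C) (β : ι → ℝ) {l l' : ℝ} (hl : 0 ≤ l) (hl' : 0 ≤ l') :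
    |PP s t l (psi l κ β) - PP s t l' (psi l' κ β)| ≤ (EX t β * lipc ι s t) * |l - l'| := by
  have hR : 0 ≤ ∑ k, rkk κ β k := Finset.sum_nonneg fun k _ => rkk_nonneg κ β k
  have hR' : ∑ k, rkk κ β k ≤ (Fintype.card ι : ℝ)^2 := by
    have := Finset.sum_le_sum (s := Finset.univ) fun k _ => rkk_le κ β k
    simp only [Finset.sum_const, Finset.card_univ, nsmul_eq_mul] at this
    linarith
  set R := ∑ k, rkk κ β k with hRdef
  have hsum : ∀ l, ∑ k, psi l κ β k = ∑ k, β k + l * R := by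
    intro l; unfold psi; rw [Finset.sum_add_distrib, hRdef, Finset.mul_sum]
  have hP : ∀ l, PP s t l (psi l κ β) = EX t β * Real.exp (-(t * l * R + s * DD l (psi l κ β))) := by
    intro l
    unfold PP EX
    rw [hsum, ← Real.exp_add]; congr 1; ring
  rw [hP, hP, ← mul_sub, abs_mul, abs_of_pos (show 0 < EX t β from Real.exp_pos _), mul_assoc (EX t β)]
  refine mul_le_mul_of_nonneg_left ?_ (show 0 < EX t β from Real.exp_pos _).le
  refine (exp_lip (add_nonneg (by positivity) (mul_nonneg hs (DD_nonneg _ _)))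
    (add_nonneg (by positivity) (mul_nonneg hs (DD_nonneg _ _)))).trans ?_
  have e : t * l * R + s * DD l (psi l κ β) - (t * l' * R + s * DD l' (psi l' κ β)) =
    t * R * (l - l') + s * (DD l (psi l κ β) - DD l' (psi l' κ β)) := by ring
  rw [e]
  refine (abs_add_le _ _).trans ?_
  rw [abs_mul, abs_mul, abs_mul, abs_of_nonneg ht, abs_of_nonneg hs, abs_of_nonneg hR]
  have h1 := mul_le_mul_of_nonneg_left (DD_lip κ β l l') hs
  have h2 : t * R * |l - l'| ≤ t * (Fintype.card ι : ℝ)^2 * |l - l'| := by gcongr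
  unfold lipc
  linarith

def hh (s t : ℝ) (κ : ι → C) (L : ℝ) : ℝ := ∫ β in posO ι, PP s t L (psi L κ β)

lemma PP_psi_int {s t L : ℝ} (hs : 0 ≤ s) (ht : 0 < t) (hL : 0 ≤ L) (κ : ι → C) :
    IntegrableOn (fun β => PP s t L (psi L κ β)) (posO ι) := by
  refine Integrable.mono' (EX_int ht) ((PP_cont s t L).measurable.comp (psi_meas L κ)).aestronglyMeasurable
    (ae_of_all _ fun β => ?_)
  rw [Real.norm_of_nonneg (PP_pos _).le]
  refine (PP_le hs _).trans ?_
  unfold EX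
  apply Real.exp_le_exp.2
  have : ∑ i, β i ≤ ∑ i, psi L κ β i := Finset.sum_le_sum fun i _ => by
    have := mul_nonneg hL (rkk_nonneg κ β i)
    unfold psi; linarith
  nlinarith

lemma hh_lip {s t : ℝ} (hs : 0 ≤ s) (ht : 0 < t) (κ : ι → C) {l l' : ℝ} (hl : 0 ≤ l) (hl' : 0 ≤ l') :
    |hh s t κ l - hh s t κ l'| ≤ ((∫ β in posO ι, EX t β) * lipc ι s t) * |l - l'| := by
  unfold hh
  rw [← integral_sub (PP_psi_int hs ht hl κ) (PP_psi_int hs ht hl' κ), ← Real.norm_eq_abs]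
  rw [← integral_mul_const, ← integral_mul_const]
  refine norm_integral_le_of_norm_le (((EX_int ht).mul_const _).mul_const _) (ae_of_all _ fun β => ?_)
  exact PP_psi_lip hs ht.le κ β hl hl'

lemma hh_contOn {s t : ℝ} (hs : 0 ≤ s) (ht : 0 < t) (κ : ι → C) : ContinuousOn (hh s t κ) (Set.Ici 0) := by
  have hc : 0 ≤ (∫ β in posO ι, EX t β) * lipc ι s t := by
    apply mul_nonneg
    · exact integral_nonneg fun β => (Real.exp_pos _).le
    · unfold lipc; positivity
  have : LipschitzOnWith ⟨_, hc⟩ (hh s t κ) (Set.Ici 0) := by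
    apply LipschitzOnWith.of_dist_le_mul
    intro x hx y hy
    rw [Real.dist_eq, Real.dist_eq]
    exact hh_lip hs ht κ hx hy
  exact this.continuousOn

lemma hh_zero {s t : ℝ} (ht : 0 < t) (κ : ι → C) : hh s t κ 0 = (t⁻¹) ^ (Fintype.card ι) := by
  rw [← EX_integral ht]
  unfold hh
  congr 1
  funext β
  have h1 : psi 0 κ β = β := by funext k; simp [psi]
  rw [h1]
  unfold PP EX
  have : DD 0 β = 0 := by
    unfold DD
    have : ∀ i j, max (0 - |β i - β j|) 0 = 0 := by
      intro i j; apply max_eq_right; simp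
    simp [this]
  rw [this]; simp

lemma hh_deriv {s t L : ℝ} (hs : 0 ≤ s) (ht : 0 < t) (hL : 0 < L) (κ : ι → C) :
    HasDerivAt (hh s t κ) (∫ α in posO ι ∩ {α | proper L α κ}, PP s t L α * Phi s t L κ α) L := by
  rw [subst hL.le κ (fun α => PP s t L α * Phi s t L κ α)]
  have h0 : 0 ≤ lipc ι s t := by unfold lipc; positivity
  refine (hasDerivAt_integral_of_dominated_loc_of_lip (μ := volume.restrict (posO ι))
    (F := fun l β => PP s t l (psi l κ β))
    (F' := fun β => PP s t L (psi L κ β) * Phi s t L κ (psi L κ β)) (s := Set.Ioi 0) (x₀ := L)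
    (bound := fun β => EX t β * lipc ι s t) (Ioi_mem_nhds hL) ?_ ?_ ?_ ?_ ?_ ?_).2
  · exact Eventually.of_forall fun l => ((PP_cont s t l).measurable.comp (psi_meas l κ)).aestronglyMeasurable
  · exact PP_psi_int hs ht hL.le κ
  · exact (((PP_cont s t L).measurable.comp (psi_meas L κ)).mul
      ((Phi_meas s t L κ).comp (psi_meas L κ))).aestronglyMeasurable
  · refine ae_of_all _ fun β => ?_
    apply LipschitzOnWith.of_dist_le_mul
    intro x hx y hy
    rw [Real.dist_eq, Real.dist_eq, Real.coe_nnabs, abs_of_nonneg (mul_nonneg (show 0 < EX t β from Real.exp_pos _).le h0)]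
    exact PP_psi_lip hs ht.le κ β (le_of_lt hx) (le_of_lt hy)
  · exact (EX_int ht).mul_const _
  · apply ae_restrict_of_ae
    filter_upwards [gen_ae (ι := ι) L] with β hβ
    exact PP_psi_deriv hL hβ

end QT

namespace QT
open Equiv Equiv.Perm

variable {ι : Type*} [Fintype ι] [DecidableEq ι] {C : Type*} [DecidableEq C]

lemma int_relabel (g : Perm ι) (F : (ι → ℝ) → ℝ) :
    ∫ α in posO ι, F (α ∘ g) = ∫ α in posO ι, F α := by
  have hmp := volume_measurePreserving_piCongrLeft (fun _ : ι => ℝ) g⁻¹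
  have he : ∀ α : ι → ℝ, (MeasurableEquiv.piCongrLeft (fun _ : ι => ℝ) g⁻¹) α = α ∘ g := by
    intro α
    funext i
    have := Equiv.piCongrLeft_apply_apply (fun _ : ι => ℝ) g⁻¹ α (g i)
    rw [MeasurableEquiv.coe_piCongrLeft]
    have h2 : g⁻¹ (g i) = i := by simp
    rw [h2] at this
    exact this
  have := hmp.setIntegral_preimage_emb (MeasurableEquiv.measurableEmbedding _) F (posO ι)
  rw [← this]
  simp only [he]
  congr 2
  ext α
  simp only [Set.mem_preimage, he]
  constructor
  · intro h i; exact h (g i)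
  · intro h i; have := h (g⁻¹ i); simpa using this

lemma DD_relabel (L : ℝ) (g : Perm ι) (α : ι → ℝ) : DD L (α ∘ g) = DD L α := by
  unfold DD
  congr 1
  rw [← Equiv.sum_comp g (fun i => ∑ j, if i = j then 0 else max (L - |α i - α j|) 0)]
  refine Finset.sum_congr rfl fun i _ => ?_
  rw [← Equiv.sum_comp g (fun j => if g i = j then 0 else max (L - |α (g i) - α j|) 0)]
  simp

lemma PP_relabel (s t L : ℝ) (g : Perm ι) (α : ι → ℝ) : PP s t L (α ∘ g) = PP s t L α := by
  unfold PP
  rw [DD_relabel]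
  congr 4
  exact Equiv.sum_comp g α

def GG (s t L : ℝ) (π : Perm ι) : ℝ := ∫ α in posO ι, PP s t L α * II L α π

lemma GG_cl (s t L : ℝ) : IsCl (GG (ι := ι) s t L) := by
  classical
  intro g π
  unfold GG
  rw [← int_relabel g (fun α => PP s t L α * II L α π)]
  congr 1
  funext α
  rw [PP_relabel]
  congr 1
  unfold II
  congr 1
  rw [eq_iff_iff]
  constructor
  · intro h i
    have := h (g i)
    simpa using this
  · intro h i
    have := h (g⁻¹ i)
    simpa using this

lemma meas_II (L : ℝ) (π : Perm ι) : Measurable (fun α : ι → ℝ => II L α π) := by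
  classical
  unfold II
  refine Measurable.ite ?_ measurable_const measurable_const
  have : {α : ι → ℝ | ∀ i, α (π i) ≤ α i + L} = ⋂ i, {α : ι → ℝ | α (π i) ≤ α i + L} := by ext; simp
  rw [this]
  exact MeasurableSet.iInter fun i => measurableSet_le (by fun_prop) (by fun_prop)

lemma II_bd (L : ℝ) (α : ι → ℝ) (π : Perm ι) : |II L α π| ≤ 1 := by
  unfold II; split_ifs <;> simp

lemma GG_int {s t : ℝ} (hs : 0 ≤ s) (ht : 0 < t) (L : ℝ) (π : Perm ι) :
    IntegrableOn (fun α : ι → ℝ => PP s t L α * II L α π) (posO ι) :=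
  PP_mul_int hs ht (meas_II L π) (fun α => II_bd L α π)

lemma meas_proper (L : ℝ) (κ : ι → C) : MeasurableSet {α : ι → ℝ | proper L α κ} := by
  have : {α : ι → ℝ | proper L α κ} = ⋂ i, ⋂ j, ⋂ (_ : i ≠ j), ⋂ (_ : κ i = κ j), {α : ι → ℝ | L < |α i - α j|} := by
    ext; simp [proper]
  rw [this]
  refine MeasurableSet.iInter fun i => MeasurableSet.iInter fun j => MeasurableSet.iInter fun _ =>
    MeasurableSet.iInter fun _ => measurableSet_lt measurable_const (by fun_prop)

open Classical in
lemma int_proper (L : ℝ) (κ : ι → C) (F : (ι → ℝ) → ℝ) :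
    ∫ α in posO ι ∩ {α | proper L α κ}, F α = ∫ α in posO ι, (if proper L α κ then F α else 0) := by
  rw [← setIntegral_indicator (meas_proper L κ)]
  congr 1

open Classical in
lemma HT_GG' {s t L : ℝ} (hs : 0 ≤ s) (ht : 0 < t) (hL : 0 ≤ L) (κ : ι → C) :
    HT (GG s t L) κ = ∫ α in posO ι, PP s t L α * (if proper L α κ then 1 else 0) := by
  unfold HT GG
  simp only [← integral_const_mul]
  rw [← integral_finsetSum]
  · congr 1
    funext α
    rw [← det_lemma hL α κ]
    unfold HT
    rw [Finset.mul_sum]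
    refine Finset.sum_congr rfl fun π _ => ?_
    ring
  · intro π _
    exact (GG_int hs ht L π).const_mul _

lemma HT_GG {s t L : ℝ} (hs : 0 ≤ s) (ht : 0 < t) (hL : 0 ≤ L) (κ : ι → C) :
    HT (GG s t L) κ = hh s t κ L := by
  classical
  rw [HT_GG' hs ht hL, hh, ← subst hL κ (PP s t L), int_proper]
  congr 1
  funext α
  split_ifs <;> simp

def CC (κ : ι → C) : ℝ := (1/2) * ∑ i, ∑ j, if i = j then 0 else if κ i = κ j then 1 else 0

lemma proper.noties {L : ℝ} (hL : 0 ≤ L) {κ : ι → C} {α : ι → ℝ} (h : proper L α κ) : noties κ α := by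
  intro i j hij hc he
  have := h i j hij hc
  rw [he] at this; simp at this; linarith

lemma sum_rkk {κ : ι → C} {α : ι → ℝ} (h : noties κ α) : ∑ k, rkk κ α k = CC κ := by
  classical
  have h1 : ∀ k, rkk κ α k = ∑ v, if κ v = κ k ∧ α v < α k then (1:ℝ) else 0 := by
    intro k; unfold rkk; rw [Finset.sum_boole]
  simp only [h1]
  have h2 := Finset.sum_comm (s := (Finset.univ : Finset ι)) (t := (Finset.univ : Finset ι))
    (f := fun k v => if κ v = κ k ∧ α v < α k then (1:ℝ) else 0)
  have h3 : ∑ k, ∑ v, ((if κ v = κ k ∧ α v < α k then (1:ℝ) else 0) + (if κ k = κ v ∧ α k < α v then (1:ℝ) else 0)) =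
      ∑ i, ∑ j, if i = j then 0 else if κ i = κ j then (1:ℝ) else 0 := by
    refine Finset.sum_congr rfl fun i _ => Finset.sum_congr rfl fun j _ => ?_
    by_cases hij : i = j
    · subst hij; simp
    by_cases hc : κ i = κ j
    · rcases lt_or_gt_of_ne (h i j hij hc) with h4 | h4
      · simp [hij, hc, h4, h4.le]
      · simp [hij, hc, h4, h4.le]
    · simp [hij, hc, Ne.symm hc]
  unfold CC
  rw [← h3]
  simp only [Finset.sum_add_distrib]
  rw [← h2]
  ring

def Wpt (L : ℝ) (α : ι → ℝ) (κ : ι → C) (c d : C) : ℝ :=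
  ww L α (SS κ c d) (Finset.univ.filter (fun i => κ i = c))

lemma rk_rkk {κ : ι → C} {c d : C} (hcd : c ≠ d) (α : ι → ℝ) {i : ι} (hi : i ∈ SS κ c d) :
    rk α (SS κ c d) (Finset.univ.filter (fun i => κ i = c)) i = rkk κ α i := by
  classical
  unfold rk rkk
  congr 2
  ext v
  simp only [Finset.mem_filter, Finset.mem_univ, true_and, mem_SS]
  rw [mem_SS] at hi
  constructor
  · rintro ⟨h1, h2, h3⟩
    refine ⟨?_, h3⟩
    rcases h1 with h1 | h1 <;> rcases hi with hi | hi <;> simp_all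
  · rintro ⟨h1, h2⟩
    rw [h1]
    tauto

open Classical in
def ee (L : ℝ) (κ : ι → C) (α : ι → ℝ) (b a : ι) : ℝ :=
  if α a < α b ∧ α b - α a < L then 1 - rkk κ α b + rkk κ α a else 0

lemma NN_ee {L : ℝ} {κ : ι → C} {α : ι → ℝ} (hα : Function.Injective α) :
    NN L κ α = ∑ i, ∑ j, ee L κ α i j := by
  classical
  have h1 : ∀ i j, (if i = j then 0 else if |α i - α j| < L then
    1 - (if 0 < α i - α j then rkk κ α i - rkk κ α j else -(rkk κ α i - rkk κ α j)) else 0) =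
      ee L κ α i j + ee L κ α j i := by
    intro i j
    unfold ee
    by_cases hij : i = j
    · subst hij; simp
    rw [if_neg hij]
    rcases lt_or_gt_of_ne (fun h => hij (hα h)) with h | h
    · rw [abs_of_neg (by linarith), if_neg (show ¬ (0 < α i - α j) by linarith)]
      simp only [h, h.not_gt, false_and, if_false, true_and, zero_add, neg_sub]
      split_ifs <;> ring
    · rw [abs_of_pos (by linarith), if_pos (show (0 < α i - α j) by linarith)]
      simp only [h, h.not_gt, false_and, if_false, true_and, add_zero]
      split_ifs <;> ring
  unfold NN
  simp only [h1, Finset.sum_add_distrib]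
  rw [Finset.sum_comm (f := fun i j => ee L κ α j i)]
  ring

lemma ee_same {L : ℝ} (hL : 0 ≤ L) {κ : ι → C} {α : ι → ℝ} (hp : proper L α κ) {b a : ι} (h : κ b = κ a) :
    ee L κ α b a = 0 := by
  unfold ee
  rw [if_neg]
  rintro ⟨h1, h2⟩
  have := hp b a (by rintro rfl; exact lt_irrefl _ h1) h
  rw [abs_of_pos (by linarith)] at this
  linarith

lemma Wpt_ee {L : ℝ} (hL : 0 ≤ L) {κ : ι → C} {α : ι → ℝ} (hp : proper L α κ) {c d : C} (hcd : c ≠ d) :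
    Wpt L α κ c d = ∑ b, ∑ a, ((if κ b = c ∧ κ a = d then ee L κ α b a else 0) +
      (if κ b = d ∧ κ a = c then ee L κ α b a else 0)) := by
  classical
  unfold Wpt ww
  have h1 : ∀ b ∈ SS κ c d, ∀ a ∈ SS κ c d, (if α a < α b ∧ α b - α a < L then
      1 - rk α (SS κ c d) (Finset.univ.filter (fun i => κ i = c)) b +
        rk α (SS κ c d) (Finset.univ.filter (fun i => κ i = c)) a else 0) = ee L κ α b a := by
    intro b hb a ha
    rw [rk_rkk hcd α hb, rk_rkk hcd α ha]
    rfl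
  rw [Finset.sum_congr rfl fun b hb => Finset.sum_congr rfl fun a ha => h1 b hb a ha]
  unfold SS
  rw [Finset.sum_filter]
  refine Finset.sum_congr rfl fun b _ => ?_
  rw [Finset.sum_filter]
  split_ifs with hb
  · refine Finset.sum_congr rfl fun a _ => ?_
    by_cases hs : κ b = κ a
    · rw [ee_same hL hp hs]; simp
    · rcases hb with hb | hb <;> by_cases h2 : κ a = c <;> by_cases h3 : κ a = d <;> simp_all
  · symm
    apply Finset.sum_eq_zero
    intro a _
    push Not at hb
    simp [hb.1, hb.2]

lemma NN_Wpt [Fintype C] {L : ℝ} (hL : 0 ≤ L) {κ : ι → C} {α : ι → ℝ} (hp : proper L α κ)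
    (hα : Function.Injective α) :
    NN L κ α = (1/2) * ∑ c, ∑ d, if c = d then 0 else Wpt L α κ c d := by
  classical
  rw [NN_ee hα]
  have h1 : ∀ c d : C, (if c = d then 0 else Wpt L α κ c d) = ∑ b, ∑ a,
      ((if κ b = c ∧ κ a = d then ee L κ α b a else 0) + (if κ b = d ∧ κ a = c then ee L κ α b a else 0)) := by
    intro c d
    split_ifs with h
    · subst h
      symm
      apply Finset.sum_eq_zero; intro b _
      apply Finset.sum_eq_zero; intro a _
      have : ∀ h : κ b = c ∧ κ a = c, ee L κ α b a = 0 := fun h => ee_same hL hp (h.1.trans h.2.symm)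
      split_ifs with h'
      · simp [this h']
      · simp
    · exact Wpt_ee hL hp h
  simp only [h1]
  have h2 : ∑ c : C, ∑ d : C, ∑ b, ∑ a, ((if κ b = c ∧ κ a = d then ee L κ α b a else 0) +
      (if κ b = d ∧ κ a = c then ee L κ α b a else 0)) =
      ∑ b, ∑ a, ∑ c : C, ∑ d : C, ((if κ b = c ∧ κ a = d then ee L κ α b a else 0) +
      (if κ b = d ∧ κ a = c then ee L κ α b a else 0)) := by
    rw [Finset.sum_congr rfl fun c _ => Finset.sum_comm, Finset.sum_comm]
    refine Finset.sum_congr rfl fun b _ => ?_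
    rw [Finset.sum_congr rfl fun c _ => Finset.sum_comm, Finset.sum_comm]
  rw [h2, Finset.mul_sum]
  refine Finset.sum_congr rfl fun b _ => ?_
  rw [Finset.mul_sum]
  refine Finset.sum_congr rfl fun a _ => ?_
  have h3 : ∑ c : C, ∑ d : C, (if κ b = c ∧ κ a = d then ee L κ α b a else 0) = ee L κ α b a := by
    simp only [ite_and, Finset.sum_ite_eq, Finset.mem_univ, if_true]
    simp
  have h4 : ∑ c : C, ∑ d : C, (if κ b = d ∧ κ a = c then ee L κ α b a else 0) = ee L κ α b a := by
    simp only [ite_and, Finset.sum_ite_eq, Finset.mem_univ, if_true]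
  simp only [Finset.sum_add_distrib, h3, h4]
  ring

end QT

namespace QT
open Equiv Equiv.Perm

variable {ι : Type*} [Fintype ι] [DecidableEq ι] {C : Type*} [DecidableEq C]

lemma Wpt_ee2 {L : ℝ} {κ : ι → C} {α : ι → ℝ} {c d : C} (hcd : c ≠ d) :
    Wpt L α κ c d = ∑ b, if κ b = c ∨ κ b = d then (∑ a, if κ a = c ∨ κ a = d then ee L κ α b a else 0) else 0 := by
  classical
  unfold Wpt ww
  have h1 : ∀ b ∈ SS κ c d, ∀ a ∈ SS κ c d, (if α a < α b ∧ α b - α a < L then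
      1 - rk α (SS κ c d) (Finset.univ.filter (fun i => κ i = c)) b +
        rk α (SS κ c d) (Finset.univ.filter (fun i => κ i = c)) a else 0) = ee L κ α b a := by
    intro b hb a ha
    rw [rk_rkk hcd α hb, rk_rkk hcd α ha]
    rfl
  rw [Finset.sum_congr rfl fun b hb => Finset.sum_congr rfl fun a ha => h1 b hb a ha]
  unfold SS
  rw [Finset.sum_filter]
  refine Finset.sum_congr rfl fun b _ => ?_
  rw [Finset.sum_filter]

lemma rkk_relabel (κ : ι → C) (α : ι → ℝ) (g : Perm ι) (k : ι) :
    rkk (κ ∘ g) (α ∘ g) k = rkk κ α (g k) := by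
  classical
  unfold rkk
  rw [← Finset.sum_boole, ← Finset.sum_boole]
  exact Equiv.sum_comp g (fun v => if κ v = κ (g k) ∧ α v < α (g k) then (1:ℝ) else 0)

lemma ee_relabel (L : ℝ) (κ : ι → C) (α : ι → ℝ) (g : Perm ι) (b a : ι) :
    ee L (κ ∘ g) (α ∘ g) b a = ee L κ α (g b) (g a) := by
  unfold ee
  rw [rkk_relabel, rkk_relabel]
  rfl

lemma Wpt_relabel {L : ℝ} {κ : ι → C} {α : ι → ℝ} {c d : C} (hcd : c ≠ d) (g : Perm ι) :
    Wpt L (α ∘ g) (κ ∘ g) c d = Wpt L α κ c d := by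
  rw [Wpt_ee2 hcd, Wpt_ee2 hcd, ← Equiv.sum_comp g (fun b => if κ b = c ∨ κ b = d then (∑ a, if κ a = c ∨ κ a = d then ee L κ α b a else 0) else 0)]
  refine Finset.sum_congr rfl fun b _ => ?_
  rw [← Equiv.sum_comp g (fun a => if κ a = c ∨ κ a = d then ee L κ α (g b) a else 0)]
  simp only [ee_relabel, Function.comp]

lemma ee_meas (L : ℝ) (κ : ι → C) (b a : ι) : Measurable (fun α : ι → ℝ => ee L κ α b a) := by
  classical
  unfold ee
  refine Measurable.ite ?_ ?_ measurable_const
  · have h1 : MeasurableSet {α : ι → ℝ | α a < α b} := measurableSet_lt (by fun_prop) (by fun_prop)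
    have h2 : MeasurableSet {α : ι → ℝ | α b - α a < L} := measurableSet_lt (by fun_prop) (by fun_prop)
    exact h1.inter h2
  · exact (measurable_const.sub (rkk_meas κ b)).add (rkk_meas κ a)

lemma ee_bd (L : ℝ) (κ : ι → C) (b a : ι) (α : ι → ℝ) : |ee L κ α b a| ≤ 1 + Fintype.card ι := by
  unfold ee
  have h1 := rkk_nonneg κ α a
  have h2 := rkk_nonneg κ α b
  have h3 := rkk_le κ α a
  have h4 := rkk_le κ α b
  split_ifs
  · rw [abs_le]; constructor <;> linarith
  · simp; positivity

lemma Wpt_meas (L : ℝ) (κ : ι → C) {c d : C} (hcd : c ≠ d) : Measurable (fun α : ι → ℝ => Wpt L α κ c d) := by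
  simp only [Wpt_ee2 hcd]
  refine Finset.measurable_sum _ fun b _ => ?_
  split_ifs
  · refine Finset.measurable_sum _ fun a _ => ?_
    split_ifs
    · exact ee_meas L κ b a
    · exact measurable_const
  · exact measurable_const

lemma Wpt_bd (L : ℝ) (κ : ι → C) {c d : C} (hcd : c ≠ d) (α : ι → ℝ) :
    |Wpt L α κ c d| ≤ ∑ b : ι, ∑ a : ι, (1 + (Fintype.card ι : ℝ)) := by
  rw [Wpt_ee2 hcd]
  refine (Finset.abs_sum_le_sum_abs _ _).trans (Finset.sum_le_sum fun b _ => ?_)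
  split_ifs
  · refine (Finset.abs_sum_le_sum_abs _ _).trans (Finset.sum_le_sum fun a _ => ?_)
    split_ifs
    · exact ee_bd L κ b a α
    · simp; positivity
  · simp; positivity

open Classical in
def Wint (s t L : ℝ) (κ : ι → C) (c d : C) : ℝ :=
  ∫ α in posO ι, PP s t L α * (if proper L α κ then Wpt L α κ c d else 0)

open Classical in
lemma Wint_int {s t : ℝ} (hs : 0 ≤ s) (ht : 0 < t) (L : ℝ) (κ : ι → C) {c d : C} (hcd : c ≠ d) :
    IntegrableOn (fun α => PP s t L α * (if proper L α κ then Wpt L α κ c d else 0)) (posO ι) := by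
  refine PP_mul_int hs ht (M := ∑ b : ι, ∑ a : ι, (1 + (Fintype.card ι : ℝ))) ?_ ?_
  · exact Measurable.ite (meas_proper L κ) (Wpt_meas L κ hcd) measurable_const
  · intro α
    split_ifs
    · exact Wpt_bd L κ hcd α
    · simp; positivity

open Classical in
lemma prop_int {s t : ℝ} (hs : 0 ≤ s) (ht : 0 < t) (L : ℝ) (κ : ι → C) :
    IntegrableOn (fun α => PP s t L α * (if proper L α κ then 1 else 0)) (posO ι) := by
  refine PP_mul_int hs ht (M := 1) ?_ ?_
  · exact Measurable.ite (meas_proper L κ) measurable_const measurable_const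
  · intro α
    split_ifs <;> simp

lemma proper_relabel (L : ℝ) (κ : ι → C) (α : ι → ℝ) (g : Perm ι) :
    proper L (α ∘ g) (κ ∘ g) ↔ proper L α κ := by
  unfold proper
  constructor
  · intro h i j hij hc
    have := h (g⁻¹ i) (g⁻¹ j) (by simpa using hij) (by simpa using hc)
    simpa using this
  · intro h i j hij hc
    exact h (g i) (g j) (by simpa using hij) hc

lemma Wint_relabel (s t L : ℝ) (κ : ι → C) {c d : C} (hcd : c ≠ d) (g : Perm ι) :
    Wint s t L (κ ∘ g) c d = Wint s t L κ c d := by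
  classical
  unfold Wint
  rw [← int_relabel g]
  congr 1
  funext α
  rw [PP_relabel, Wpt_relabel hcd]
  simp only [proper_relabel]

lemma SS_col {κ : ι → C} {c d : C} (hcd : c ≠ d) {X : Finset ι} (hX : X ⊆ SS κ c d) :
    SS (col κ c d X) c d = SS κ c d := by
  ext i
  rw [mem_SS (κ := col κ c d X), col_eq_c hcd hX, col_eq_d hcd hX, Finset.mem_sdiff]
  have := @hX i
  tauto

lemma Wpt_col (L : ℝ) (α : ι → ℝ) {κ : ι → C} {c d : C} (hcd : c ≠ d) {X : Finset ι} (hX : X ⊆ SS κ c d) :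
    Wpt L α (col κ c d X) c d = ww L α (SS κ c d) X := by
  unfold Wpt
  rw [SS_col hcd hX, filter_col_c hcd hX]

def outp (L : ℝ) (α : ι → ℝ) (κ : ι → C) (c d : C) : Prop :=
  ∀ i j, i ∉ SS κ c d → j ∉ SS κ c d → i ≠ j → κ i = κ j → L < |α i - α j|

lemma proper_col (L : ℝ) (α : ι → ℝ) {κ : ι → C} {c d : C} (hcd : c ≠ d) {X : Finset ι} (hX : X ⊆ SS κ c d) :
    proper L α (col κ c d X) ↔ outp L α κ c d ∧ pr L α (SS κ c d) X := by
  have hS : ∀ i ∈ SS κ c d, col κ c d X i = if i ∈ X then c else d := by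
    intro i hi; simp [col, hi]
  have hN : ∀ i, i ∉ SS κ c d → col κ c d X i = κ i := by
    intro i hi; simp [col, hi]
  constructor
  · intro h
    refine ⟨fun i j hi hj hij hc => h i j hij (by rw [hN i hi, hN j hj, hc]), fun i hi j hj hij hc => h i j hij ?_⟩
    rw [hS i hi, hS j hj]
    simp only [hc]
  · rintro ⟨h1, h2⟩ i j hij hc
    by_cases hi : i ∈ SS κ c d <;> by_cases hj : j ∈ SS κ c d
    · refine h2 i hi j hj hij ?_
      rw [hS i hi, hS j hj] at hc
      split_ifs at hc <;> simp_all
    · exfalso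
      have h3 : j ∈ SS (col κ c d X) c d := by
        rw [mem_SS, ← hc, ← mem_SS, SS_col hcd hX]; exact hi
      rw [SS_col hcd hX] at h3; exact hj h3
    · exfalso
      have h3 : i ∈ SS (col κ c d X) c d := by
        rw [mem_SS, hc, ← mem_SS, SS_col hcd hX]; exact hj
      rw [SS_col hcd hX] at h3; exact hi h3
    · exact h1 i j hi hj hij (by rw [← hN i hi, ← hN j hj, hc])

open Classical in
lemma comb_int {s t L : ℝ} (hs : 0 ≤ s) (ht : 0 < t) (hL : 0 ≤ L) (κ : ι → C) {c d : C} (hcd : c ≠ d) (x y : ℝ) :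
    (x * HT (GG s t L) κ - Wint s t L κ c d) * y =
      ∫ α in posO ι, PP s t L α * (if proper L α κ then (x - Wpt L α κ c d) * y else 0) := by
  rw [HT_GG' hs ht hL, Wint, ← integral_const_mul, ← integral_sub, ← integral_mul_const]
  · congr 1
    funext α
    split_ifs <;> ring
  · exact (prop_int hs ht L κ).const_mul _
  · exact Wint_int hs ht L κ hcd

open Classical in
lemma comb_integrable {s t L : ℝ} (hs : 0 ≤ s) (ht : 0 < t) (κ : ι → C) {c d : C} (hcd : c ≠ d) (x y : ℝ) :
    IntegrableOn (fun α => PP s t L α * (if proper L α κ then (x - Wpt L α κ c d) * y else 0)) (posO ι) := by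
  have := (((prop_int hs ht L κ).const_mul x).sub (Wint_int hs ht L κ hcd)).mul_const y
  refine this.congr (ae_of_all _ fun α => ?_)
  simp only [Pi.sub_apply]
  split_ifs <;> ring

lemma KK_GG {s t L : ℝ} (hs : 0 ≤ s) (ht : 0 < t) (hL : 0 ≤ L) (κ : ι → C) {c d : C} (hcd : c ≠ d) :
    KK (GG s t L) κ c d = Wint s t L κ c d := by
  classical
  refine K_eq_W hcd (GG_cl s t L) (fun κ => Wint s t L κ c d) (fun κ g => Wint_relabel s t L κ hcd g) ?_
  intro f
  simp only [comb_int hs ht hL _ hcd]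
  rw [← integral_finsetSum _ (fun X _ => comb_integrable hs ht _ hcd _ _),
    ← integral_finsetSum _ (fun X _ => comb_integrable hs ht _ hcd _ _)]
  refine integral_congr_ae (ae_restrict_of_ae ?_)
  filter_upwards [gen_ae L] with α hα
  have key := two_colour hα.inj hα.abs (SS κ c d) f
  simp only [← Finset.mul_sum]
  congr 1
  have e : ∀ X ∈ (SS κ c d).powerset, ∀ x y : ℝ, 
      (if proper L α (col κ c d X) then (x - Wpt L α (col κ c d X) c d) * y else 0) = 
      if outp L α κ c d then (if pr L α (SS κ c d) X then (x - ww L α (SS κ c d) X) * y else 0) else 0 := by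
    intro X hX x y
    rw [Finset.mem_powerset] at hX
    rw [Wpt_col L α hcd hX, ← ite_and]
    simp only [proper_col L α hcd hX]
  rw [Finset.sum_congr rfl fun X hX => e X hX _ _, Finset.sum_congr rfl fun X hX => e X hX _ _]
  by_cases ho : outp L α κ c d
  · simp only [ho, if_true]; exact key
  · simp [ho]

lemma hh_deriv2 [Fintype C] {s t L : ℝ} (hs : 0 ≤ s) (ht : 0 < t) (hL : 0 < L) (κ : ι → C) :
    HasDerivAt (hh s t κ) (-t * CC κ * HT (GG s t L) κ
      - s * ((1/2) * ∑ c, ∑ d, if c = d then 0 else KK (GG s t L) κ c d)) L := by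
  classical
  convert hh_deriv hs ht hL κ using 1
  rw [int_proper, HT_GG' hs ht hL.le]
  have e1 : ∀ c d : C, (if c = d then 0 else KK (GG s t L) κ c d) = 
      ∫ α in posO ι, PP s t L α * (if c = d then 0 else if proper L α κ then Wpt L α κ c d else 0) := by
    intro c d
    split_ifs with h
    · simp
    · rw [KK_GG hs ht hL.le κ h, Wint]
  have i1 : ∀ c d : C, IntegrableOn (fun α => PP s t L α * (if c = d then 0 else if proper L α κ then Wpt L α κ c d else 0)) (posO ι) := by
    intro c d
    split_ifs with h
    · simp
    · exact Wint_int hs ht L κ h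
  simp only [e1]
  rw [Finset.sum_congr rfl fun c _ => (integral_finsetSum _ (fun d _ => i1 c d)).symm]
  rw [← integral_finsetSum _ (fun c _ => integrable_finsetSum _ (fun d _ => i1 c d))]
  rw [← integral_const_mul, ← integral_const_mul, ← integral_const_mul, ← integral_sub]
  · refine integral_congr_ae (ae_restrict_of_ae ?_)
    filter_upwards [gen_ae L] with α hα
    simp only [← Finset.mul_sum]
    by_cases hp : proper L α κ
    · simp only [hp, if_true]
      unfold Phi
      rw [sum_rkk (hp.noties hL.le), NN_Wpt hL.le hp hα.inj]
      ring
    · simp [hp]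
  · exact (prop_int hs ht L κ).const_mul _
  · exact ((integrable_finsetSum _ (fun c _ => integrable_finsetSum _ (fun d _ => i1 c d))).const_mul _).const_mul _

end QT

namespace QT
open Equiv Equiv.Perm

variable {ι : Type*} [Fintype ι] [DecidableEq ι] {C : Type*} [DecidableEq C]

def RR (s t : ℝ) (G : Perm ι → ℝ) (π : Perm ι) : ℝ :=
  (1/2) * ∑ i, ∑ j, if i = j then 0 else rr s t G i j π

lemma RR_cl (s t : ℝ) {G : Perm ι → ℝ} (hG : IsCl G) : IsCl (RR s t G) := by
  classical
  intro g π
  unfold RR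
  congr 1
  rw [← Equiv.sum_comp g]
  refine Finset.sum_congr rfl fun i _ => ?_
  rw [← Equiv.sum_comp g]
  refine Finset.sum_congr rfl fun j _ => ?_
  simp only [EmbeddingLike.apply_eq_iff_eq]
  congr 1
  unfold rr
  have e1 : g * π * g⁻¹ * swap (g i) (g j) = g * (π * swap i j) * g⁻¹ := by
    rw [Equiv.swap_apply_apply]; group
  have e2 : SameCycle (g * π * g⁻¹) (g i) (g j) ↔ SameCycle π i j := by
    rw [sameCycle_conj]; simp
  rw [e1, hG, hG]
  simp only [e2]

lemma HT_RR [Fintype C] (s t : ℝ) (G : Perm ι → ℝ) (κ : ι → C) :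
    HT (RR s t G) κ = -t * CC κ * HT G κ - s * ((1/2) * ∑ c, ∑ d, if c = d then 0 else KK G κ c d) := by
  classical
  have h1 : HT (RR s t G) κ = (1/2) * ∑ i, ∑ j, if i = j then 0 else ∑ π ∈ yng κ, sg π * rr s t G i j π := by
    unfold HT RR
    have : ∀ π : Perm ι, sg π * (1 / 2 * ∑ i, ∑ j, if i = j then 0 else rr s t G i j π) =
        (1/2) * ∑ i, ∑ j, if i = j then 0 else sg π * rr s t G i j π := by
      intro π
      rw [mul_left_comm, Finset.mul_sum]
      congr 1
      refine Finset.sum_congr rfl fun i _ => ?_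
      rw [Finset.mul_sum]
      refine Finset.sum_congr rfl fun j _ => ?_
      split_ifs <;> simp
    simp only [this]
    rw [← Finset.mul_sum, Finset.sum_comm]
    congr 1
    refine Finset.sum_congr rfl fun i _ => ?_
    rw [Finset.sum_comm]
    refine Finset.sum_congr rfl fun j _ => ?_
    split_ifs <;> simp
  have h2 : ∀ i j, (if i = j then 0 else ∑ π ∈ yng κ, sg π * rr s t G i j π) =
      (-t * HT G κ) * (if i = j then 0 else if κ i = κ j then 1 else 0) - s * (if κ i = κ j then 0 else QQ G κ i j) := by
    intro i j
    by_cases hij : i = j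
    · subst hij; simp
    by_cases hc : κ i = κ j
    · simp only [hij, hc, if_false, if_true]
      rw [rr_same s t G hij hc]; ring
    · simp only [hij, hc, if_false, if_true]
      rw [rr_diff s t G hc]; ring
  have h3 : ∑ c, ∑ d, (if c = d then 0 else KK G κ c d) = ∑ i, ∑ j, if κ i = κ j then 0 else QQ G κ i j := by
    have e1 : ∀ c d, (if c = d then 0 else KK G κ c d) = ∑ i, ∑ j, if κ i = c then (if κ j = d then (if κ i = κ j then 0 else QQ G κ i j) else 0) else 0 := by
      intro c d
      unfold KK
      rw [Finset.sum_filter]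
      simp only [Finset.sum_filter]
      split_ifs with h
      · subst h
        symm
        apply Finset.sum_eq_zero; intro i _
        apply Finset.sum_eq_zero; intro j _
        split_ifs <;> simp_all
      · refine Finset.sum_congr rfl fun i _ => ?_
        split_ifs with hi
        · refine Finset.sum_congr rfl fun j _ => ?_
          split_ifs <;> simp_all
        · simp
    simp only [e1]
    rw [Finset.sum_congr rfl fun c _ => Finset.sum_comm, Finset.sum_comm]
    refine Finset.sum_congr rfl fun i _ => ?_
    rw [Finset.sum_congr rfl fun c _ => Finset.sum_comm, Finset.sum_comm]
    refine Finset.sum_congr rfl fun j _ => ?_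
    simp
  rw [h1, h3]
  simp only [h2, Finset.sum_sub_distrib, ← Finset.mul_sum]
  unfold CC
  ring

def clS (ι : Type*) [Fintype ι] [DecidableEq ι] : Submodule ℝ (Perm ι → ℝ) where
  carrier := {G | IsCl G}
  add_mem' := by intro a b ha hb g π; simp [ha g π, hb g π]
  zero_mem' := by intro g π; rfl
  smul_mem' := by intro c a ha g π; simp [ha g π]

def HTl (ι : Type*) [Fintype ι] [DecidableEq ι] : (Perm ι → ℝ) →ₗ[ℝ] ((ι → ι) → ℝ) where
  toFun G := fun κ => HT G κ
  map_add' := by intro a b; funext κ; simp [HT, mul_add, Finset.sum_add_distrib]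
  map_smul' := by
    intro c a; funext κ; simp only [HT, Pi.smul_apply, smul_eq_mul, Finset.mul_sum, RingHom.id_apply]
    exact Finset.sum_congr rfl fun π _ => by ring

lemma exists_inv (ι : Type*) [Fintype ι] [DecidableEq ι] :
    ∃ M : ((ι → ι) → ℝ) →L[ℝ] (Perm ι → ℝ), ∀ G : Perm ι → ℝ, IsCl G → M (fun κ => HT G κ) = G := by
  have hinj : LinearMap.ker ((HTl ι).comp (clS ι).subtype) = ⊥ := by
    rw [LinearMap.ker_eq_bot']
    intro m hm
    ext σ
    exact HT_inj m.2 (fun κ => congrFun hm κ) σ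
  obtain ⟨g, hg⟩ := LinearMap.exists_leftInverse_of_injective _ hinj
  refine ⟨LinearMap.toContinuousLinearMap ((clS ι).subtype.comp g), fun G hG => ?_⟩
  have := LinearMap.congr_fun hg ⟨G, hG⟩
  exact congrArg Subtype.val this

lemma GG_contOn {s t : ℝ} (hs : 0 ≤ s) (ht : 0 < t) : ContinuousOn (fun L => GG (ι := ι) s t L) (Set.Ici 0) := by
  obtain ⟨M, hM⟩ := exists_inv ι
  have h1 : ContinuousOn (fun L => M (fun κ => hh s t κ L)) (Set.Ici 0) :=
    M.continuous.comp_continuousOn (continuousOn_pi.2 fun κ => hh_contOn hs ht κ)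
  refine h1.congr fun L hL => ?_
  rw [← hM _ (GG_cl s t L)]
  congr 1
  funext κ
  exact HT_GG hs ht hL κ

lemma GG_deriv {s t L : ℝ} (hs : 0 ≤ s) (ht : 0 < t) (hL : 0 < L) :
    HasDerivAt (fun L => GG (ι := ι) s t L) (RR s t (GG s t L)) L := by
  obtain ⟨M, hM⟩ := exists_inv ι
  have h0 : HasDerivAt (fun L => (fun κ : ι → ι => hh s t κ L)) (fun κ => HT (RR s t (GG s t L)) κ) L := by
    rw [hasDerivAt_pi]
    intro κ
    rw [HT_RR]
    exact hh_deriv2 hs ht hL κ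
  have h1 := M.hasFDerivAt.comp_hasDerivAt L h0
  rw [hM _ (RR_cl s t (GG_cl s t L))] at h1
  refine h1.congr_of_eventuallyEq ?_
  filter_upwards [Ioi_mem_nhds hL] with x hx
  rw [← hM _ (GG_cl s t x)]
  simp only [Function.comp]
  congr 1
  funext κ
  exact HT_GG hs ht (le_of_lt hx) κ

lemma GG_zero {s t : ℝ} (hs : 0 ≤ s) (ht : 0 < t) (π : Perm ι) :
    GG s t 0 π = if π = 1 then (t⁻¹) ^ (Fintype.card ι) else 0 := by
  have hcl : IsCl (fun π : Perm ι => if π = 1 then (t⁻¹) ^ (Fintype.card ι) else (0:ℝ)) := by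
    intro g π
    have : g * π * g⁻¹ = 1 ↔ π = 1 := by simp [mul_inv_eq_one]
    simp only [this]
  have h : IsCl (GG (ι := ι) s t 0 - (fun π : Perm ι => if π = 1 then (t⁻¹) ^ (Fintype.card ι) else (0:ℝ))) :=
    (clS ι).sub_mem (GG_cl s t 0) hcl
  have := HT_inj h (fun κ => ?_) π
  · simp only [Pi.sub_apply] at this; linarith
  · have e := HT_GG hs ht le_rfl κ
    rw [hh_zero ht] at e
    have : HT (GG s t 0 - (fun π : Perm ι => if π = 1 then (t⁻¹) ^ (Fintype.card ι) else (0:ℝ))) κ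
      = HT (GG s t 0) κ - HT (fun π : Perm ι => if π = 1 then (t⁻¹) ^ (Fintype.card ι) else (0:ℝ)) κ := by
      simp [HT, mul_sub, Finset.sum_sub_distrib]
    rw [this, e]
    have h1 : (1 : Perm ι) ∈ yng κ := by rw [mem_yng]; simp
    simp [HT, h1, sg_one]

def AA (s t : ℝ) : (Perm ι → ℝ) →ₗ[ℝ] (Perm ι → ℝ) where
  toFun F := fun π => (1/2) * ∑ i, ∑ j, if i = j then 0 else
    if SameCycle π i j then F (π * swap i j) - (s + t) * F π else - (s * t) * F (π * swap i j)
  map_add' := by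
    intro a b; funext π
    simp only [Pi.add_apply]
    rw [← mul_add, ← Finset.sum_add_distrib]
    congr 1
    refine Finset.sum_congr rfl fun i _ => ?_
    rw [← Finset.sum_add_distrib]
    refine Finset.sum_congr rfl fun j _ => ?_
    split_ifs <;> ring
  map_smul' := by
    intro c a; funext π
    simp only [Pi.smul_apply, smul_eq_mul, RingHom.id_apply]
    simp only [Finset.mul_sum]
    refine Finset.sum_congr rfl fun i _ => ?_
    refine Finset.sum_congr rfl fun j _ => ?_
    split_ifs <;> ring

lemma AA_symm (s t : ℝ) : AA (ι := ι) s t = AA t s := by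
  ext F π
  simp only [AA, add_comm s t, mul_comm s t]

def FF (s t L : ℝ) (π : Perm ι) : ℝ := t ^ (ell π) * GG s t L π

lemma FF_contOn {s t : ℝ} (hs : 0 ≤ s) (ht : 0 < t) : ContinuousOn (fun L => FF (ι := ι) s t L) (Set.Ici 0) := by
  refine continuousOn_pi.2 fun π => ?_
  exact continuousOn_const.mul (continuousOn_pi.1 (GG_contOn hs ht) π)

lemma FF_deriv {s t L : ℝ} (hs : 0 ≤ s) (ht : 0 < t) (hL : 0 < L) :
    HasDerivAt (fun L => FF (ι := ι) s t L) (AA s t (FF s t L)) L := by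
  rw [hasDerivAt_pi]
  intro π
  have h := ((hasDerivAt_pi.1 (GG_deriv (ι := ι) hs ht hL)) π).const_mul (t ^ (ell π))
  refine h.congr_deriv ?_
  symm
  unfold RR AA
  simp only [LinearMap.coe_mk, AddHom.coe_mk]
  simp only [Finset.mul_sum]
  refine Finset.sum_congr rfl fun i _ => ?_
  refine Finset.sum_congr rfl fun j _ => ?_
  by_cases hij : i = j
  · simp [hij]
  simp only [hij, if_false]
  unfold FF rr
  by_cases hc : SameCycle π i j
  · simp only [hc, if_true]
    rw [ell_same hij hc, pow_succ]; ring
  · simp only [hc, if_false]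
    rw [ell_diff hij hc, pow_succ]; ring

lemma FF_zero {s t : ℝ} (hs : 0 ≤ s) (ht : 0 < t) (π : Perm ι) : FF s t 0 π = if π = 1 then 1 else 0 := by
  unfold FF
  rw [GG_zero hs ht]
  split_ifs with h
  · subst h
    rw [ell_one, ← mul_pow, mul_inv_cancel₀ ht.ne', one_pow]
  · simp

lemma ode_right {V : Type*} [NormedAddCommGroup V] [NormedSpace ℝ V] (A : V →L[ℝ] V) {f : ℝ → V}
    (hc : ContinuousOn f (Set.Ici 0)) (hd : ∀ x, 0 < x → HasDerivAt f (A (f x)) x) :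
    ∀ x, 0 ≤ x → HasDerivWithinAt f (A (f x)) (Set.Ici x) x := by
  intro x hx
  rcases hx.lt_or_eq with h | h
  · exact (hd x h).hasDerivWithinAt
  · subst h
    refine hasDerivWithinAt_Ici_of_tendsto_deriv (s := Set.Ioi 0) ?_ ?_ self_mem_nhdsWithin ?_
    · intro y hy; exact (hd y hy).differentiableAt.differentiableWithinAt
    · exact (hc 0 Set.self_mem_Ici).mono Set.Ioi_subset_Ici_self
    · have h1 : Tendsto (fun y => A (f y)) (nhdsWithin 0 (Set.Ioi 0)) (nhds (A (f 0))) :=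
        (A.continuous.tendsto _).comp ((hc 0 Set.self_mem_Ici).mono Set.Ioi_subset_Ici_self)
      refine h1.congr' ?_
      filter_upwards [self_mem_nhdsWithin] with y hy
      exact (hd y hy).deriv.symm

lemma ode_unique {V : Type*} [NormedAddCommGroup V] [NormedSpace ℝ V] (A : V →L[ℝ] V) {f g : ℝ → V}
    (hc : ContinuousOn f (Set.Ici 0)) (hd : ∀ x, 0 < x → HasDerivAt f (A (f x)) x)
    (hc' : ContinuousOn g (Set.Ici 0)) (hd' : ∀ x, 0 < x → HasDerivAt g (A (g x)) x)
    (h0 : f 0 = g 0) : f 1 = g 1 := by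
  have := ODE_solution_unique_of_mem_Icc_right (v := fun _ => A) (s := fun _ => Set.univ) (K := ‖A‖₊)
    (f := f) (g := g) (a := 0) (b := 1) (fun t _ => A.lipschitz.lipschitzOnWith)
    (hc.mono Set.Icc_subset_Ici_self) (fun t ht => ode_right A hc hd t ht.1) (fun _ _ => trivial)
    (hc'.mono Set.Icc_subset_Ici_self) (fun t ht => ode_right A hc' hd' t ht.1) (fun _ _ => trivial) h0
  exact this ⟨zero_le_one, le_rfl⟩

theorem FF_symm {s t : ℝ} (hs : 0 < s) (ht : 0 < t) : FF (ι := ι) s t 1 = FF t s 1 := by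
  refine ode_unique (LinearMap.toContinuousLinearMap (AA (ι := ι) s t)) (f := fun L => FF (ι := ι) s t L)
    (g := fun L => FF (ι := ι) t s L) (FF_contOn hs.le ht) (fun x hx => FF_deriv hs.le ht hx)
    (FF_contOn ht.le hs) (fun x hx => ?_) ?_
  · rw [AA_symm]; exact FF_deriv ht.le hs hx
  · funext π
    simp only [FF_zero hs.le ht, FF_zero ht.le hs]

end QT

namespace QT
open Equiv Equiv.Perm

def con {m : ℕ} (x : ℝ) (b : Fin m → ℝ) : Fin (m+1) → ℝ := Fin.cons x b

lemma cext_con {m : ℕ} (a : Fin m → ℝ) (i : Fin (m+1)) : cext a i.val = con 0 a i := by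
  unfold con
  refine Fin.cases ?_ (fun j => ?_) i
  · simp [cext]
  · have : 1 ≤ (j.succ).val ∧ (j.succ).val ≤ m := by
      have := j.2
      simp
    rw [cext, dif_pos this]
    simp

lemma area_con {m : ℕ} (a : Fin m → ℝ) : area (m+1) a = ∑ i, con 0 a i := by
  unfold area
  rw [Finset.sum_range]
  exact Finset.sum_congr rfl fun i _ => cext_con a i

lemma dinv_con {m : ℕ} (a : Fin m → ℝ) : dinv (m+1) a = DD 1 (con 0 a) := by
  unfold dinv
  rw [Finset.sum_range]
  have h1 : ∀ j : Fin (m+1), ∑ i ∈ Finset.range j.val, sc (cext a i - cext a j.val) =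
      ∑ i : Fin (m+1), if i < j then max (1 - |con 0 a i - con 0 a j|) 0 else 0 := by
    intro j
    have e : ∑ i : Fin (m+1), (if i < j then max (1 - |con 0 a i - con 0 a j|) 0 else 0) =
      ∑ i : Fin (m+1), (fun i : ℕ => if i < j.val then sc (cext a i - cext a j.val) else 0) i.val := by
      refine Finset.sum_congr rfl fun i _ => ?_
      simp only [cext_con, Fin.lt_def]
      rfl
    rw [e, ← Finset.sum_range (fun i : ℕ => if i < j.val then sc (cext a i - cext a j.val) else 0), ← Finset.sum_filter]
    congr 1
    ext i
    simp
    have := j.2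
    omega
  have h1' : ∑ j : Fin (m+1), ∑ i ∈ Finset.range j.val, sc (cext a i - cext a j.val) =
      ∑ j : Fin (m+1), ∑ i : Fin (m+1), if i < j then max (1 - |con 0 a i - con 0 a j|) 0 else 0 :=
    Finset.sum_congr rfl fun j _ => h1 j
  refine h1'.trans ?_
  unfold DD
  have h2 : ∀ i j : Fin (m+1), (if i = j then 0 else max (1 - |con 0 a i - con 0 a j|) 0) =
    (if i < j then max (1 - |con 0 a i - con 0 a j|) 0 else 0) + (if j < i then max (1 - |con 0 a j - con 0 a i|) 0 else 0) := by
    intro i j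
    rcases lt_trichotomy i j with h | h | h
    · simp [h, h.ne, h.not_gt]
    · simp [h]
    · rw [abs_sub_comm]; simp [h, h.ne', h.not_gt]
  simp only [h2, Finset.sum_add_distrib]
  rw [Finset.sum_comm (f := fun i j : Fin (m+1) => if i < j then max (1 - |con 0 a i - con 0 a j|) 0 else 0)]
  ring

lemma areaPoly_con {m : ℕ} (a : Fin m → ℝ) : a ∈ areaPoly (m+1) ↔ 
    (∀ i, 0 ≤ con 0 a i) ∧ ∀ i, con 0 a (finRotate (m+1) i) ≤ con 0 a i + 1 := by
  have key : a ∈ areaPoly (m+1) ↔ ∀ i : Fin m, 0 ≤ con 0 a i.succ ∧ con 0 a i.succ ≤ con 0 a i.castSucc + 1 := by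
    constructor
    · intro h i
      have := h i.val i.2
      have e1 := cext_con a i.succ
      have e2 := cext_con a i.castSucc
      simp only [Fin.val_succ, Fin.val_castSucc] at e1 e2
      rw [← e1, ← e2]; exact this
    · intro h i hi
      have := h ⟨i, hi⟩
      have e1 := cext_con a (Fin.succ ⟨i, hi⟩)
      have e2 := cext_con a (Fin.castSucc ⟨i, hi⟩)
      rw [← e1, ← e2] at this
      exact this
  rw [key]
  constructor
  · intro h
    have h0 : ∀ i, 0 ≤ con 0 a i := by
      intro i
      refine Fin.cases ?_ (fun j => (h j).1) i
      simp [con]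
    refine ⟨h0, fun i => ?_⟩
    refine Fin.lastCases ?_ (fun j => ?_) i
    · rw [finRotate_last]
      have := h0 (Fin.last m)
      have h' : con 0 a 0 = 0 := by simp [con]
      rw [h']; linarith
    · have : finRotate (m+1) j.castSucc = j.succ := by
        rw [finRotate_apply]; simp
      rw [this]; exact (h j).2
  · rintro ⟨h1, h2⟩ i
    refine ⟨h1 _, ?_⟩
    have := h2 i.castSucc
    have e : finRotate (m+1) i.castSucc = i.succ := by
      rw [finRotate_apply]; simp
    rwa [e] at this

def JJ (s t : ℝ) (n : ℕ) : ℝ := ∫ a in areaPoly n, Real.exp (-(t * area n a) - s * dinv n a)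

open Classical in
def mn {m : ℕ} (k : Fin (m+1)) (α : Fin (m+1) → ℝ) : ℝ := if ∀ i, α k ≤ α i then 1 else 0

lemma mn_meas {m : ℕ} (k : Fin (m+1)) : Measurable (mn k) := by
  classical
  unfold mn
  refine Measurable.ite ?_ measurable_const measurable_const
  have : {α : Fin (m+1) → ℝ | ∀ i, α k ≤ α i} = ⋂ i, {α : Fin (m+1) → ℝ | α k ≤ α i} := by ext; simp
  rw [this]
  exact MeasurableSet.iInter fun i => measurableSet_le (by fun_prop) (by fun_prop)

lemma mn_sum {m : ℕ} {α : Fin (m+1) → ℝ} (h : Function.Injective α) : ∑ k, mn k α = 1 := by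
  classical
  obtain ⟨k, hk⟩ := Finite.exists_min α
  rw [Finset.sum_eq_single k]
  · simp [mn, hk]
  · intro j _ hj
    unfold mn
    rw [if_neg]
    intro h'
    exact hj (h (le_antisymm (h' k) (hk j)))
  · simp

lemma mn_int {m : ℕ} {s t : ℝ} (hs : 0 ≤ s) (ht : 0 < t) (π : Perm (Fin (m+1))) (k : Fin (m+1)) :
    IntegrableOn (fun α => PP s t 1 α * (II 1 α π * mn k α)) (posO (Fin (m+1))) := by
  refine PP_mul_int hs ht (M := 1) ((meas_II 1 π).mul (mn_meas k)) ?_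
  intro α
  rw [abs_mul]
  have h1 := II_bd 1 α π
  have h2 : |mn k α| ≤ 1 := by unfold mn; split_ifs <;> simp
  exact mul_le_one₀ h1 (abs_nonneg _) h2

lemma rot_piece {m : ℕ} (s t : ℝ) (g : Perm (Fin (m+1))) (π : Perm (Fin (m+1))) (hg : g * π = π * g) (k : Fin (m+1)) :
    ∫ α in posO (Fin (m+1)), PP s t 1 α * (II 1 α π * mn k α) = 
    ∫ α in posO (Fin (m+1)), PP s t 1 α * (II 1 α π * mn (g k) α) := by
  rw [← int_relabel g]
  congr 1
  funext α
  rw [PP_relabel]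
  congr 1
  have hg' : ∀ i, g (π i) = π (g i) := fun i => by
    have := congrArg (fun f : Perm _ => f i) hg; exact this
  congr 1
  · unfold II
    congr 1
    rw [eq_iff_iff]
    constructor
    · intro h i
      have := h (g⁻¹ i)
      simpa [hg'] using this
    · intro h i
      have := h (g i)
      simpa [hg'] using this
  · unfold mn
    congr 1
    rw [eq_iff_iff]
    constructor
    · intro h i
      have := h (g⁻¹ i)
      simpa using this
    · intro h i
      exact h (g i)

lemma rot_pow {m : ℕ} (k : Fin (m+1)) : ((finRotate (m+1)) ^ k.val) 0 = k := by
  have : ∀ j : ℕ, (hj : j < m+1) → ((finRotate (m+1)) ^ j) 0 = ⟨j, hj⟩ := by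
    intro j
    induction j with
    | zero => intro _; rfl
    | succ j ih =>
      intro hj
      rw [pow_succ', Perm.mul_apply, ih (by omega), finRotate_apply]
      ext
      rw [Fin.val_add_one_of_lt]
      simp [Fin.lt_def]; omega
  exact this k.val k.2

lemma GG_split {m : ℕ} {s t : ℝ} (hs : 0 ≤ s) (ht : 0 < t) :
    GG s t 1 (finRotate (m+1)) = (m+1) * ∫ α in posO (Fin (m+1)), PP s t 1 α * (II 1 α (finRotate (m+1)) * mn 0 α) := by
  have h1 : GG s t 1 (finRotate (m+1)) = ∫ α in posO (Fin (m+1)), ∑ k, PP s t 1 α * (II 1 α (finRotate (m+1)) * mn k α) := by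
    unfold GG
    refine integral_congr_ae (ae_restrict_of_ae ?_)
    filter_upwards [gen_ae 1] with α hα
    rw [← Finset.mul_sum, ← Finset.mul_sum, mn_sum hα.inj, mul_one]
  rw [h1, integral_finsetSum _ (fun k _ => mn_int hs ht _ k)]
  have h2 : ∀ k : Fin (m+1), ∫ α in posO (Fin (m+1)), PP s t 1 α * (II 1 α (finRotate (m+1)) * mn k α) =
      ∫ α in posO (Fin (m+1)), PP s t 1 α * (II 1 α (finRotate (m+1)) * mn 0 α) := by
    intro k
    have := rot_piece s t ((finRotate (m+1)) ^ k.val) (finRotate (m+1)) (by rw [← pow_succ, ← pow_succ']) 0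
    rw [rot_pow] at this
    exact this.symm
  rw [Finset.sum_congr rfl (fun k _ => h2 k), Finset.sum_const]
  simp

lemma fub {m : ℕ} {H : (Fin (m+1) → ℝ) → ℝ} (hH : Integrable H) :
    ∫ α, H α = ∫ x : ℝ, ∫ b : Fin m → ℝ, H (con x b) := by
  have hmp := (volume_preserving_piFinSuccAbove (fun _ : Fin (m+1) => ℝ) 0).symm
  rw [← hmp.integral_comp' H]
  have hI : Integrable (fun p => H ((MeasurableEquiv.piFinSuccAbove (fun _ : Fin (m+1) => ℝ) 0).symm p)) 
      (volume : Measure (ℝ × (Fin m → ℝ))) := (hmp.integrable_comp_emb (MeasurableEquiv.measurableEmbedding _)).2 hH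
  have := integral_prod _ hI
  refine this.trans ?_
  have e : ∀ x : ℝ, ∀ b : Fin m → ℝ, (MeasurableEquiv.piFinSuccAbove (fun _ : Fin (m+1) => ℝ) 0).symm (x, b) = con x b := by
    intro x b
    unfold con
    simp [MeasurableEquiv.piFinSuccAbove]
    rfl
  simp only [e]

lemma con_add {m : ℕ} (x : ℝ) (a : Fin m → ℝ) : con x (a + fun _ => x) = fun i => con 0 a i + x := by
  funext i
  unfold con
  refine Fin.cases ?_ (fun j => ?_) i <;> simp

lemma DD_add {m : ℕ} (x : ℝ) (α : Fin (m+1) → ℝ) : DD 1 (fun i => α i + x) = DD 1 α := by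
  unfold DD
  simp

lemma PP_add {m : ℕ} (s t x : ℝ) (α : Fin (m+1) → ℝ) : 
    PP s t 1 (fun i => α i + x) = Real.exp (-(t * (m+1)) * x) * PP s t 1 α := by
  unfold PP
  rw [DD_add, ← Real.exp_add]
  congr 1
  simp [Finset.sum_add_distrib]
  ring

open Classical in
lemma piece0 {m : ℕ} {s t : ℝ} (hs : 0 ≤ s) (ht : 0 < t) :
    ∫ α in posO (Fin (m+1)), PP s t 1 α * (II 1 α (finRotate (m+1)) * mn 0 α) = (t * (m+1))⁻¹ * JJ s t (m+1) := by
  rw [← integral_indicator meas_posO]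
  rw [fub ((integrable_indicator_iff meas_posO).2 (mn_int hs ht _ 0))]
  have h1 : ∀ x : ℝ, ∫ b : Fin m → ℝ, (posO (Fin (m+1))).indicator (fun α => PP s t 1 α * (II 1 α (finRotate (m+1)) * mn 0 α)) (con x b)
      = ∫ a : Fin m → ℝ, (Set.Ici (0:ℝ)).indicator (fun x => Real.exp (-(t * (m+1)) * x)) x * 
        (areaPoly (m+1)).indicator (fun a => Real.exp (-(t * area (m+1) a) - s * dinv (m+1) a)) a := by
    intro x
    rw [← integral_add_right_eq_self _ (fun _ : Fin m => x)]
    congr 1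
    funext a
    have hz : con 0 a 0 = 0 := by simp [con]
    rw [con_add]
    by_cases hx : x ∈ Set.Ici (0:ℝ)
    · rw [Set.indicator_of_mem hx]
      have hx' : (0:ℝ) ≤ x := hx
      by_cases ha : a ∈ areaPoly (m+1)
      · rw [Set.indicator_of_mem ha]
        have ha' := (areaPoly_con a).1 ha
        rw [Set.indicator_of_mem]
        · rw [PP_add]
          have e1 : II 1 (fun i => con 0 a i + x) (finRotate (m+1)) = 1 := by
            unfold II; rw [if_pos]; intro i; have := ha'.2 i; linarith
          have e2 : mn 0 (fun i => con 0 a i + x) = 1 := by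
            unfold mn; rw [if_pos]; intro i; have := ha'.1 i; simp only [hz]; linarith
          rw [e1, e2, PP, ← dinv_con, ← area_con]
          ring
        · intro i; have := ha'.1 i; simp only; linarith
      · rw [Set.indicator_of_notMem ha, mul_zero]
        have : II 1 (fun i => con 0 a i + x) (finRotate (m+1)) * mn 0 (fun i => con 0 a i + x) = 0 := by
          by_contra hne
          apply ha
          rw [areaPoly_con]
          have hne' := mul_ne_zero_iff.1 hne
          constructor
          · intro i
            by_contra hlt
            apply hne'.2
            unfold mn; rw [if_neg]
            intro h; have := h i; simp only [hz] at this; linarith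
          · intro i
            by_contra hlt
            apply hne'.1
            unfold II; rw [if_neg]
            intro h; have := h i; linarith
        simp only [Set.indicator_apply, this]; simp
    · rw [Set.indicator_of_notMem hx, zero_mul, Set.indicator_of_notMem]
      intro h
      apply hx
      have := h 0
      simpa [hz] using this
  simp only [h1, integral_const_mul, integral_mul_const]
  rw [integral_indicator measurableSet_Ici, integral_Ici_eq_integral_Ioi]
  have hpos : 0 < t * (m+1 : ℝ) := by positivity
  rw [integral_exp_mul_Ioi (by linarith)]
  have hm : MeasurableSet (areaPoly (m+1)) := by
    have : areaPoly (m+1) = ⋂ i : Fin (m+1), ({a : Fin m → ℝ | 0 ≤ con 0 a i} ∩ {a : Fin m → ℝ | con 0 a (finRotate (m+1) i) ≤ con 0 a i + 1}) := by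
      ext a
      rw [areaPoly_con]
      simp [forall_and]
    rw [this]
    have hc : ∀ i : Fin (m+1), Measurable (fun a : Fin m → ℝ => con 0 a i) := by
      intro i
      unfold con
      refine Fin.cases ?_ (fun j => ?_) i
      · simp
      · simp; exact measurable_pi_apply j
    exact MeasurableSet.iInter fun i => (measurableSet_le measurable_const (hc i)).inter
      (measurableSet_le (hc _) ((hc i).add_const 1))
  have hJ : ∫ a : Fin m → ℝ, (areaPoly (m+1)).indicator (fun a => Real.exp (-(t * area (m+1) a) - s * dinv (m+1) a)) a
      = JJ s t (m+1) := integral_indicator hm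
  rw [hJ]
  congr 1
  simp

lemma GG_JJ {m : ℕ} {s t : ℝ} (hs : 0 ≤ s) (ht : 0 < t) :
    t * GG s t 1 (finRotate (m+1)) = JJ s t (m+1) := by
  rw [GG_split hs ht, piece0 hs ht]
  have : (m+1 : ℝ) ≠ 0 := by positivity
  field_simp

lemma ell_rot (m : ℕ) : ell (finRotate (m+1)) = 1 := by
  apply ell_cycle
  have h : ∀ k : Fin (m+1), SameCycle (finRotate (m+1)) 0 k := fun k => sameCycle_nat.2 ⟨_, rot_pow k⟩
  intro a b
  exact (h a).symm.trans (h b)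

theorem JJ_symm {m : ℕ} {s t : ℝ} (hs : 0 < s) (ht : 0 < t) : JJ s t (m+1) = JJ t s (m+1) := by
  have := congrFun (FF_symm (ι := Fin (m+1)) hs ht) (finRotate (m+1))
  unfold FF at this
  rw [ell_rot, pow_one, pow_one] at this
  rw [← GG_JJ hs.le ht, ← GG_JJ ht.le hs]
  exact this

end QT

namespace QT
open Equiv Equiv.Perm
open scoped NNReal BoundedContinuousFunction

lemma con_meas {m : ℕ} : Measurable (fun a : Fin m → ℝ => con 0 a) := by
  refine measurable_pi_iff.2 fun i => ?_
  unfold con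
  refine Fin.cases ?_ (fun j => ?_) i
  · simp
  · simp; exact measurable_pi_apply j

lemma area_meas (m : ℕ) : Measurable (fun a : Fin m → ℝ => area (m+1) a) := by
  simp only [area_con]
  exact Finset.measurable_sum _ fun i _ => (measurable_pi_apply i).comp con_meas

lemma dinv_meas (m : ℕ) : Measurable (fun a : Fin m → ℝ => dinv (m+1) a) := by
  simp only [dinv_con]
  exact (DD_cont 1).measurable.comp con_meas

lemma areaPoly_meas (m : ℕ) : MeasurableSet (areaPoly (m+1)) := by
  have : areaPoly (m+1) = ⋂ i : Fin (m+1), ({a : Fin m → ℝ | 0 ≤ con 0 a i} ∩ {a : Fin m → ℝ | con 0 a (finRotate (m+1) i) ≤ con 0 a i + 1}) := by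
    ext a
    rw [areaPoly_con]
    simp [forall_and]
  rw [this]
  have hc : ∀ i : Fin (m+1), Measurable (fun a : Fin m → ℝ => con 0 a i) := fun i =>
    (measurable_pi_apply i).comp con_meas
  exact MeasurableSet.iInter fun i => (measurableSet_le measurable_const (hc i)).inter
    (measurableSet_le (hc _) ((hc i).add_const 1))

def lam (m : ℕ) : Measure (Fin m → ℝ) := volume.restrict (areaPoly (m+1))

lemma cext_le {m : ℕ} {a : Fin m → ℝ} (ha : a ∈ areaPoly (m+1)) : ∀ i ≤ m, cext a i ≤ i := by
  intro i
  induction i with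
  | zero => intro _; simp [cext]
  | succ i ih =>
    intro hi
    have := (ha i (by simpa using hi)).2
    have := ih (by omega)
    push_cast
    exact ‹cext a (i+1) ≤ cext a i + 1›.trans (by linarith)

instance lam_fin (m : ℕ) : IsFiniteMeasure (lam m) := by
  constructor
  unfold lam
  rw [Measure.restrict_apply_univ]
  have hsub : areaPoly (m+1) ⊆ Set.Icc (fun _ : Fin m => (0:ℝ)) (fun _ => (m:ℝ)) := by
    intro a ha
    have hv : ∀ j : Fin m, cext a (j.val + 1) = a j := by
      intro j
      have : 1 ≤ j.val + 1 ∧ j.val + 1 ≤ m + 1 - 1 := by have := j.2; omega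
      rw [cext, dif_pos this]
      rfl
    refine ⟨fun j => ?_, fun j => ?_⟩
    · have := (ha j.val j.2).1
      have h2 := hv j
      exact this.trans_eq h2
    · have h1 := cext_le ha (j.val+1) (by have := j.2; omega)
      rw [hv] at h1
      refine h1.trans ?_
      have h3 : j.val + 1 ≤ m := by
        have := j.2
        omega
      show ((j.val + 1 : ℕ) : ℝ) ≤ (m:ℝ)
      exact_mod_cast h3
  exact (measure_mono hsub).trans_lt (isCompact_Icc.measure_lt_top)

lemma dinv_nonneg {m : ℕ} (a : Fin m → ℝ) : 0 ≤ dinv (m+1) a := by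
  rw [dinv_con]; exact DD_nonneg _ _

lemma area_nonneg {m : ℕ} : ∀ᵐ a ∂(lam m), 0 ≤ area (m+1) a := by
  unfold lam
  rw [ae_restrict_iff' (areaPoly_meas m)]
  refine ae_of_all _ fun a ha => ?_
  refine le_of_le_of_eq ?_ (area_con a).symm
  exact Finset.sum_nonneg fun i _ => ((areaPoly_con a).1 ha).1 i

lemma JJ_lam (s t : ℝ) (m : ℕ) : JJ s t (m+1) = ∫ a, Real.exp (-(t * area (m+1) a) - s * dinv (m+1) a) ∂(lam m) := rfl

lemma JJ_tend {m : ℕ} {s t : ℝ} (hs : 0 ≤ s) (ht : 0 ≤ t) :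
    Tendsto (fun k : ℕ => JJ (s + 1 / ((k:ℝ) + 1)) (t + 1 / ((k:ℝ) + 1)) (m+1)) atTop (nhds (JJ s t (m+1))) := by
  simp only [JJ_lam]
  refine tendsto_integral_of_dominated_convergence (fun _ => 1) ?_ (integrable_const 1) ?_ ?_
  · intro k
    have h1 := area_meas m
    have h2 := dinv_meas m
    refine Measurable.aestronglyMeasurable ?_
    exact Real.measurable_exp.comp (((h1.const_mul _).neg).sub (h2.const_mul _))
  · intro k
    filter_upwards [area_nonneg] with a ha
    have hd := dinv_nonneg a
    rw [Real.norm_eq_abs, abs_of_pos (Real.exp_pos _), Real.exp_le_one_iff]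
    have h1 : 0 ≤ (t + 1 / ((k:ℝ) + 1)) * area (m+1) a := mul_nonneg (by positivity) ha
    have h2 : 0 ≤ (s + 1 / ((k:ℝ) + 1)) * dinv (m+1) a := mul_nonneg (by positivity) hd
    linarith
  · refine ae_of_all _ fun a => ?_
    have h := tendsto_one_div_add_atTop_nhds_zero_nat (𝕜 := ℝ)
    have hc : Continuous (fun e : ℝ => Real.exp (-((t + e) * area (m+1) a) - (s + e) * dinv (m+1) a)) := by fun_prop
    have := (hc.tendsto 0).comp h
    simpa [Function.comp_def] using this

lemma JJ_symm' {m : ℕ} {s t : ℝ} (hs : 0 ≤ s) (ht : 0 ≤ t) : JJ s t (m+1) = JJ t s (m+1) := by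
  refine tendsto_nhds_unique (JJ_tend hs ht) ?_
  refine (JJ_tend ht hs).congr fun k => ?_
  exact JJ_symm (by positivity) (by positivity)

def uu : (ℝ≥0 × ℝ≥0) →ᵇ ℝ := BoundedContinuousFunction.ofNormedAddCommGroup
  (fun p => Real.exp (-(p.1 : ℝ))) (by fun_prop) 1 (by
    intro p
    rw [Real.norm_eq_abs, abs_of_pos (Real.exp_pos _), Real.exp_le_one_iff]
    simp)

def vv : (ℝ≥0 × ℝ≥0) →ᵇ ℝ := BoundedContinuousFunction.ofNormedAddCommGroup
  (fun p => Real.exp (-(p.2 : ℝ))) (by fun_prop) 1 (by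
    intro p
    rw [Real.norm_eq_abs, abs_of_pos (Real.exp_pos _), Real.exp_le_one_iff]
    simp)

def algA : StarSubalgebra ℝ ((ℝ≥0 × ℝ≥0) →ᵇ ℝ) :=
  { Algebra.adjoin ℝ ({uu, vv} : Set ((ℝ≥0 × ℝ≥0) →ᵇ ℝ)) with
    star_mem' := by
      intro a ha
      have : star a = a := by ext x; simp
      rw [this]; exact ha }

lemma uniq {P Q : Measure (ℝ≥0 × ℝ≥0)} [IsFiniteMeasure P] [IsFiniteMeasure Q]
    (h : ∀ i j : ℕ, ∫ p, Real.exp (-(i * (p.1:ℝ)) - j * (p.2:ℝ)) ∂P = ∫ p, Real.exp (-(i * (p.1:ℝ)) - j * (p.2:ℝ)) ∂Q) :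
    P = Q := by
  refine ext_of_forall_mem_subalgebra_integral_eq_of_pseudoEMetric_complete_countable (𝕜 := ℝ) (A := algA) ?_ ?_
  · intro x y hxy
    have hu : uu ∈ algA := Algebra.subset_adjoin (by simp)
    have hv : vv ∈ algA := Algebra.subset_adjoin (by simp)
    by_cases h1 : x.1 = y.1
    · have h2 : x.2 ≠ y.2 := fun h2 => hxy (Prod.ext h1 h2)
      refine ⟨vv, ⟨_, ⟨vv, hv, rfl⟩, rfl⟩, ?_⟩
      simpa [vv] using h2
    · refine ⟨uu, ⟨_, ⟨uu, hu, rfl⟩, rfl⟩, ?_⟩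
      simpa [uu] using h1
  · intro g hg
    have hg' : g ∈ Subalgebra.toSubmodule (Algebra.adjoin ℝ ({uu, vv} : Set ((ℝ≥0 × ℝ≥0) →ᵇ ℝ))) := hg
    rw [Algebra.adjoin_eq_span] at hg'
    induction hg' using Submodule.span_induction with
    | mem x hx =>
      obtain ⟨i, j, rfl⟩ := (Submonoid.mem_closure_pair _ _ _).1 hx
      have e : ∀ p : ℝ≥0 × ℝ≥0, (uu ^ i * vv ^ j) p = Real.exp (-(i * (p.1:ℝ)) - j * (p.2:ℝ)) := by
        intro p
        simp only [BoundedContinuousFunction.coe_mul, BoundedContinuousFunction.coe_pow, Pi.mul_apply, Pi.pow_apply]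
        simp only [uu, vv, BoundedContinuousFunction.coe_ofNormedAddCommGroup]
        rw [← Real.exp_nat_mul, ← Real.exp_nat_mul, ← Real.exp_add]
        congr 1
        ring
      simp only [e]
      exact h i j
    | zero => simp
    | add x y hx hy h1 h2 =>
      simp only [BoundedContinuousFunction.coe_add, Pi.add_apply]
      have hx' := Algebra.adjoin_eq_span ℝ ({uu, vv} : Set ((ℝ≥0 × ℝ≥0) →ᵇ ℝ))
      rw [integral_add (x.integrable _) (y.integrable _), integral_add (x.integrable _) (y.integrable _)]
      rw [← hx'] at hx hy
      rw [h1 hx, h2 hy]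
    | smul c x hx h1 =>
      simp only [BoundedContinuousFunction.coe_smul]
      have hx' := Algebra.adjoin_eq_span ℝ ({uu, vv} : Set ((ℝ≥0 × ℝ≥0) →ᵇ ℝ))
      rw [integral_smul, integral_smul]
      rw [← hx'] at hx
      rw [h1 hx]

lemma symm_succ (m : ℕ) : Measure.map Prod.swap (qtMeasure (m+1)) = qtMeasure (m+1) := by
  have hd := dinv_meas m
  have ha := area_meas m
  have hdm := hd.real_toNNReal
  have ham := ha.real_toNNReal
  have key : Measure.map (fun a : Fin m → ℝ => ((dinv (m+1) a).toNNReal, (area (m+1) a).toNNReal)) (lam m) = 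
    Measure.map (fun a : Fin m → ℝ => ((area (m+1) a).toNNReal, (dinv (m+1) a).toNNReal)) (lam m) := by
    apply uniq
    intro i j
    have hmeas : Measurable (fun p : ℝ≥0 × ℝ≥0 => Real.exp (-(i * (p.1:ℝ)) - j * (p.2:ℝ))) := by fun_prop
    rw [integral_map (hdm.prodMk ham).aemeasurable hmeas.aestronglyMeasurable,
      integral_map (ham.prodMk hdm).aemeasurable hmeas.aestronglyMeasurable]
    have e1 : ∫ a, Real.exp (-(i * ((dinv (m+1) a).toNNReal : ℝ)) - j * ((area (m+1) a).toNNReal : ℝ)) ∂(lam m) = JJ i j (m+1) := by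
      rw [JJ_lam]
      refine integral_congr_ae ?_
      filter_upwards [area_nonneg] with a h
      rw [Real.coe_toNNReal _ h, Real.coe_toNNReal _ (dinv_nonneg a)]
      congr 1; ring
    have e2 : ∫ a, Real.exp (-(i * ((area (m+1) a).toNNReal : ℝ)) - j * ((dinv (m+1) a).toNNReal : ℝ)) ∂(lam m) = JJ j i (m+1) := by
      rw [JJ_lam]
      refine integral_congr_ae ?_
      filter_upwards [area_nonneg] with a h
      rw [Real.coe_toNNReal _ h, Real.coe_toNNReal _ (dinv_nonneg a)]
    exact (e1.trans (JJ_symm' (by positivity) (by positivity))).trans e2.symm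
  have hq : qtMeasure (m+1) = Measure.map (fun a : Fin m → ℝ => (dinv (m+1) a, area (m+1) a)) (lam m) := rfl
  have hcoe : Measurable (fun p : ℝ≥0 × ℝ≥0 => ((p.1 : ℝ), (p.2 : ℝ))) := by fun_prop
  have k1 := congrArg (Measure.map (fun p : ℝ≥0 × ℝ≥0 => ((p.1 : ℝ), (p.2 : ℝ)))) key
  rw [Measure.map_map hcoe (hdm.prodMk ham), Measure.map_map hcoe (ham.prodMk hdm)] at k1
  rw [hq, Measure.map_map measurable_swap (hd.prodMk ha)]
  have f1 : Measure.map (fun a : Fin m → ℝ => (dinv (m+1) a, area (m+1) a)) (lam m) = 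
      Measure.map ((fun p : ℝ≥0 × ℝ≥0 => ((p.1 : ℝ), (p.2 : ℝ))) ∘ fun a : Fin m → ℝ => ((dinv (m+1) a).toNNReal, (area (m+1) a).toNNReal)) (lam m) := by
    refine Measure.map_congr ?_
    filter_upwards [area_nonneg] with a h
    have h' : 0 ≤ area (m+1) a := h
    simp only [Function.comp, Prod.swap, Real.coe_toNNReal _ h', Real.coe_toNNReal _ (dinv_nonneg a)]
  have f2 : Measure.map (Prod.swap ∘ fun a : Fin m → ℝ => (dinv (m+1) a, area (m+1) a)) (lam m) = 
      Measure.map ((fun p : ℝ≥0 × ℝ≥0 => ((p.1 : ℝ), (p.2 : ℝ))) ∘ fun a : Fin m → ℝ => ((area (m+1) a).toNNReal, (dinv (m+1) a).toNNReal)) (lam m) := by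
    refine Measure.map_congr ?_
    filter_upwards [area_nonneg] with a h
    have h' : 0 ≤ area (m+1) a := h
    simp only [Function.comp, Prod.swap, Real.coe_toNNReal _ h', Real.coe_toNNReal _ (dinv_nonneg a)]
  rw [f1, f2, k1]

end QT

/-- The `q,t`-Catalan measure `μ_n` is symmetric about the line `y = x`. -/
theorem qtMeasure_symm (n : ℕ) (hn : 2 ≤ n) :
    Measure.map Prod.swap (qtMeasure n) = qtMeasure n := by
  obtain ⟨m, rfl⟩ : ∃ m, n = m + 1 := ⟨n - 1, by omega⟩
  exact QT.symm_succ m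
end
end

section
/- The total mass of the q,t-Catalan measure is μ_n(ℝ²) = n^{n−2}/(n−1)!; equivalently, the (n−1)-dimensional Lebesgue volume of the area polytope A_n ⊆ ℝ^{n−1} equals n^{n−2}/(n−1)!. -/
open MeasureTheory Finset Filter

noncomputable section

def PP (m : ℕ) (x : ℝ) : Set (Fin m → ℝ) :=
  {a | ∀ i : Fin m, 0 ≤ a i ∧ a i ≤ (Fin.cons x a : Fin (m+1) → ℝ) i.castSucc + 1}

lemma PP_meas (m : ℕ) (x : ℝ) : MeasurableSet (PP m x) := by
  have : PP m x = ⋂ i : Fin m, {a | 0 ≤ a i ∧ a i ≤ (Fin.cons x a : Fin (m+1) → ℝ) i.castSucc + 1} := by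
    ext a; simp [PP]
  rw [this]
  refine MeasurableSet.iInter fun i => ?_
  have hc : Measurable (fun a : Fin m → ℝ => (Fin.cons x a : Fin (m+1) → ℝ) i.castSucc) := by
    generalize i.castSucc = j
    refine Fin.cases ?_ (fun j => ?_) j
    · simp
    · simpa using measurable_pi_apply j
  exact (measurableSet_le measurable_const (measurable_pi_apply i)).inter
    (measurableSet_le (measurable_pi_apply i) (hc.add_const 1))

lemma PP_cons (m : ℕ) (x y : ℝ) (b : Fin m → ℝ) :
    (Fin.cons y b : Fin (m+1) → ℝ) ∈ PP (m+1) x ↔ y ∈ Set.Icc 0 (x+1) ∧ b ∈ PP m y := by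
  simp only [PP, Set.mem_ofPred_eq, Fin.forall_fin_succ, Fin.cons_zero, Fin.cons_succ,
    Fin.castSucc_zero, Set.mem_Icc, ← Fin.succ_castSucc]

lemma PP_vol_succ (m : ℕ) (x : ℝ) :
    volume (PP (m+1) x) = ∫⁻ y in Set.Icc 0 (x+1), volume (PP m y) := by
  have h := (volume_preserving_piFinSuccAbove (fun _ : Fin (m+1) => ℝ) 0).symm
  rw [← h.measure_preimage (PP_meas (m+1) x).nullMeasurableSet, Measure.volume_eq_prod,
    Measure.prod_apply (h.measurable (PP_meas _ _)), ← lintegral_indicator measurableSet_Icc]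
  congr 1
  ext y
  have hh : ∀ b : Fin m → ℝ, (MeasurableEquiv.piFinSuccAbove (fun _ : Fin (m+1) => ℝ) 0).symm (y, b)
      = (Fin.cons y b : Fin (m+1) → ℝ) := by
    intro b
    simp [MeasurableEquiv.piFinSuccAbove, Fin.insertNthEquiv]
  by_cases hy : y ∈ Set.Icc 0 (x+1)
  · rw [Set.indicator_of_mem hy]
    congr 1
    ext b
    simp only [Set.mem_preimage, hh, PP_cons, hy, true_and]
  · rw [Set.indicator_of_notMem hy]
    convert measure_empty (μ := (volume : Measure (Fin m → ℝ)))
    ext b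
    simp only [Set.mem_preimage, hh, PP_cons, hy, false_and, Set.mem_empty_iff_false]

lemma lint (f F : ℝ → ℝ) (z : ℝ) (hz : 0 ≤ z) (hf : Continuous f) (h0 : ∀ y, 0 ≤ y → 0 ≤ f y)
    (hF : ∀ y, HasDerivAt F (f y) y) :
    ∫⁻ y in Set.Icc 0 z, ENNReal.ofReal (f y) = ENNReal.ofReal (F z - F 0) := by
  rw [← ofReal_integral_eq_lintegral_ofReal (hf.integrableOn_Icc)
    ((ae_restrict_iff' measurableSet_Icc).2 (Eventually.of_forall fun y hy => h0 y hy.1)),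
    integral_Icc_eq_integral_Ioc, ← intervalIntegral.integral_of_le hz,
    intervalIntegral.integral_eq_sub_of_hasDerivAt (fun y _ => hF y) (hf.intervalIntegrable _ _)]

lemma PP_vol (m : ℕ) : ∀ x : ℝ, 0 ≤ x → volume (PP (m+1) x) =
    ENNReal.ofReal ((x+1) * (x+m+2)^m / (Nat.factorial (m+1) : ℝ)) := by
  induction m with
  | zero =>
    intro x hx
    rw [PP_vol_succ]
    have : ∀ y, volume (PP 0 y) = 1 := by
      intro y
      have : PP 0 y = Set.univ := by ext a; simp [PP]
      rw [this]; simp [volume_pi]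
    simp [this]
  | succ m ih =>
    intro x hx
    rw [PP_vol_succ, setLIntegral_congr_fun measurableSet_Icc (fun y hy => ih y hy.1),
      lint _ (fun y => y * (y+m+2)^(m+1) / (Nat.factorial (m+2) : ℝ)) (x+1) (by linarith)
        (by fun_prop) (fun y hy => by positivity) (fun y => ?_)]
    · congr 1
      push_cast
      ring
    · have h1 : HasDerivAt (fun y : ℝ => y+m+2) 1 y := ((hasDerivAt_id y).add_const _).add_const _
      have h2 := ((hasDerivAt_id y).mul (h1.pow (m+1))).div_const (Nat.factorial (m+2) : ℝ)
      refine HasDerivAt.congr_deriv h2 ?_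
      rw [Nat.factorial_succ (m+1)]
      have : (Nat.factorial (m+1) : ℝ) ≠ 0 := by positivity
      have : (m+2 : ℝ) ≠ 0 := by positivity
      push_cast
      simp only [id, Pi.pow_apply, Nat.add_sub_cancel]
      have : (m+1+1 : ℝ) ≠ 0 := by positivity
      field_simp
      ring

lemma areaPoly_eq (m : ℕ) : areaPoly (m+1) = PP m 0 := by
  ext a
  simp only [areaPoly, PP, Set.mem_ofPred_eq, Nat.add_sub_cancel]
  have key : ∀ i : Fin m, cext (k := m) a (i+1) = a i ∧
      cext (k := m) a i = (Fin.cons 0 a : Fin (m+1) → ℝ) i.castSucc := by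
    rintro ⟨i, hi⟩
    refine ⟨by simp [cext, hi], ?_⟩
    rcases i with _ | i
    · simp [cext]
    · have : (Fin.castSucc ⟨i+1, hi⟩ : Fin (m+1)) = Fin.succ ⟨i, by omega⟩ := rfl
      rw [this, Fin.cons_succ]
      simp [cext, hi.le]
  constructor
  · intro h i
    have := h i i.2
    rwa [(key i).1, (key i).2] at this
  · intro h i hi
    have := h ⟨i, hi⟩
    rwa [← (key ⟨i, hi⟩).1, ← (key ⟨i, hi⟩).2] at this

lemma cext_meas {k : ℕ} (i : ℕ) : Measurable (fun a : Fin k → ℝ => cext a i) := by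
  unfold cext
  split_ifs
  · exact measurable_pi_apply _
  · exact measurable_const

lemma sc_meas : Measurable sc := by
  have : Continuous sc := by unfold sc; fun_prop
  exact this.measurable

/-- The total mass of the q,t-Catalan measure is `n^{n-2}/(n-1)!`; equivalently, the
Lebesgue volume of the area polytope `A_n ⊆ ℝ^{n-1}` is `n^{n-2}/(n-1)!`. -/
theorem qtMeasure_total_mass (n : ℕ) (hn : 2 ≤ n) :
    qtMeasure n Set.univ =
      ENNReal.ofReal ((n : ℝ) ^ (n - 2) / (Nat.factorial (n - 1) : ℝ)) ∧
    volume (areaPoly n) =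
      ENNReal.ofReal ((n : ℝ) ^ (n - 2) / (Nat.factorial (n - 1) : ℝ)) := by
  have hv : volume (areaPoly n) =
      ENNReal.ofReal ((n : ℝ) ^ (n - 2) / (Nat.factorial (n - 1) : ℝ)) := by
    obtain ⟨m, rfl⟩ := Nat.exists_eq_add_of_le' hn
    rw [areaPoly_eq (m+1)]
    refine (PP_vol m 0 le_rfl).trans ?_
    simp
  refine ⟨?_, hv⟩
  have hm : Measurable (fun a : Fin (n-1) → ℝ => (dinv n a, area n a)) := by
    refine Measurable.prodMk ?_ ?_
    · unfold dinv
      exact Finset.measurable_sum _ fun j _ => Finset.measurable_sum _ fun i _ =>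
        sc_meas.comp ((cext_meas i).sub (cext_meas j))
    · unfold area
      exact Finset.measurable_sum _ fun j _ => cext_meas j
  rw [qtMeasure, Measure.map_apply hm MeasurableSet.univ, Set.preimage_univ,
    Measure.restrict_apply_univ, hv]
end
end
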